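/- arXiv:2109.07325 — 3 statements merged into one kernel-verified Lean document; each statement's English description precedes it below -/
import Mathlib

section
/- For every n ∈ ℕ, H_{1,3}(3n) = H_{2,3}(3n), and this common value equals σ(3n) − (1/2)·∑_{d∣3n} min(d, 3n/d) − σ(n) + 3·δ_{3∣n}·∑_{d∣(n/3), d²<n/3} d + (1/4)·δ_{12n=□}·√(12n). -/
open scoped BigOperators

namespace HurwitzPaper

/-- Evaluation of the binary quadratic form `(a,b,c)` (i.e. `a x² + b x y + c y²`). -/
def formEval (Q : ℤ × ℤ × ℤ) (x y : ℤ) : ℤ :=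
  Q.1 * x ^ 2 + Q.2.1 * x * y + Q.2.2 * y ^ 2

/-- Discriminant `b² - 4ac` of the form `(a,b,c)`. -/
def formDisc (Q : ℤ × ℤ × ℤ) : ℤ := Q.2.1 ^ 2 - 4 * Q.1 * Q.2.2

/-- Right action of `γ ∈ SL₂(ℤ)` on a binary quadratic form: `(Q∘γ)(x,y) = Q(ax+by, cx+dy)`. -/
def formAct (γ : Matrix.SpecialLinearGroup (Fin 2) ℤ) (Q : ℤ × ℤ × ℤ) : ℤ × ℤ × ℤ :=
  (formEval Q (γ.1 0 0) (γ.1 1 0),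
   formEval Q (γ.1 0 0 + γ.1 0 1) (γ.1 1 0 + γ.1 1 1)
     - formEval Q (γ.1 0 0) (γ.1 1 0) - formEval Q (γ.1 0 1) (γ.1 1 1),
   formEval Q (γ.1 0 1) (γ.1 1 1))

/-- A form is positive definite iff its leading coefficient is positive and its
discriminant is negative. -/
def IsPosDef (Q : ℤ × ℤ × ℤ) : Prop := 0 < Q.1 ∧ formDisc Q < 0

/-- `SL₂(ℤ)`-equivalence classes of positive definite integral binary quadratic forms
of discriminant `-N`. -/
abbrev FormClasses (N : ℤ) :=
  Quot (fun (Q Q' : {Q : ℤ × ℤ × ℤ // formDisc Q = -N ∧ IsPosDef Q}) =>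
    ∃ γ : Matrix.SpecialLinearGroup (Fin 2) ℤ, formAct γ Q.1 = Q'.1)

/-- The Hurwitz class number `H(N)`: each class of positive definite forms of
discriminant `-N` is counted with weight `1/ω_Q = 2/#Γ_Q`, where `Γ_Q` is the stabilizer
of (a representative of) the class in `SL₂(ℤ)`; `H(0) = -1/12`, and `H(N) = 0` when no
such forms exist (in particular for `N < 0` and `N ≡ 1, 2 (mod 4)`). -/
noncomputable def hurwitzClassNumber (N : ℤ) : ℝ :=
  if N = 0 then -(1 / 12)
  else ∑ᶠ c : FormClasses N,
    (2 : ℝ) / (Nat.card {γ : Matrix.SpecialLinearGroup (Fin 2) ℤ //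
      formAct γ c.out.1 = c.out.1})

/-- `H_{κ,m,M}(n) = ∑_{t ≡ m (mod M)} t^κ H(4n - t²)`. -/
noncomputable def HH (κ : ℕ) (m : ℤ) (M : ℕ) (n : ℕ) : ℝ :=
  ∑ᶠ t : ℤ, if t % (M : ℤ) = m % (M : ℤ) then
    (t : ℝ) ^ κ * hurwitzClassNumber (4 * n - t ^ 2) else 0

/-- `a(n)`: the `n`-th Fourier coefficient of `η(3τ)⁸ = q ∏_{k≥1} (1-q^{3k})⁸`
(the factors with `k > n` do not affect the coefficient of `q^n`). -/
noncomputable def etaCoeff (n : ℕ) : ℤ :=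
  Polynomial.coeff (Polynomial.X * ∏ k ∈ Finset.Icc 1 n, (1 - Polynomial.X ^ (3 * k)) ^ 8 : Polynomial ℤ) n



abbrev V6 := ℤ × ℤ × ℤ × ℤ × ℤ × ℤ

lemma ncard_eq_of_inv {α β : Type*} {s : Set α} {t : Set β} (f : α → β) (g : β → α)
    (hf : ∀ x ∈ s, f x ∈ t) (hg : ∀ y ∈ t, g y ∈ s)
    (h1 : ∀ x ∈ s, g (f x) = x) (h2 : ∀ y ∈ t, f (g y) = y) : s.ncard = t.ncard := by
  apply Set.ncard_congr (fun a _ => f a)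
  · exact hf
  · intro a b ha hb h
    rw [← h1 a ha, ← h1 b hb]
    exact congrArg g h
  · intro b hb
    exact ⟨g b, hg b hb, h2 b hb⟩

def Ty (l μ ν : ℤ) : Prop := (l = 1 ∧ μ = 1 ∧ ν = 1) ∨ (l = 3 ∧ ((μ = 3 ∧ ν = 1) ∨ (μ = 1 ∧ ν = 3)))

lemma Ty.swap {l μ ν : ℤ} (h : Ty l μ ν) : Ty l ν μ := by
  unfold Ty at *; omega

def Qp (ν a b c d : ℤ) : Prop := 0 < a - d ∧ a - d ≤ ν * c ∧ c ≤ b ∧ (b = c → a < 0)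
def Qm (ν a b c d : ℤ) : Prop := 0 ≤ a - d ∧ a - d < ν * c ∧ c ≤ b ∧ (b = c → 0 < a)

def GP (l k A B D : ℤ) : Set V6 := {x | match x with
  | (μ, ν, p, q, r, s) => Ty l μ ν ∧ μ * p * s + ν * q * r = k ∧
      Qp ν (p * A) (q * D - μ * p * B) (r * A) (ν * r * B + s * D)}
def GM (l k A B D : ℤ) : Set V6 := {x | match x with
  | (μ, ν, p, q, r, s) => Ty l μ ν ∧ μ * p * s + ν * q * r = k ∧
      Qm ν (p * A) (q * D - μ * p * B) (r * A) (ν * r * B + s * D)}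

def phi (A B D : ℤ) (x : V6) : V6 := match x with
  | (μ, ν, p, q, r, s) =>
    if q * D - μ * p * B = r * A then (ν, μ, -r + μ * p, s + ν * q, p, -q)
    else if p * A = ν * r * B + s * D then
      (if q * D - μ * p * B - μ * (p * A) > r * A then (μ, ν, p + ν * r, q - μ * s, r, s)
        else (ν, μ, -r, s, p, -q))
    else (μ, ν, p, q, r, s)

def psi (A B D : ℤ) (x : V6) : V6 := match x with
  | (μ, ν, p, q, r, s) =>
    if q * D - μ * p * B = r * A then (ν, μ, r, -s, -p, q)
    else if p * A - (ν * r * B + s * D) = ν * (r * A) then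
      (if q * D - μ * p * B + μ * (ν * r * B + s * D) > r * A then (μ, ν, p - ν * r, q + μ * s, r, s)
        else (ν, μ, r, -s, -(p - ν * r), q + μ * s))
    else (μ, ν, p, q, r, s)

lemma wall (l k A B D : ℤ) : (GM l k A B D).ncard = (GP l k A B D).ncard := by
  apply ncard_eq_of_inv (phi A B D) (psi A B D)
  · rintro ⟨μ, ν, p, q, r, s⟩ ⟨ht, hk, hq⟩
    simp only [phi]
    unfold Qm at hq
    split_ifs with h1 h2 h3
    · refine ⟨ht.swap, ?_, ?_⟩
      · rw [← hk]; ring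
      · unfold Qp
        rcases ht with ⟨_, rfl, rfl⟩ | ⟨_, ⟨rfl, rfl⟩ | ⟨rfl, rfl⟩⟩ <;> ring_nf at * <;> omega
    · refine ⟨ht, ?_, ?_⟩
      · rw [← hk]; ring
      · unfold Qp
        rcases ht with ⟨_, rfl, rfl⟩ | ⟨_, ⟨rfl, rfl⟩ | ⟨rfl, rfl⟩⟩ <;> ring_nf at * <;> omega
    · refine ⟨ht.swap, ?_, ?_⟩
      · rw [← hk]; ring
      · unfold Qp
        rcases ht with ⟨_, rfl, rfl⟩ | ⟨_, ⟨rfl, rfl⟩ | ⟨rfl, rfl⟩⟩ <;> ring_nf at * <;> omega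
    · refine ⟨ht, ?_, ?_⟩
      · rw [← hk]
      · unfold Qp
        rcases ht with ⟨_, rfl, rfl⟩ | ⟨_, ⟨rfl, rfl⟩ | ⟨rfl, rfl⟩⟩ <;> ring_nf at * <;> omega
  · rintro ⟨μ, ν, p, q, r, s⟩ ⟨ht, hk, hq⟩
    simp only [psi]
    unfold Qp at hq
    split_ifs with h1 h2 h3
    · refine ⟨ht.swap, ?_, ?_⟩
      · rw [← hk]; ring
      · unfold Qm
        rcases ht with ⟨_, rfl, rfl⟩ | ⟨_, ⟨rfl, rfl⟩ | ⟨rfl, rfl⟩⟩ <;> ring_nf at * <;> omega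
    · refine ⟨ht, ?_, ?_⟩
      · rw [← hk]; ring
      · unfold Qm
        rcases ht with ⟨_, rfl, rfl⟩ | ⟨_, ⟨rfl, rfl⟩ | ⟨rfl, rfl⟩⟩ <;> ring_nf at * <;> omega
    · refine ⟨ht.swap, ?_, ?_⟩
      · rw [← hk]; ring
      · unfold Qm
        rcases ht with ⟨_, rfl, rfl⟩ | ⟨_, ⟨rfl, rfl⟩ | ⟨rfl, rfl⟩⟩ <;> ring_nf at * <;> omega
    · refine ⟨ht, ?_, ?_⟩
      · rw [← hk]
      · unfold Qm
        rcases ht with ⟨_, rfl, rfl⟩ | ⟨_, ⟨rfl, rfl⟩ | ⟨rfl, rfl⟩⟩ <;> ring_nf at * <;> omega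
  · rintro ⟨μ, ν, p, q, r, s⟩ ⟨ht, hk, hq⟩
    unfold Qm at hq
    simp only [phi]
    split_ifs with h1 h2 h3
    · simp only [psi]
      rw [if_neg, if_pos, if_neg]
      · ext <;> simp
      all_goals
        rcases ht with ⟨_, rfl, rfl⟩ | ⟨_, ⟨rfl, rfl⟩ | ⟨rfl, rfl⟩⟩ <;> ring_nf at * <;> omega
    · simp only [psi]
      rw [if_neg, if_pos, if_pos]
      · ext <;> simp
      all_goals
        rcases ht with ⟨_, rfl, rfl⟩ | ⟨_, ⟨rfl, rfl⟩ | ⟨rfl, rfl⟩⟩ <;> ring_nf at * <;> omega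
    · simp only [psi]
      rw [if_pos]
      · ext <;> simp
      all_goals
        rcases ht with ⟨_, rfl, rfl⟩ | ⟨_, ⟨rfl, rfl⟩ | ⟨rfl, rfl⟩⟩ <;> ring_nf at * <;> omega
    · simp only [psi]
      rw [if_neg, if_neg]
      all_goals
        rcases ht with ⟨_, rfl, rfl⟩ | ⟨_, ⟨rfl, rfl⟩ | ⟨rfl, rfl⟩⟩ <;> ring_nf at * <;> omega
  · rintro ⟨μ, ν, p, q, r, s⟩ ⟨ht, hk, hq⟩
    unfold Qp at hq
    simp only [psi]
    split_ifs with h1 h2 h3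
    · simp only [phi]
      rw [if_neg, if_pos, if_neg]
      · ext <;> simp
      all_goals
        rcases ht with ⟨_, rfl, rfl⟩ | ⟨_, ⟨rfl, rfl⟩ | ⟨rfl, rfl⟩⟩ <;> ring_nf at * <;> omega
    · simp only [phi]
      rw [if_neg, if_pos, if_pos]
      · ext <;> simp
      all_goals
        rcases ht with ⟨_, rfl, rfl⟩ | ⟨_, ⟨rfl, rfl⟩ | ⟨rfl, rfl⟩⟩ <;> ring_nf at * <;> omega
    · simp only [phi]
      rw [if_pos]
      · ext <;> simp
      all_goals
        rcases ht with ⟨_, rfl, rfl⟩ | ⟨_, ⟨rfl, rfl⟩ | ⟨rfl, rfl⟩⟩ <;> ring_nf at * <;> omega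
    · simp only [phi]
      rw [if_neg, if_neg]
      all_goals
        rcases ht with ⟨_, rfl, rfl⟩ | ⟨_, ⟨rfl, rfl⟩ | ⟨rfl, rfl⟩⟩ <;> ring_nf at * <;> omega



lemma Ty.pos {l μ ν : ℤ} (h : Ty l μ ν) : 0 < μ ∧ 0 < ν ∧ μ * ν ≤ 3 ∧ μ * ν = l := by
  rcases h with ⟨rfl, rfl, rfl⟩ | ⟨rfl, ⟨rfl, rfl⟩ | ⟨rfl, rfl⟩⟩ <;> norm_num

lemma bound_c {l μ ν a b c d n : ℤ} (ht : Ty l μ ν) (hn : μ * a * d + ν * b * c = n)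
    (h0 : 0 ≤ a - d) (h1 : a - d ≤ ν * c) (h2 : c ≤ b) :
    ν * c ^ 2 ≤ 4 * n ∧ μ * a ^ 2 ≤ 4 * n ∧ μ * (a + d) ^ 2 ≤ 4 * n := by
  obtain ⟨e, rfl⟩ : ∃ e, a = d + e := ⟨a - d, by ring⟩
  have he : 0 ≤ e := by linarith
  have he' : e ≤ ν * c := by linarith
  rcases ht with ⟨_, rfl, rfl⟩ | ⟨_, ⟨rfl, rfl⟩ | ⟨rfl, rfl⟩⟩
  · have hc : 0 ≤ c := by linarith
    have hbc : c * c ≤ b * c := mul_le_mul_of_nonneg_right h2 hc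
    have hee : e * e ≤ c * c := by nlinarith
    refine ⟨?_, ?_, ?_⟩
    · nlinarith [sq_nonneg (d + e + d)]
    · nlinarith [sq_nonneg (3 * (d + e) - 2 * e)]
    · nlinarith [sq_nonneg (d + e + d)]
  · have hc : 0 ≤ c := by linarith
    have hbc : c * c ≤ b * c := mul_le_mul_of_nonneg_right h2 hc
    have hee : e * e ≤ c * c := by nlinarith
    refine ⟨?_, ?_, ?_⟩
    · nlinarith [sq_nonneg (d + e + d)]
    · nlinarith [sq_nonneg (3 * (d + e) - 2 * e)]
    · nlinarith [sq_nonneg (d + e + d)]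
  · have hc : 0 ≤ c := by linarith
    have hbc : c * c ≤ b * c := mul_le_mul_of_nonneg_right h2 hc
    have hee : e * e ≤ 9 * (c * c) := by nlinarith
    refine ⟨?_, ?_, ?_⟩
    · nlinarith [sq_nonneg (d + e + d)]
    · nlinarith [sq_nonneg (3 * (d + e) - 2 * e)]
    · nlinarith [sq_nonneg (d + e + d)]

lemma homog (l k A B D N : ℤ) (hN : 0 < N) : GP l k (N * A) (N * B) (N * D) = GP l k A B D := by
  ext ⟨μ, ν, p, q, r, s⟩
  simp only [GP, Set.mem_ofPred_eq, Qp]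
  have e1 : p * (N * A) - (ν * r * (N * B) + s * (N * D)) = N * (p * A - (ν * r * B + s * D)) := by ring
  have e2 : ν * (r * (N * A)) = N * (ν * (r * A)) := by ring
  have e3 : r * (N * A) = N * (r * A) := by ring
  have e4 : q * (N * D) - μ * p * (N * B) = N * (q * D - μ * p * B) := by ring
  have e5 : p * (N * A) = N * (p * A) := by ring
  rw [e1, e2, e3, e4, e5, mul_le_mul_iff_right₀ hN, mul_le_mul_iff_right₀ hN]
  have : N * (q * D - μ * p * B) = N * (r * A) ↔ (q * D - μ * p * B) = r * A :=
    mul_right_inj' hN.ne'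
  rw [this]
  have : N * (p * A) < 0 ↔ p * A < 0 := by
    constructor <;> intro h <;> nlinarith
  rw [this]
  have : 0 < N * (p * A - (ν * r * B + s * D)) ↔ 0 < (p * A - (ν * r * B + s * D)) := by
    exact mul_pos_iff_of_pos_left hN
  rw [this]

lemma stepCore {μ ν p q r s A B D : ℤ} (hA : 0 < A) (hμ : 0 < μ) (hν : 0 < ν) (hr : 0 < r)
    (h1 : ν * r ∣ p * A - s * D) (h2 : p = 0 ∨ μ * p ∣ q * D - r * A) :
    Qp ν (p * A) (q * D - μ * p * B) (r * A) (ν * r * B + s * D) ↔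
    Qm ν (p * A) (q * D - μ * p * (B + 1)) (r * A) (ν * r * (B + 1) + s * D) := by
  obtain ⟨x, hx⟩ := h1
  have hR : 0 < ν * r := mul_pos hν hr
  unfold Qp Qm
  rcases eq_or_ne p 0 with rfl | hp0
  · have e1 : 0 * A - (ν * r * B + s * D) = (ν * r) * (x - B) := by linear_combination hx
    have e2 : 0 * A - (ν * r * (B + 1) + s * D) = (ν * r) * (x - B - 1) := by linear_combination hx
    have e3 : ν * (r * A) = (ν * r) * A := by ring
    rw [e1, e2, e3, mul_le_mul_iff_right₀ hR, mul_lt_mul_iff_right₀ hR,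
      mul_pos_iff_of_pos_left hR, mul_nonneg_iff_of_pos_left hR]
    simp
    omega
  obtain ⟨y, hy⟩ := h2.resolve_left hp0
  have e1 : p * A - (ν * r * B + s * D) = (ν * r) * (x - B) := by linear_combination hx
  have e2 : p * A - (ν * r * (B + 1) + s * D) = (ν * r) * (x - B - 1) := by linear_combination hx
  have e3 : ν * (r * A) = (ν * r) * A := by ring
  have e4 : q * D - μ * p * B = r * A + (μ * p) * (y - B) := by linear_combination hy
  have e5 : q * D - μ * p * (B + 1) = r * A + (μ * p) * (y - B - 1) := by linear_combination hy
  rw [e1, e2, e3, e4, e5, mul_le_mul_iff_right₀ hR, mul_lt_mul_iff_right₀ hR,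
    mul_pos_iff_of_pos_left hR, mul_nonneg_iff_of_pos_left hR, le_add_iff_nonneg_right,
    le_add_iff_nonneg_right, add_eq_left, add_eq_left]
  rcases lt_trichotomy p 0 with hp | hp | hp
  · have hP : μ * p < 0 := mul_neg_of_pos_of_neg hμ hp
    have hpA : p * A < 0 := mul_neg_of_neg_of_pos hp hA
    have f1 : 0 ≤ μ * p * (y - B) ↔ y - B ≤ 0 := by
      constructor <;> intro h <;> nlinarith
    have f2 : 0 ≤ μ * p * (y - B - 1) ↔ y - B - 1 ≤ 0 := by
      constructor <;> intro h <;> nlinarith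
    have f3 : μ * p * (y - B - 1) = 0 ↔ y - B - 1 = 0 := by
      rw [mul_eq_zero]; constructor
      · rintro (h | h) <;> omega
      · exact Or.inr
    rw [f1, f2, f3]; omega
  · exact absurd hp hp0
  · have hP : 0 < μ * p := mul_pos hμ hp
    have hpA : 0 < p * A := mul_pos hp hA
    have f1 : 0 ≤ μ * p * (y - B) ↔ 0 ≤ y - B := mul_nonneg_iff_of_pos_left hP
    have f2 : 0 ≤ μ * p * (y - B - 1) ↔ 0 ≤ y - B - 1 := mul_nonneg_iff_of_pos_left hP
    have f3 : μ * p * (y - B) = 0 ↔ y - B = 0 := by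
      rw [mul_eq_zero]; constructor
      · rintro (h | h) <;> omega
      · exact Or.inr
    rw [f1, f2, f3]; omega

lemma dvdfac {K x : ℤ} {N : ℤ} (hN : N = ((K.toNat).factorial : ℤ)) (h0 : 0 < |x|) (h : |x| ≤ K) : x ∣ N := by
  rw [hN, ← Int.natAbs_dvd, Int.natCast_dvd_natCast]
  have := Int.natCast_natAbs x
  apply Nat.dvd_factorial <;> omega

lemma step (l A B D N : ℤ) (hA : 0 < A) (hD : 0 < D) (hN : N = (((4 * D).toNat).factorial : ℤ)) :
    GP l 1 (N * A) B (N * D) = GM l 1 (N * A) (B + 1) (N * D) := by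
  have hN0 : 0 < N := by rw [hN]; exact_mod_cast Nat.factorial_pos _
  have key : ∀ μ ν p q r s B : ℤ, Ty l μ ν → μ * p * s + ν * q * r = 1 →
      0 ≤ p * (N * A) - (ν * r * B + s * (N * D)) →
      p * (N * A) - (ν * r * B + s * (N * D)) ≤ ν * (r * (N * A)) → r * (N * A) ≤ q * (N * D) - μ * p * B →
      0 < r → (ν * r ∣ p * (N * A) - s * (N * D) ∧ (p = 0 ∨ μ * p ∣ q * (N * D) - r * (N * A))) := by
    intro μ ν p q r s B ht hk h0 h1 h2 hr
    obtain ⟨hμ, hν, -, -⟩ := ht.pos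
    have hb := bound_c (n := N * A * (N * D)) ht (by linear_combination (N * A * (N * D)) * hk) h0 h1 h2
    obtain ⟨b1, b2, -⟩ := hb
    have b1' : ν * r ^ 2 ≤ 4 * D := by
      have : ν * r ^ 2 * A * (N ^ 2 * A) ≤ 4 * D * (N ^ 2 * A) := by nlinarith
      have := le_of_mul_le_mul_right this (by positivity)
      have : 0 ≤ ν * r ^ 2 := by positivity
      nlinarith
    have b2' : μ * p ^ 2 ≤ 4 * D := by
      have : μ * p ^ 2 * A * (N ^ 2 * A) ≤ 4 * D * (N ^ 2 * A) := by nlinarith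
      have := le_of_mul_le_mul_right this (by positivity)
      have : 0 ≤ μ * p ^ 2 := by positivity
      nlinarith
    constructor
    · have : ν * r ∣ N := by
        apply dvdfac hN
        · rw [abs_of_pos (by positivity)]; positivity
        · rw [abs_of_pos (by positivity)]; nlinarith
      have e : p * (N * A) - s * (N * D) = N * (p * A - s * D) := by ring
      rw [e]; exact this.mul_right _
    · by_cases hp : p = 0
      · exact Or.inl hp
      · right
        have : μ * p ∣ N := by
          apply dvdfac hN
          · exact abs_pos.mpr (by positivity)
          · rw [abs_mul, abs_of_pos hμ]
            have : |p| ≤ p ^ 2 := by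
              rw [← sq_abs]
              have := abs_pos.mpr hp
              nlinarith
            nlinarith
        have e : q * (N * D) - r * (N * A) = N * (q * D - r * A) := by ring
        rw [e]; exact this.mul_right _
  have hNA : 0 < N * A := mul_pos hN0 hA
  ext ⟨μ, ν, p, q, r, s⟩
  constructor
  · rintro ⟨ht, hk, hq⟩
    obtain ⟨hμ, hν, -, -⟩ := ht.pos
    have hr : 0 < r := by
      have h1 := hq.1.trans_le hq.2.1
      have h2 := pos_of_mul_pos_right h1 hν.le
      exact pos_of_mul_pos_left h2 hNA.le
    have := key μ ν p q r s B ht hk hq.1.le hq.2.1 hq.2.2.1 hr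
    exact ⟨ht, hk, (stepCore hNA hμ hν hr this.1 this.2).1 hq⟩
  · rintro ⟨ht, hk, hq⟩
    obtain ⟨hμ, hν, -, -⟩ := ht.pos
    have hr : 0 < r := by
      have h1 := hq.1.trans_lt hq.2.1
      have h2 := pos_of_mul_pos_right h1 hν.le
      exact pos_of_mul_pos_left h2 hNA.le
    have := key μ ν p q r s (B + 1) ht hk hq.1 hq.2.1.le hq.2.2.1 hr
    exact ⟨ht, hk, (stepCore hNA hμ hν hr this.1 this.2).2 hq⟩


lemma f_shift (l A D : ℤ) (hA : 0 < A) (hD : 0 < D) (B : ℕ) :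
    (GP l 1 A B D).ncard = (GP l 1 A 0 D).ncard := by
  set N : ℤ := (((4 * D).toNat).factorial : ℤ) with hN
  have hN0 : 0 < N := by rw [hN]; exact_mod_cast Nat.factorial_pos _
  have h : ∀ k : ℕ, (GP l 1 (N * A) k (N * D)).ncard = (GP l 1 (N * A) 0 (N * D)).ncard := by
    intro k
    induction k with
    | zero => simp
    | succ k ih =>
      rw [← ih, step l A k D N hA hD hN, wall]
      push_cast; rfl
  rw [← homog l 1 A B D N hN0, ← homog l 1 A 0 D N hN0, mul_zero, ← h ((N * B).toNat)]
  rw [Int.toNat_of_nonneg (by positivity)]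



lemma base_core {l μ ν p q r s A D : ℤ} (ht : Ty l μ ν) (hA : 0 < A) (hD : 0 < D)
    (hk : μ * p * s + ν * q * r = 1) (hq : Qp ν (p * A) (q * D) (r * A) (s * D)) :
    A < D ∧ μ = l ∧ ν = 1 ∧ p = 1 ∧ q = 1 ∧ r = 1 ∧ s = 0 := by
  obtain ⟨hμ, hν, hμν, hl⟩ := ht.pos
  obtain ⟨h1, h2, h3, h4⟩ := hq
  have hr : 0 < r := by
    have h1 := h1.trans_le h2
    exact pos_of_mul_pos_left (pos_of_mul_pos_right h1 hν.le) hA.le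
  have hq0 : 0 < q := by
    have : 0 < q * D := by nlinarith
    exact pos_of_mul_pos_left this hD.le
  have hqr : 0 < q * r := mul_pos hq0 hr
  have hνqr : 0 < ν * (q * r) := mul_pos hν hqr
  have hps : p * s ≤ 0 := by
    by_contra h
    push Not at h
    have := mul_pos hμ h
    nlinarith
  rcases eq_or_lt_of_le hps with h0 | h0
  · have e : ν * (q * r) = 1 := by linear_combination hk - μ * h0
    have hν1 : ν = 1 := Int.eq_one_of_dvd_one hν.le ⟨_, e.symm⟩
    subst hν1
    have hq1 : q = 1 := Int.eq_one_of_dvd_one hq0.le ⟨r, by linarith⟩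
    subst hq1
    have hr1 : r = 1 := by linarith
    subst hr1
    rcases mul_eq_zero.1 h0 with rfl | rfl
    · have hs : s < 0 := by nlinarith
      have : D = A := by nlinarith
      have := h4 (by linarith)
      linarith
    · have hp : 0 < p := by nlinarith
      have hp1 : p = 1 := by nlinarith
      subst hp1
      refine ⟨?_, by linarith, rfl, rfl, rfl, rfl, rfl⟩
      rcases eq_or_ne D A with rfl | hne
      · have := h4 rfl
        linarith
      · have : A ≤ D := by linarith
        exact lt_of_le_of_ne this (Ne.symm hne)
  · exfalso
    have hp : 0 < p := by
      by_contra hp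
      push Not at hp
      have hs : 0 < s := by
        by_contra hs
        push Not at hs
        nlinarith [mul_nonneg_of_nonpos_of_nonpos hp hs]
      nlinarith
    have hs : s < 0 := by
      by_contra hs
      push Not at hs
      nlinarith
    obtain ⟨t, rfl⟩ : ∃ t, s = -t := ⟨-s, by ring⟩
    have ht0 : 0 < t := by linarith
    -- AM-GM
    have hpr : 0 < ν * r - p := by
      have : t * D ≤ (ν * r - p) * A := by linarith
      have : 0 < (ν * r - p) * A := lt_of_lt_of_le (mul_pos ht0 hD) this
      exact pos_of_mul_pos_left this hA.le
    have g1 : r * t ≤ (ν * r - p) * q := by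
      have a1 : t * D ≤ (ν * r - p) * A := by linarith
      have a2 : r * (t * D) ≤ r * ((ν * r - p) * A) := mul_le_mul_of_nonneg_left a1 hr.le
      have a3 : (ν * r - p) * (r * A) ≤ (ν * r - p) * (q * D) := mul_le_mul_of_nonneg_left h3 hpr.le
      have : r * t * D ≤ (ν * r - p) * q * D := by linarith
      exact le_of_mul_le_mul_right this hD
    have g2 : r * t + p * q ≤ ν * (q * r) := by linarith
    have g3 : 4 * (p * t) * (q * r) ≤ (ν * (q * r)) ^ 2 := by
      have : 0 ≤ r * t + p * q := by positivity
      nlinarith [sq_nonneg (r * t - p * q)]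
    have g4 : 4 * (p * t) ≤ ν ^ 2 * (q * r) := by
      have : 4 * (p * t) * (q * r) ≤ ν ^ 2 * (q * r) * (q * r) := by linarith
      exact le_of_mul_le_mul_right this hqr
    have hpt : 0 < p * t := mul_pos hp ht0
    rcases ht with ⟨_, rfl, rfl⟩ | ⟨_, ⟨rfl, rfl⟩ | ⟨rfl, rfl⟩⟩
    · nlinarith
    · have e1 : q * r = 4 := by nlinarith
      have e2 : p * t = 1 := by nlinarith
      have hp1 : p = 1 := Int.eq_one_of_dvd_one hp.le ⟨_, e2.symm⟩
      subst hp1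
      have ht1 : t = 1 := by linarith
      subst ht1
      have hq4 : q ≤ 4 := by nlinarith
      have hr4 : r ≤ 4 := by nlinarith
      interval_cases q <;> interval_cases r <;> omega
    · have e1 : q * r = 1 := by nlinarith
      have e2 : p * t = 2 := by nlinarith
      have hq1 : q = 1 := Int.eq_one_of_dvd_one hq0.le ⟨_, e1.symm⟩
      subst hq1
      have hr1 : r = 1 := by linarith
      subst hr1
      have hp4 : p ≤ 2 := by nlinarith
      have ht4 : t ≤ 2 := by nlinarith
      interval_cases p <;> interval_cases t <;> omega

lemma f_val (l A D : ℤ) (hl : l = 1 ∨ l = 3) (hA : 0 < A) (hD : 0 < D) (B : ℕ) :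
    (GP l 1 A B D).ncard = if A < D then 1 else 0 := by
  rw [f_shift l A D hA hD]
  split_ifs with h
  · rw [Set.ncard_eq_one]
    refine ⟨(l, 1, 1, 1, 1, 0), ?_⟩
    ext ⟨μ, ν, p, q, r, s⟩
    simp only [GP, Set.mem_ofPred_eq, mul_zero, sub_zero, zero_add, Set.mem_singleton_iff, Prod.mk.injEq]
    constructor
    · rintro ⟨ht, hk, hq⟩
      exact (base_core ht hA hD hk hq).2
    · rintro ⟨rfl, rfl, rfl, rfl, rfl, rfl⟩
      refine ⟨?_, ?_, ?_⟩
      · unfold Ty; omega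
      · ring
      · unfold Qp; omega
  · convert Set.ncard_empty V6
    ext ⟨μ, ν, p, q, r, s⟩
    simp only [GP, Set.mem_ofPred_eq, mul_zero, sub_zero, zero_add, Set.mem_empty_iff_false, iff_false]
    rintro ⟨ht, hk, hq⟩
    exact h (base_core ht hA hD hk hq).1



def MW (l n : ℤ) : Set V6 := {x | match x with
  | (μ, ν, a, b, c, d) => Ty l μ ν ∧ μ * a * d + ν * b * c = n ∧
      0 ≤ a - d ∧ a - d ≤ ν * c ∧ c ≤ b ∧ 0 < c}

lemma abs_le_of_sq {x n m : ℤ} (hm : 0 < m) (h : m * x ^ 2 ≤ n) : -n ≤ x ∧ x ≤ n := by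
  have h1 : x ^ 2 ≤ n := by nlinarith [sq_nonneg x]
  constructor <;> nlinarith [sq_nonneg (x - 1), sq_nonneg (x + 1), sq_nonneg x]

lemma MW_finite (l n : ℤ) : (MW l n).Finite := by
  set K : ℤ := n + 96 * n ^ 2 + 8 * n + 3 with hK
  apply Set.Finite.subset (s := (Set.Icc (-K) K) ×ˢ (Set.Icc (-K) K) ×ˢ (Set.Icc (-K) K) ×ˢ
    (Set.Icc (-K) K) ×ˢ (Set.Icc (-K) K) ×ˢ (Set.Icc (-K) K))
  · refine ((Set.finite_Icc _ _).prod ((Set.finite_Icc _ _).prod ((Set.finite_Icc _ _).prod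
      ((Set.finite_Icc _ _).prod ((Set.finite_Icc _ _).prod (Set.finite_Icc _ _))))))
  · rintro ⟨μ, ν, a, b, c, d⟩ ⟨ht, hn, h0, h1, h2, h3⟩
    obtain ⟨b1, b2, b3⟩ := bound_c ht hn h0 h1 h2
    obtain ⟨hμ, hν, hμν, -⟩ := ht.pos
    have c1 := abs_le_of_sq hν b1
    have c2 := abs_le_of_sq hμ b2
    have c3 := abs_le_of_sq hμ b3
    have hμ3 : μ ≤ 3 := by nlinarith
    have hν3 : ν ≤ 3 := by nlinarith
    have hn0 : 0 < n := by nlinarith [mul_pos hν (pow_pos h3 2)]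
    have hb : b ≤ n + 96 * n ^ 2 := by
      have e : ν * b * c = n - μ * (a * d) := by linarith
      have hbpos : 0 < b := by linarith
      have f1 : b ≤ ν * b * c := by
        have : b * 1 ≤ b * (ν * c) := mul_le_mul_of_nonneg_left (by nlinarith) hbpos.le
        linarith
      have f2 : |a * d| ≤ 4 * n * (8 * n) := by
        rw [abs_mul]
        apply mul_le_mul
        · exact abs_le.2 (by omega)
        · exact abs_le.2 (by omega)
        · positivity
        · positivity
      have f3 := (abs_le.1 f2).1
      have f4 : -(μ * (a * d)) ≤ 3 * (4 * n * (8 * n)) := by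
        nlinarith
      nlinarith
    have hn2 : n ≤ n ^ 2 := by nlinarith
    simp only [Set.mem_prod, Set.mem_Icc]
    omega

lemma GP_one_subset (l n : ℤ) : GP l n 1 0 1 ⊆ MW l n := by
  rintro ⟨μ, ν, a, b, c, d⟩ ⟨ht, hn, hq⟩
  simp only [Qp, mul_one, mul_zero, sub_zero, zero_add] at hq
  obtain ⟨hμ, hν, hμν, -⟩ := ht.pos
  refine ⟨ht, hn, hq.1.le, hq.2.1, hq.2.2.1, ?_⟩
  have := hq.1.trans_le hq.2.1
  exact pos_of_mul_pos_right this hν.le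

lemma GM_one_subset (l n : ℤ) : GM l n 1 0 1 ⊆ MW l n := by
  rintro ⟨μ, ν, a, b, c, d⟩ ⟨ht, hn, hq⟩
  simp only [Qm, mul_one, mul_zero, sub_zero, zero_add] at hq
  obtain ⟨hμ, hν, hμν, -⟩ := ht.pos
  refine ⟨ht, hn, hq.1, hq.2.1.le, hq.2.2.1, ?_⟩
  have := hq.1.trans_lt hq.2.1
  exact pos_of_mul_pos_right this hν.le

lemma GP_one_finite (l n : ℤ) : (GP l n 1 0 1).Finite := (MW_finite l n).subset (GP_one_subset l n)
lemma GM_one_finite (l n : ℤ) : (GM l n 1 0 1).Finite := (MW_finite l n).subset (GM_one_subset l n)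

lemma GP_finite (l A B D : ℤ) (hA : 0 < A) (hD : 0 < D) : (GP l 1 A B D).Finite := by
  apply Set.Finite.of_injOn (f := fun x : V6 => match x with
    | (μ, ν, p, q, r, s) => (μ, ν, p * A, q * D - μ * p * B, r * A, ν * r * B + s * D))
    (t := GP l (A * D) 1 0 1) _ _ (GP_one_finite l _)
  · rintro ⟨μ, ν, p, q, r, s⟩ ⟨ht, hn, hq⟩
    refine ⟨ht, ?_, ?_⟩
    · linear_combination A * D * hn
    · simpa using hq
  · rintro ⟨μ, ν, p, q, r, s⟩ ⟨ht, hn, hq⟩ ⟨μ', ν', p', q', r', s'⟩ ⟨ht', hn', hq'⟩ h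
    simp only [Prod.mk.injEq] at h
    obtain ⟨rfl, rfl, h1, h2, h3, h4⟩ := h
    have e1 := mul_right_cancel₀ hA.ne' h1
    have e2 := mul_right_cancel₀ hA.ne' h3
    subst e1 e2
    have e3 := mul_right_cancel₀ hD.ne' (show q * D = q' * D by linarith)
    have e4 := mul_right_cancel₀ hD.ne' (show s * D = s' * D by linarith)
    subst e3 e4
    rfl

def FS (l A D : ℤ) : Set V6 := {x | match x with
  | (μ, ν, p, b, r, d) => Ty l μ ν ∧ IsCoprime (μ * p) (ν * r) ∧ μ * p * d + ν * b * r = D ∧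
      Qp ν (p * A) b (r * A) d}

lemma FS_mem {l A D : ℤ} (hD : 0 < D) {μ ν p b r d : ℤ} (h : (μ, ν, p, b, r, d) ∈ FS l A D) :
    ∃ B : ℕ, (B : ℤ) < D ∧ ∃ q s, (μ, ν, p, q, r, s) ∈ GP l 1 A B D ∧
      b = q * D - μ * p * B ∧ d = ν * r * B + s * D := by
  obtain ⟨ht, ⟨s0, q0, h0⟩, hd, hq⟩ := h
  set B0 := q0 * d - s0 * b with hB0
  obtain ⟨B, hB⟩ : ∃ B : ℕ, (B : ℤ) = B0 % D := ⟨(B0 % D).toNat, Int.toNat_of_nonneg (Int.emod_nonneg _ hD.ne')⟩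
  have hdm := Int.emod_add_mul_ediv B0 D
  set k := B0 / D
  have e1 : b = (q0 - μ * p * k) * D - μ * p * B := by
    rw [hB]
    have : B0 % D = B0 - D * k := by linarith
    rw [this, hB0]
    linear_combination -b * h0 + q0 * hd
  have e2 : d = ν * r * B + (s0 + ν * r * k) * D := by
    rw [hB]
    have : B0 % D = B0 - D * k := by linarith
    rw [this, hB0]
    linear_combination -d * h0 + s0 * hd
  refine ⟨B, ?_, q0 - μ * p * k, s0 + ν * r * k, ⟨ht, ?_, ?_⟩, e1, e2⟩
  · rw [hB]; exact Int.emod_lt_of_pos _ hD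
  · linear_combination h0
  · rw [← e1, ← e2]; exact hq

lemma GP_mem {l A D : ℤ} {μ ν p q r s : ℤ} {B : ℤ} (h : (μ, ν, p, q, r, s) ∈ GP l 1 A B D) :
    (μ, ν, p, q * D - μ * p * B, r, ν * r * B + s * D) ∈ FS l A D := by
  obtain ⟨ht, hk, hq⟩ := h
  refine ⟨ht, ⟨s, q, by linear_combination hk⟩, by linear_combination D * hk, hq⟩

lemma FS_ncard (l A D : ℤ) (hl : l = 1 ∨ l = 3) (hA : 0 < A) (hD : 0 < D) :
    (FS l A D).ncard = if A < D then D.toNat else 0 := by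
  have hf := f_val l A D hl hA hD
  split_ifs with h
  · simp only [h, if_true] at hf
    have hf' : ∀ B : ℕ, ∃ x, GP l 1 A B D = {x} := fun B => Set.ncard_eq_one.1 (hf B)
    choose g hg using hf'
    have hg' : ∀ B : ℕ, g B ∈ GP l 1 A B D := fun B => by rw [hg]; rfl
    have : (Set.Iio D.toNat).ncard = (FS l A D).ncard := by
      apply Set.ncard_congr (fun B _ => match g B with
        | (μ, ν, p, q, r, s) => (μ, ν, p, q * D - μ * p * B, r, ν * r * B + s * D))
      · intro B _
        exact GP_mem (hg' B)
      · intro B B' hB hB' heq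
        have m1 := hg' B
        have m2 := hg' B'
        revert m1 m2 heq
        rcases g B with ⟨μ, ν, p, q, r, s⟩
        rcases g B' with ⟨μ', ν', p', q', r', s'⟩
        rintro heq ⟨ht, hk, hq⟩ ⟨ht', hk', hq'⟩
        simp only [Prod.mk.injEq] at heq
        obtain ⟨rfl, rfl, rfl, h1, rfl, h2⟩ := heq
        have : D ∣ (B : ℤ) - B' := by
          refine ⟨s' * q - q' * s, ?_⟩
          linear_combination q * h2 - s * h1 - ((B : ℤ) - B') * hk
        simp only [Set.mem_Iio] at hB hB'
        obtain ⟨k, hk⟩ := this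
        have : k = 0 := by
          have hB1 : (B : ℤ) < D := by omega
          have hB2 : (B' : ℤ) < D := by omega
          have : D * k < D * 1 := by rw [← hk]; omega
          have := lt_of_mul_lt_mul_left this hD.le
          have : D * (-1) < D * k := by rw [← hk]; omega
          have := lt_of_mul_lt_mul_left this hD.le
          omega
        subst this
        omega
      · rintro ⟨μ, ν, p, b, r, d⟩ hx
        obtain ⟨B, hB, q, s, hm, rfl, rfl⟩ := FS_mem hD hx
        refine ⟨B, ?_, ?_⟩
        · simp only [Set.mem_Iio]; omega
        · rw [hg] at hm
          rw [← hm]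
    rw [← this]
    rw [Set.ncard_eq_toFinset_card' (Set.Iio D.toNat)]
    simp
  · simp only [h, if_false] at hf
    convert Set.ncard_empty V6
    rw [Set.eq_empty_iff_forall_notMem]
    rintro ⟨μ, ν, p, b, r, d⟩ hx
    obtain ⟨B, hB, q, s, hm, rfl, rfl⟩ := FS_mem hD hx
    have := hf B
    rw [Set.ncard_eq_zero (GP_finite l A B D hA hD)] at this
    rw [this] at hm
    exact hm


lemma ncard_fiber {α ι : Type*} [DecidableEq ι] {s : Set α} (hs : s.Finite) (f : α → ι) (t : Finset ι)
    (h : ∀ x ∈ s, f x ∈ t) : s.ncard = ∑ i ∈ t, {x ∈ s | f x = i}.ncard := by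
  classical
  rw [Set.ncard_eq_toFinset_card s hs, Finset.card_eq_sum_card_fiberwise (f := f) (t := t)]
  · apply Finset.sum_congr rfl
    intro i _
    rw [← Set.ncard_coe_finset]
    congr 1
    ext x
    simp
  · intro x hx
    exact h x (by simpa using hx)

lemma ncard_split {α : Type*} {s : Set α} (hs : s.Finite) (p : α → Prop) :
    s.ncard = {x ∈ s | p x}.ncard + {x ∈ s | ¬ p x}.ncard := by
  rw [← Set.ncard_union_eq ?_ (hs.subset (fun x hx => hx.1)) (hs.subset (fun x hx => hx.1))]
  · congr 1
    ext x
    simp only [Set.mem_union, Set.mem_ofPred_eq]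
    tauto
  · rw [Set.disjoint_left]
    rintro x ⟨_, h⟩ ⟨_, h'⟩
    exact h' h

def gg (x : V6) : ℕ := Int.gcd x.2.2.1 x.2.2.2.2.1
def good (x : V6) : Prop := IsCoprime (x.1 * (x.2.2.1 / gg x)) (x.2.1 * (x.2.2.2.2.1 / gg x))

lemma gg_pos {l n : ℤ} {x : V6} (hx : x ∈ GP l n 1 0 1) : 0 < gg x := by
  obtain ⟨_, _, _, _, _, h⟩ := GP_one_subset _ _ hx
  unfold gg
  exact Int.gcd_pos_of_ne_zero_right _ h.ne'

lemma fiber_good (l : ℤ) (n g D : ℕ) (hg : 0 < g) (h : g * D = n) :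
    {x ∈ {x ∈ GP l n 1 0 1 | good x} | gg x = g}.ncard = (FS l g D).ncard := by
  have hg' : (g : ℤ) ≠ 0 := by exact_mod_cast hg.ne'
  subst h
  apply ncard_eq_of_inv (fun x => match x with
    | (μ, ν, a, b, c, d) => (μ, ν, a / g, b, c / g, d))
    (fun x => match x with
    | (μ, ν, p, b, r, d) => (μ, ν, p * g, b, r * g, d))
  · rintro ⟨μ, ν, a, b, c, d⟩ ⟨⟨⟨ht, hk, hq⟩, hgood⟩, hgg⟩
    simp only [good] at hgood
    rw [hgg] at hgood
    simp only [gg] at hgg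
    have h1 : (g : ℤ) ∣ a := by rw [← hgg]; exact Int.gcd_dvd_left _ _
    have h2 : (g : ℤ) ∣ c := by rw [← hgg]; exact Int.gcd_dvd_right _ _
    obtain ⟨p, rfl⟩ := h1
    obtain ⟨r, rfl⟩ := h2
    simp only [Int.mul_ediv_cancel_left _ hg'] at hgood ⊢
    refine ⟨ht, hgood, ?_, ?_⟩
    · push_cast at hk
      apply mul_left_cancel₀ hg'
      linear_combination hk
    · simpa [mul_comm] using hq
  · rintro ⟨μ, ν, p, b, r, d⟩ ⟨ht, hc, hk, hq⟩
    have hpr : Int.gcd p r = 1 := by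
      rw [← Int.isCoprime_iff_gcd_eq_one]
      exact hc.of_mul_left_right.of_mul_right_right
    have hgg : gg (μ, ν, p * g, b, r * g, d) = g := by
      simp only [gg, Int.gcd_mul_right, hpr, Int.natAbs_natCast, one_mul]
    refine ⟨⟨⟨ht, ?_, ?_⟩, ?_⟩, hgg⟩
    · push_cast; linear_combination g * hk
    · simpa using hq
    · simp only [good]
      rw [hgg]
      simpa [Int.mul_ediv_cancel _ hg'] using hc
  · rintro ⟨μ, ν, a, b, c, d⟩ ⟨⟨⟨ht, hk, hq⟩, hgood⟩, hgg⟩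
    simp only [gg] at hgg
    have h1 : (g : ℤ) ∣ a := by rw [← hgg]; exact Int.gcd_dvd_left _ _
    have h2 : (g : ℤ) ∣ c := by rw [← hgg]; exact Int.gcd_dvd_right _ _
    simp [Int.ediv_mul_cancel h1, Int.ediv_mul_cancel h2]
  · rintro ⟨μ, ν, p, b, r, d⟩ _
    simp [Int.mul_ediv_cancel _ hg']

lemma coprime_three {x y : ℤ} (h : IsCoprime x y) (h3 : ¬ (3 : ℤ) ∣ y) : IsCoprime (3 * x) y := by
  apply IsCoprime.mul_left _ h
  exact (Int.prime_three.coprime_iff_not_dvd).2 h3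

lemma bad_cases {μ ν p b r d : ℤ} {g : ℕ} (hg : 0 < g) (ht : Ty 3 μ ν)
    (hgg : gg (μ, ν, g * p, b, g * r, d) = g)
    (hb : ¬ good (μ, ν, g * p, b, g * r, d)) : IsCoprime p r ∧
    ((μ = 1 ∧ ν = 3 ∧ (3 : ℤ) ∣ p ∧ ¬ (3 : ℤ) ∣ r) ∨ (μ = 3 ∧ ν = 1 ∧ (3 : ℤ) ∣ r ∧ ¬ (3 : ℤ) ∣ p)) := by
  have hg' : (g : ℤ) ≠ 0 := by exact_mod_cast hg.ne'
  simp only [good] at hb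
  rw [hgg] at hb
  simp only [Int.mul_ediv_cancel_left _ hg'] at hb
  simp only [gg, Int.gcd_mul_left, Int.natAbs_natCast] at hgg
  have hpr : IsCoprime p r := by
    rw [Int.isCoprime_iff_gcd_eq_one]
    exact Nat.eq_of_mul_eq_mul_left hg (by rw [hgg, mul_one])
  refine ⟨hpr, ?_⟩
  have n3 : ¬ ((3 : ℤ) ∣ p ∧ (3 : ℤ) ∣ r) := by
    rintro ⟨h1, h2⟩
    have := hpr.isUnit_of_dvd' h1 h2
    rw [Int.isUnit_iff] at this
    omega
  rcases ht with ⟨h, _⟩ | ⟨_, ⟨rfl, rfl⟩ | ⟨rfl, rfl⟩⟩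
  · omega
  · right
    have : (3 : ℤ) ∣ r := by
      by_contra h3
      apply hb
      simpa using coprime_three hpr h3
    tauto
  · left
    have : (3 : ℤ) ∣ p := by
      by_contra h3
      apply hb
      simpa using (coprime_three hpr.symm h3).symm
    tauto

lemma bad_of {μ ν p b r d : ℤ} {g : ℕ} (hg : 0 < g) (hpr : IsCoprime p r)
    (h : (ν = 3 ∧ (3 : ℤ) ∣ p) ∨ (μ = 3 ∧ (3 : ℤ) ∣ r)) :
    gg (μ, ν, p * g, b, r * g, d) = g ∧ ¬ good (μ, ν, p * g, b, r * g, d) := by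
  have hg' : (g : ℤ) ≠ 0 := by exact_mod_cast hg.ne'
  have hgg : gg (μ, ν, p * g, b, r * g, d) = g := by
    simp only [gg, Int.gcd_mul_right, Int.isCoprime_iff_gcd_eq_one.1 hpr, Int.natAbs_natCast, one_mul]
  refine ⟨hgg, ?_⟩
  intro hb
  simp only [good] at hb
  rw [hgg] at hb
  simp only [Int.mul_ediv_cancel _ hg'] at hb
  have : IsUnit (3 : ℤ) := by
    rcases h with ⟨rfl, h⟩ | ⟨rfl, h⟩
    · exact hb.isUnit_of_dvd' (h.mul_left _) (Dvd.intro _ rfl)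
    · exact hb.isUnit_of_dvd' (Dvd.intro _ rfl) (h.mul_left _)
  rw [Int.isUnit_iff] at this
  omega

lemma fiber_bad (n g D : ℕ) (hg : 0 < g) (h : 3 * (g * D) = n) :
    {x ∈ {x ∈ GP 3 n 1 0 1 | ¬ good x} | gg x = g}.ncard = (FS 3 (3 * g) (3 * D)).ncard := by
  have hg' : (g : ℤ) ≠ 0 := by exact_mod_cast hg.ne'
  have h31 : ¬ ((3 : ℤ) = 1) := by norm_num
  have h13 : ¬ ((1 : ℤ) = 3) := by norm_num
  have hg3 : (3 * g : ℤ) ≠ 0 := by positivity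
  subst h
  apply ncard_eq_of_inv (fun x => match x with
    | (μ, ν, a, b, c, d) => if ν = 3 then (3, 1, a / (3 * g), 3 * b, c / g, d)
        else (1, 3, a / g, b, c / (3 * g), 3 * d))
    (fun x => match x with
    | (μ, ν, p, b, r, d) => if ν = 1 then (1, 3, (3 * p) * g, b / 3, r * g, d)
        else (3, 1, p * g, b, (3 * r) * g, d / 3))
  · rintro ⟨μ, ν, a, b, c, d⟩ ⟨⟨⟨ht, hk, hq⟩, hgood⟩, hgg⟩
    have hgg' := hgg
    simp only [gg] at hgg'
    have h1 : (g : ℤ) ∣ a := by rw [← hgg']; exact Int.gcd_dvd_left _ _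
    have h2 : (g : ℤ) ∣ c := by rw [← hgg']; exact Int.gcd_dvd_right _ _
    obtain ⟨p, rfl⟩ := h1
    obtain ⟨r, rfl⟩ := h2
    obtain ⟨hpr, ⟨rfl, rfl, ⟨p, rfl⟩, hr⟩ | ⟨rfl, rfl, ⟨r, rfl⟩, hp⟩⟩ := bad_cases hg ht hgg hgood
    · have e : (g : ℤ) * (3 * p) / (3 * g) = p := by
        rw [show (g : ℤ) * (3 * p) = p * (3 * g) by ring]; exact Int.mul_ediv_cancel _ hg3
      simp only [if_true, Int.mul_ediv_cancel_left _ hg', e]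
      refine ⟨by unfold Ty; omega, ?_, ?_, ?_⟩
      · simpa using coprime_three hpr.of_mul_left_right hr
      · push_cast at hk
        apply mul_left_cancel₀ hg'
        linear_combination hk
      · unfold Qp at *; ring_nf at *; omega
    · have e : (g : ℤ) * (3 * r) / (3 * g) = r := by
        rw [show (g : ℤ) * (3 * r) = r * (3 * g) by ring]; exact Int.mul_ediv_cancel _ hg3
      simp only [Int.mul_ediv_cancel_left _ hg', e]
      simp only [h13, if_false]
      refine ⟨by unfold Ty; omega, ?_, ?_, ?_⟩
      · simpa using (coprime_three hpr.symm.of_mul_left_right hp).symm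
      · push_cast at hk
        apply mul_left_cancel₀ hg'
        linear_combination hk
      · unfold Qp at *; ring_nf at *; omega
  · rintro ⟨μ, ν, p, b, r, d⟩ ⟨ht, hc, hk, hq⟩
    have hpr : IsCoprime p r := hc.of_mul_left_right.of_mul_right_right
    rcases ht with ⟨h, _⟩ | ⟨_, ⟨rfl, rfl⟩ | ⟨rfl, rfl⟩⟩
    · omega
    · simp only [if_true]
      have h3 : (3 : ℤ) ∣ b := by
        have h1 : IsCoprime (3 : ℤ) r := by simpa using hc.of_mul_left_left
        refine h1.dvd_of_dvd_mul_right ⟨D - p * d, by linear_combination hk⟩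
      obtain ⟨b, rfl⟩ := h3
      rw [Int.mul_ediv_cancel_left _ (by norm_num)]
      have := bad_of (μ := 1) (ν := 3) (b := b) (d := d) hg (p := 3 * p) (r := r) (by simpa using hc)
        (Or.inl ⟨rfl, Dvd.intro _ rfl⟩)
      refine ⟨⟨⟨by unfold Ty; omega, ?_, ?_⟩, this.2⟩, this.1⟩
      · push_cast; linear_combination g * hk
      · unfold Qp at *; ring_nf at *; omega
    · simp only [h31, if_false]
      have h3 : (3 : ℤ) ∣ d := by
        have h1 : IsCoprime (3 : ℤ) p := by simpa using hc.symm.of_mul_left_left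
        refine h1.dvd_of_dvd_mul_left ⟨D - b * r, by linear_combination hk⟩
      obtain ⟨d, rfl⟩ := h3
      rw [Int.mul_ediv_cancel_left _ (by norm_num)]
      have := bad_of (μ := 3) (ν := 1) (b := b) (d := d) hg (p := p) (r := 3 * r) (by simpa using hc)
        (Or.inr ⟨rfl, Dvd.intro _ rfl⟩)
      refine ⟨⟨⟨by unfold Ty; omega, ?_, ?_⟩, this.2⟩, this.1⟩
      · push_cast; linear_combination g * hk
      · unfold Qp at *; ring_nf at *; omega
  · rintro ⟨μ, ν, a, b, c, d⟩ ⟨⟨⟨ht, hk, hq⟩, hgood⟩, hgg⟩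
    have hgg' := hgg
    simp only [gg] at hgg'
    have h1 : (g : ℤ) ∣ a := by rw [← hgg']; exact Int.gcd_dvd_left _ _
    have h2 : (g : ℤ) ∣ c := by rw [← hgg']; exact Int.gcd_dvd_right _ _
    obtain ⟨p, rfl⟩ := h1
    obtain ⟨r, rfl⟩ := h2
    obtain ⟨hpr, ⟨rfl, rfl, ⟨p, rfl⟩, hr⟩ | ⟨rfl, rfl, ⟨r, rfl⟩, hp⟩⟩ := bad_cases hg ht hgg hgood
    · have e : (g : ℤ) * (3 * p) / (3 * g) = p := by
        rw [show (g : ℤ) * (3 * p) = p * (3 * g) by ring]; exact Int.mul_ediv_cancel _ hg3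
      simp only [if_true, Int.mul_ediv_cancel_left _ hg', e]
      rw [Int.mul_ediv_cancel_left _ (by norm_num)]
      ring_nf
    · have e : (g : ℤ) * (3 * r) / (3 * g) = r := by
        rw [show (g : ℤ) * (3 * r) = r * (3 * g) by ring]; exact Int.mul_ediv_cancel _ hg3
      simp only [Int.mul_ediv_cancel_left _ hg', e]
      simp only [h13, h31, if_false]
      rw [Int.mul_ediv_cancel_left _ (by norm_num)]
      ring_nf
  · rintro ⟨μ, ν, p, b, r, d⟩ ⟨ht, hc, hk, hq⟩
    rcases ht with ⟨h, _⟩ | ⟨_, ⟨rfl, rfl⟩ | ⟨rfl, rfl⟩⟩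
    · omega
    · simp only [if_true]
      have h3 : (3 : ℤ) ∣ b := by
        have h1 : IsCoprime (3 : ℤ) r := by simpa using hc.of_mul_left_left
        refine h1.dvd_of_dvd_mul_right ⟨D - p * d, by linear_combination hk⟩
      obtain ⟨b, rfl⟩ := h3
      rw [Int.mul_ediv_cancel_left _ (by norm_num), Int.mul_ediv_cancel _ hg',
        show (3 : ℤ) * p * g = p * (3 * g) by ring, Int.mul_ediv_cancel _ hg3]
    · simp only [h31, h13, if_false]
      have h3 : (3 : ℤ) ∣ d := by
        have h1 : IsCoprime (3 : ℤ) p := by simpa using hc.symm.of_mul_left_left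
        refine h1.dvd_of_dvd_mul_left ⟨D - b * r, by linear_combination hk⟩
      obtain ⟨d, rfl⟩ := h3
      rw [Int.mul_ediv_cancel_left _ (by norm_num), Int.mul_ediv_cancel _ hg',
        show (3 : ℤ) * r * g = r * (3 * g) by ring, Int.mul_ediv_cancel _ hg3]

def big (n : ℕ) : ℕ := ∑ g ∈ n.divisors, if g < n / g then n / g else 0
def small (n : ℕ) : ℕ := ∑ g ∈ n.divisors, if g < n / g then g else 0

lemma gg_mem {l : ℤ} {n : ℕ} (hn : 0 < n) {x : V6} (hx : x ∈ GP l n 1 0 1) : gg x ∈ n.divisors := by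
  rw [Nat.mem_divisors]
  refine ⟨?_, hn.ne'⟩
  obtain ⟨μ, ν, a, b, c, d⟩ := x
  obtain ⟨_, hk, _⟩ := hx
  rw [← Int.natCast_dvd_natCast, ← hk]
  unfold gg
  apply dvd_add
  · exact ((Int.gcd_dvd_left _ _).mul_left _).mul_right _
  · exact (Int.gcd_dvd_right _ _).mul_left _

lemma card_good (l : ℤ) (hl : l = 1 ∨ l = 3) (n : ℕ) (hn : 0 < n) :
    {x ∈ GP l n 1 0 1 | good x}.ncard = big n := by
  rw [ncard_fiber ((GP_one_finite l n).subset (fun x hx => hx.1)) gg n.divisors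
    (fun x hx => gg_mem hn hx.1)]
  unfold big
  apply Finset.sum_congr rfl
  intro g hg
  have hgd := (Nat.mem_divisors.1 hg).1
  have hg0 : 0 < g := Nat.pos_of_mem_divisors hg
  have hD : 0 < n / g := Nat.div_pos (Nat.le_of_dvd hn hgd) hg0
  rw [fiber_good l n g (n / g) hg0 (Nat.mul_div_cancel' hgd),
    FS_ncard l g (n / g : ℕ) hl (by exact_mod_cast hg0) (by exact_mod_cast hD)]
  simp only [Nat.cast_lt, Int.toNat_natCast]

lemma S_one (n : ℕ) (hn : 0 < n) : (GP 1 n 1 0 1).ncard = big n := by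
  rw [← card_good 1 (Or.inl rfl) n hn]
  congr 1
  ext x
  refine ⟨fun h => ⟨h, ?_⟩, fun h => h.1⟩
  have hg := gg_pos h
  obtain ⟨μ, ν, a, b, c, d⟩ := x
  obtain ⟨⟨_, rfl, rfl⟩ | ⟨h, _⟩, hk, _⟩ := h
  · simp only [good, one_mul, gg] at hg ⊢
    rw [Int.isCoprime_iff_gcd_eq_one]
    exact Int.gcd_ediv_gcd_ediv_gcd hg
  · omega

lemma S_three (n : ℕ) (hn : 0 < n) : (GP 3 n 1 0 1).ncard = big n + if 3 ∣ n then 3 * big (n / 3) else 0 := by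
  rw [ncard_split (GP_one_finite 3 n) good, card_good 3 (Or.inr rfl) n hn]
  congr 1
  have hmem : ∀ x ∈ {x ∈ GP 3 n 1 0 1 | ¬ good x}, 3 * gg x ∣ n := by
    intro x hx
    have hg := gg_pos hx.1
    obtain ⟨g, hgg⟩ : ∃ g, gg x = g := ⟨_, rfl⟩
    rw [hgg] at hg
    obtain ⟨μ, ν, a, b, c, d⟩ := x
    obtain ⟨⟨ht, hk, hq⟩, hgood⟩ := hx
    have hgg' := hgg
    simp only [gg] at hgg'
    have h1 : (g : ℤ) ∣ a := by rw [← hgg']; exact Int.gcd_dvd_left _ _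
    have h2 : (g : ℤ) ∣ c := by rw [← hgg']; exact Int.gcd_dvd_right _ _
    obtain ⟨p, rfl⟩ := h1
    obtain ⟨r, rfl⟩ := h2
    rw [hgg, ← Int.natCast_dvd_natCast, ← hk]
    push_cast
    obtain ⟨hpr, ⟨rfl, rfl, ⟨p, rfl⟩, hr⟩ | ⟨rfl, rfl, ⟨r, rfl⟩, hp⟩⟩ := bad_cases hg ht hgg hgood
    · exact ⟨p * d + b * r, by ring⟩
    · exact ⟨p * d + b * r, by ring⟩
  split_ifs with h3
  · obtain ⟨m, rfl⟩ := h3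
    have hm : 0 < m := by omega
    rw [Nat.mul_div_cancel_left _ (by norm_num)]
    rw [ncard_fiber ((GP_one_finite 3 _).subset (fun x hx => hx.1)) gg m.divisors]
    · unfold big
      rw [Finset.mul_sum]
      apply Finset.sum_congr rfl
      intro g hg
      have hgd := (Nat.mem_divisors.1 hg).1
      have hg0 : 0 < g := Nat.pos_of_mem_divisors hg
      have hD : 0 < m / g := Nat.div_pos (Nat.le_of_dvd hm hgd) hg0
      rw [fiber_bad (3 * m) g (m / g) hg0 (by rw [Nat.mul_div_cancel' hgd]),
        FS_ncard 3 _ _ (Or.inr rfl) (by positivity) (by positivity)]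
      have : (3 * (g : ℤ) < 3 * ((m / g : ℕ) : ℤ)) ↔ g < m / g := by omega
      simp only [this]
      split_ifs <;> omega
    · intro x hx
      rw [Nat.mem_divisors]
      exact ⟨Nat.dvd_of_mul_dvd_mul_left (by norm_num) (hmem x hx), hm.ne'⟩
  · convert Set.ncard_empty V6
    rw [Set.eq_empty_iff_forall_notMem]
    intro x hx
    exact h3 ((Dvd.intro _ rfl).trans (hmem x hx))



abbrev V4 := ℤ × ℤ × ℤ × ℤ

def Sx (μ ν n : ℤ) (P : ℤ → ℤ → ℤ → ℤ → Prop) : Set V4 := {x | match x with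
  | (a, b, c, d) => μ * a * d + ν * b * c = n ∧ P a b c d}

lemma Sx_finite {l μ ν : ℤ} (ht : Ty l μ ν) (n : ℤ) {P : ℤ → ℤ → ℤ → ℤ → Prop}
    (h : ∀ a b c d, P a b c d → 0 ≤ a - d ∧ a - d ≤ ν * c ∧ c ≤ b ∧ 0 < c) : (Sx μ ν n P).Finite := by
  apply Set.Finite.of_injOn (f := fun x : V4 => ((μ, ν, x) : V6)) (t := MW l n) _ _ (MW_finite l n)
  · rintro ⟨a, b, c, d⟩ ⟨h1, h2⟩
    exact ⟨ht, h1, h _ _ _ _ h2⟩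
  · intro x _ y _ hxy
    simpa using hxy

lemma Sx_congr {μ ν n : ℤ} {P P' : ℤ → ℤ → ℤ → ℤ → Prop} (h : ∀ a b c d, P a b c d ↔ P' a b c d) :
    (Sx μ ν n P).ncard = (Sx μ ν n P').ncard := by
  congr 1; ext ⟨a, b, c, d⟩; simp only [Sx, Set.mem_ofPred_eq, h]

lemma Sx_split {l μ ν : ℤ} (ht : Ty l μ ν) (n : ℤ) {P : ℤ → ℤ → ℤ → ℤ → Prop}
    (P1 P2 : ℤ → ℤ → ℤ → ℤ → Prop)
    (h : ∀ a b c d, P a b c d → 0 ≤ a - d ∧ a - d ≤ ν * c ∧ c ≤ b ∧ 0 < c)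
    (hs : ∀ a b c d, P a b c d ↔ P1 a b c d ∨ P2 a b c d)
    (hd : ∀ a b c d, P1 a b c d → P2 a b c d → False) :
    (Sx μ ν n P).ncard = (Sx μ ν n P1).ncard + (Sx μ ν n P2).ncard := by
  rw [← Set.ncard_union_eq ?_
    (Sx_finite ht n (fun a b c d h1 => h a b c d ((hs a b c d).2 (Or.inl h1))))
    (Sx_finite ht n (fun a b c d h1 => h a b c d ((hs a b c d).2 (Or.inr h1))))]
  · congr 1
    ext ⟨a, b, c, d⟩
    simp only [Sx, Set.mem_ofPred_eq, Set.mem_union, hs]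
    tauto
  · rw [Set.disjoint_left]
    rintro ⟨a, b, c, d⟩ ⟨_, h1⟩ ⟨_, h2⟩
    exact hd _ _ _ _ h1 h2

noncomputable def RP (μ ν n : ℤ) : ℕ := (Sx μ ν n (Qp ν)).ncard
noncomputable def RM (μ ν n : ℤ) : ℕ := (Sx μ ν n (Qm ν)).ncard

lemma GP_one (n : ℤ) : (GP 1 n 1 0 1).ncard = RP 1 1 n := by
  apply ncard_eq_of_inv (fun x : V6 => x.2.2) (fun y : V4 => (1, 1, y))
  · rintro ⟨μ, ν, a, b, c, d⟩ ⟨⟨_, rfl, rfl⟩ | ⟨h, _⟩, hk, hq⟩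
    · exact ⟨hk, by simpa using hq⟩
    · omega
  · rintro ⟨a, b, c, d⟩ ⟨hk, hq⟩
    exact ⟨by unfold Ty; omega, hk, by simpa using hq⟩
  · rintro ⟨μ, ν, a, b, c, d⟩ ⟨⟨_, rfl, rfl⟩ | ⟨h, _⟩, hk, hq⟩
    · rfl
    · omega
  · rintro ⟨a, b, c, d⟩ _; rfl

lemma GM_one (n : ℤ) : (GM 1 n 1 0 1).ncard = RM 1 1 n := by
  apply ncard_eq_of_inv (fun x : V6 => x.2.2) (fun y : V4 => (1, 1, y))
  · rintro ⟨μ, ν, a, b, c, d⟩ ⟨⟨_, rfl, rfl⟩ | ⟨h, _⟩, hk, hq⟩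
    · exact ⟨hk, by simpa using hq⟩
    · omega
  · rintro ⟨a, b, c, d⟩ ⟨hk, hq⟩
    exact ⟨by unfold Ty; omega, hk, by simpa using hq⟩
  · rintro ⟨μ, ν, a, b, c, d⟩ ⟨⟨_, rfl, rfl⟩ | ⟨h, _⟩, hk, hq⟩
    · rfl
    · omega
  · rintro ⟨a, b, c, d⟩ _; rfl

lemma GP_three (n : ℤ) : (GP 3 n 1 0 1).ncard = RP 3 1 n + RP 1 3 n := by
  rw [ncard_split (GP_one_finite 3 n) (fun x => x.2.1 = 1)]
  congr 1
  · apply ncard_eq_of_inv (fun x : V6 => x.2.2) (fun y : V4 => (3, 1, y))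
    · rintro ⟨μ, ν, a, b, c, d⟩ ⟨⟨ht, hk, hq⟩, h⟩
      simp only at h
      obtain ⟨rfl, rfl⟩ : μ = 3 ∧ ν = 1 := by unfold Ty at ht; omega
      exact ⟨hk, by simpa using hq⟩
    · rintro ⟨a, b, c, d⟩ ⟨hk, hq⟩
      exact ⟨⟨by unfold Ty; omega, hk, by simpa using hq⟩, rfl⟩
    · rintro ⟨μ, ν, a, b, c, d⟩ ⟨⟨ht, hk, hq⟩, h⟩
      simp only at h
      obtain ⟨rfl, rfl⟩ : μ = 3 ∧ ν = 1 := by unfold Ty at ht; omega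
      rfl
    · rintro ⟨a, b, c, d⟩ _; rfl
  · apply ncard_eq_of_inv (fun x : V6 => x.2.2) (fun y : V4 => (1, 3, y))
    · rintro ⟨μ, ν, a, b, c, d⟩ ⟨⟨ht, hk, hq⟩, h⟩
      simp only at h
      obtain ⟨rfl, rfl⟩ : μ = 1 ∧ ν = 3 := by unfold Ty at ht; omega
      exact ⟨hk, by simpa using hq⟩
    · rintro ⟨a, b, c, d⟩ ⟨hk, hq⟩
      exact ⟨⟨by unfold Ty; omega, hk, by simpa using hq⟩, by norm_num⟩
    · rintro ⟨μ, ν, a, b, c, d⟩ ⟨⟨ht, hk, hq⟩, h⟩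
      simp only at h
      obtain ⟨rfl, rfl⟩ : μ = 1 ∧ ν = 3 := by unfold Ty at ht; omega
      rfl
    · rintro ⟨a, b, c, d⟩ _; rfl

lemma GM_three (n : ℤ) : (GM 3 n 1 0 1).ncard = RM 3 1 n + RM 1 3 n := by
  rw [ncard_split (GM_one_finite 3 n) (fun x => x.2.1 = 1)]
  congr 1
  · apply ncard_eq_of_inv (fun x : V6 => x.2.2) (fun y : V4 => (3, 1, y))
    · rintro ⟨μ, ν, a, b, c, d⟩ ⟨⟨ht, hk, hq⟩, h⟩
      simp only at h
      obtain ⟨rfl, rfl⟩ : μ = 3 ∧ ν = 1 := by unfold Ty at ht; omega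
      exact ⟨hk, by simpa using hq⟩
    · rintro ⟨a, b, c, d⟩ ⟨hk, hq⟩
      exact ⟨⟨by unfold Ty; omega, hk, by simpa using hq⟩, rfl⟩
    · rintro ⟨μ, ν, a, b, c, d⟩ ⟨⟨ht, hk, hq⟩, h⟩
      simp only at h
      obtain ⟨rfl, rfl⟩ : μ = 3 ∧ ν = 1 := by unfold Ty at ht; omega
      rfl
    · rintro ⟨a, b, c, d⟩ _; rfl
  · apply ncard_eq_of_inv (fun x : V6 => x.2.2) (fun y : V4 => (1, 3, y))
    · rintro ⟨μ, ν, a, b, c, d⟩ ⟨⟨ht, hk, hq⟩, h⟩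
      simp only at h
      obtain ⟨rfl, rfl⟩ : μ = 1 ∧ ν = 3 := by unfold Ty at ht; omega
      exact ⟨hk, by simpa using hq⟩
    · rintro ⟨a, b, c, d⟩ ⟨hk, hq⟩
      exact ⟨⟨by unfold Ty; omega, hk, by simpa using hq⟩, by norm_num⟩
    · rintro ⟨μ, ν, a, b, c, d⟩ ⟨⟨ht, hk, hq⟩, h⟩
      simp only at h
      obtain ⟨rfl, rfl⟩ : μ = 1 ∧ ν = 3 := by unfold Ty at ht; omega
      rfl
    · rintro ⟨a, b, c, d⟩ _; rfl

/-- positive `d` -/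
def Lp (ν e : ℤ) (a b c d : ℤ) : Prop := 0 < c ∧ 0 < d ∧ 0 ≤ a - d - e ∧ a - d - e < ν * c ∧ 0 ≤ b - c - e

lemma Lp_symm {l μ ν : ℤ} (ht : Ty l μ ν) (n e : ℤ) : (Sx μ ν n (Lp ν e)).ncard = (Sx ν μ n (Lp μ e)).ncard := by
  have main : ∀ (μ ν a b c d : ℤ), 0 < μ → 0 < ν → (a, b, c, d) ∈ Sx μ ν n (Lp ν e) →
      (b - μ * d * ((b - c - e) / (μ * d)), a + ν * c * ((b - c - e) / (μ * d)), d, c) ∈ Sx ν μ n (Lp μ e) ∧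
      ((a + ν * c * ((b - c - e) / (μ * d)) - d - e) / (ν * c)) = (b - c - e) / (μ * d) := by
    rintro μ ν a b c d hμ hν ⟨hk, hc, hd, h1, h2, h3⟩
    have hX : 0 < ν * c := mul_pos hν hc
    have hY : 0 < μ * d := mul_pos hμ hd
    set k := (b - c - e) / (μ * d) with hkk
    have hk0 : 0 ≤ k := Int.ediv_nonneg h3 hY.le
    have e1 := Int.emod_add_mul_ediv (b - c - e) (μ * d)
    have e2 := Int.emod_nonneg (b - c - e) hY.ne'
    have e3 := Int.emod_lt_of_pos (b - c - e) hY
    rw [← hkk] at e1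
    refine ⟨⟨?_, hd, hc, ?_, ?_, ?_⟩, ?_⟩
    · linear_combination hk
    · linarith
    · linarith
    · have : 0 ≤ ν * c * k := by positivity
      linarith
    · rw [show a + ν * c * k - d - e = (a - d - e) + ν * c * k by ring, Int.add_mul_ediv_left _ _ hX.ne',
        Int.ediv_eq_zero_of_lt h1 h2, zero_add]
  obtain ⟨hμ, hν, -, -⟩ := ht.pos
  apply ncard_eq_of_inv (fun x => match x with
    | (a, b, c, d) => (b - μ * d * ((b - c - e) / (μ * d)), a + ν * c * ((b - c - e) / (μ * d)), d, c))
    (fun x => match x with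
    | (a, b, c, d) => (b - ν * d * ((b - c - e) / (ν * d)), a + μ * c * ((b - c - e) / (ν * d)), d, c))
  · rintro ⟨a, b, c, d⟩ hx
    exact (main μ ν a b c d hμ hν hx).1
  · rintro ⟨a, b, c, d⟩ hx
    exact (main ν μ a b c d hν hμ hx).1
  · rintro ⟨a, b, c, d⟩ hx
    simp only [(main μ ν a b c d hμ hν hx).2, Prod.mk.injEq]
    refine ⟨by ring, by ring, trivial⟩
  · rintro ⟨a, b, c, d⟩ hx
    simp only [(main ν μ a b c d hν hμ hx).2, Prod.mk.injEq]
    refine ⟨by ring, by ring, trivial⟩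

/-- negative `d`, left -/
def Ln (ν : ℤ) (a b c d : ℤ) : Prop := 0 < c ∧ d < 0 ∧ 0 ≤ a - d ∧ a - d < ν * c ∧ c ≤ b
/-- negative `d`, right: in swapped type -/
def Rn (ν : ℤ) (a b c d : ℤ) : Prop := 0 < c ∧ d < 0 ∧ 0 < a - d ∧ a - d ≤ ν * c ∧ c < b

lemma LRn {l μ ν : ℤ} (ht : Ty l μ ν) (n : ℤ) : (Sx μ ν n (Ln ν)).ncard = (Sx ν μ n (Rn μ)).ncard := by
  obtain ⟨hμ, hν, -, -⟩ := ht.pos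
  apply ncard_eq_of_inv (fun x => match x with
    | (a, b, c, d) => (-b + μ * (-d) * ((b - c) / (μ * (-d)) + 1), ν * c * ((b - c) / (μ * (-d)) + 1) - a, -d, -c))
    (fun x => match x with
    | (a, b, c, d) => (ν * (-d) * ((b - c - 1) / (ν * (-d)) + 1) - b, -a + μ * c * ((b - c - 1) / (ν * (-d)) + 1), -d, -c))
  · rintro ⟨a, b, c, d⟩ ⟨hk, hc, hd, h1, h2, h3⟩
    have hX : 0 < ν * c := mul_pos hν hc
    have hY : 0 < μ * (-d) := mul_pos hμ (by linarith)
    have e1 := Int.emod_add_mul_ediv (b - c) (μ * (-d))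
    have e2 := Int.emod_nonneg (b - c) hY.ne'
    have e3 := Int.emod_lt_of_pos (b - c) hY
    set k := (b - c) / (μ * (-d)) with hkk
    have hk0 : 0 ≤ k := Int.ediv_nonneg (by linarith) hY.le
    have : 0 ≤ ν * c * k := by positivity
    refine ⟨?_, by linarith, by linarith, ?_, ?_, ?_⟩
    · linear_combination hk
    · linarith
    · linarith
    · linarith
  · rintro ⟨a, b, c, d⟩ ⟨hk, hc, hd, h1, h2, h3⟩
    have hX : 0 < μ * c := mul_pos hμ hc
    have hY : 0 < ν * (-d) := mul_pos hν (by linarith)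
    have e1 := Int.emod_add_mul_ediv (b - c - 1) (ν * (-d))
    have e2 := Int.emod_nonneg (b - c - 1) hY.ne'
    have e3 := Int.emod_lt_of_pos (b - c - 1) hY
    set k := (b - c - 1) / (ν * (-d)) with hkk
    have hk0 : 0 ≤ k := Int.ediv_nonneg (by linarith) hY.le
    have : 0 ≤ μ * c * k := by positivity
    refine ⟨?_, by linarith, by linarith, ?_, ?_, ?_⟩
    · linear_combination hk
    · linarith
    · linarith
    · linarith
  · rintro ⟨a, b, c, d⟩ ⟨hk, hc, hd, h1, h2, h3⟩
    have hX : 0 < ν * c := mul_pos hν hc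
    dsimp only
    set k := (b - c) / (μ * (-d)) with hkk
    have : (ν * c * (k + 1) - a - (-d) - 1) / (ν * (-(-c))) = k := by
      rw [show ν * c * (k + 1) - a - (-d) - 1 = (ν * c - 1 - (a - d)) + ν * c * k by ring, neg_neg,
        Int.add_mul_ediv_left _ _ hX.ne', Int.ediv_eq_zero_of_lt (by linarith) (by linarith), zero_add]
    simp only [this, Prod.mk.injEq]
    refine ⟨by ring, by ring, by ring, by ring⟩
  · rintro ⟨a, b, c, d⟩ ⟨hk, hc, hd, h1, h2, h3⟩
    have hX : 0 < μ * c := mul_pos hμ hc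
    dsimp only
    set k := (b - c - 1) / (ν * (-d)) with hkk
    have : (-a + μ * c * (k + 1) - (-d)) / (μ * (-(-c))) = k := by
      rw [show -a + μ * c * (k + 1) - (-d) = (μ * c - (a - d)) + μ * c * k by ring, neg_neg,
        Int.add_mul_ediv_left _ _ hX.ne', Int.ediv_eq_zero_of_lt (by linarith) (by linarith), zero_add]
    simp only [this, Prod.mk.injEq]
    refine ⟨by ring, by ring, by ring, by ring⟩



def Zs (ν : ℤ) (a b c d : ℤ) : Prop := d = 0 ∧ 0 < a ∧ a ≤ ν * c ∧ 0 < c ∧ c < b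
def Zt (ν : ℤ) (a b c d : ℤ) : Prop := d = 0 ∧ 0 ≤ a ∧ a < ν * c ∧ 0 < c ∧ c < b
def Ks (ν : ℤ) (a b c d : ℤ) : Prop := d = 0 ∧ 0 < a ∧ a < ν * c ∧ 0 < c ∧ b = c
def Kt (ν : ℤ) (a b c d : ℤ) : Prop := a = 0 ∧ d < 0 ∧ -d < ν * c ∧ 0 < c ∧ b = c
def Es (a b c d : ℤ) : Prop := a < 0 ∧ a = d ∧ 0 < c ∧ b = c
def Is (ν : ℤ) (a b c d : ℤ) : Prop := a < 0 ∧ 0 < a - d ∧ a - d < ν * c ∧ 0 < c ∧ b = c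
def Js (ν : ℤ) (a b c d : ℤ) : Prop := a < 0 ∧ a - d = ν * c ∧ 0 < c ∧ b = c
def Us (ν : ℤ) (a b c d : ℤ) : Prop := a ≤ 0 ∧ d < 0 ∧ 0 ≤ a - d ∧ a - d < ν * c ∧ 0 < c ∧ b = c
def Vs (ν : ℤ) (a b c d : ℤ) : Prop := a < 0 ∧ 0 < a - d ∧ a - d ≤ ν * c ∧ 0 < c ∧ b = c

lemma Zst (μ ν n : ℤ) : (Sx μ ν n (Zs ν)).ncard = (Sx μ ν n (Zt ν)).ncard := by
  apply ncard_eq_of_inv (fun x => match x with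
    | (a, b, c, d) => (a - 1, b, c, d))
    (fun x => match x with
    | (a, b, c, d) => (a + 1, b, c, d))
  · rintro ⟨a, b, c, d⟩ ⟨h, rfl, h1, h2, h3, h4⟩
    exact ⟨by linarith, rfl, by linarith, by linarith, h3, h4⟩
  · rintro ⟨a, b, c, d⟩ ⟨h, rfl, h1, h2, h3, h4⟩
    exact ⟨by linarith, rfl, by linarith, by linarith, h3, h4⟩
  · rintro ⟨a, b, c, d⟩ _; simp
  · rintro ⟨a, b, c, d⟩ _; simp

lemma Kst (μ ν n : ℤ) : (Sx μ ν n (Ks ν)).ncard = (Sx μ ν n (Kt ν)).ncard := by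
  apply ncard_eq_of_inv (fun x => match x with
    | (a, b, c, d) => (-d, b, c, -a))
    (fun x => match x with
    | (a, b, c, d) => (-d, b, c, -a))
  · rintro ⟨a, b, c, d⟩ ⟨h, rfl, h1, h2, h3, h4⟩
    exact ⟨by linarith, by simp, by linarith, by linarith, h3, h4⟩
  · rintro ⟨a, b, c, d⟩ ⟨h, rfl, h1, h2, h3, h4⟩
    exact ⟨by linarith, by simp, by linarith, by linarith, h3, h4⟩
  · rintro ⟨a, b, c, d⟩ _; simp
  · rintro ⟨a, b, c, d⟩ _; simp

lemma Es_symm (μ ν n : ℤ) : (Sx μ ν n Es).ncard = (Sx ν μ n Es).ncard := by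
  apply ncard_eq_of_inv (fun x => match x with
    | (a, b, c, d) => (-c, -a, -a, -c))
    (fun x => match x with
    | (a, b, c, d) => (-c, -a, -a, -c))
  · rintro ⟨a, b, c, d⟩ ⟨h, h1, rfl, h2, rfl⟩
    exact ⟨by linarith, by linarith, rfl, by linarith, rfl⟩
  · rintro ⟨a, b, c, d⟩ ⟨h, h1, rfl, h2, rfl⟩
    exact ⟨by linarith, by linarith, rfl, by linarith, rfl⟩
  · rintro ⟨a, b, c, d⟩ ⟨h, h1, rfl, h2, rfl⟩; simp
  · rintro ⟨a, b, c, d⟩ ⟨h, h1, rfl, h2, rfl⟩; simp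

lemma Js_symm (μ ν n : ℤ) : (Sx μ ν n (Js ν)).ncard = (Sx ν μ n (Js μ)).ncard := by
  apply ncard_eq_of_inv (fun x => match x with
    | (a, b, c, d) => (-c, -a, -a, -c + μ * a))
    (fun x => match x with
    | (a, b, c, d) => (-c, -a, -a, -c + ν * a))
  · rintro ⟨a, b, c, d⟩ ⟨h, h1, h2, h3, rfl⟩
    obtain rfl : d = a - ν * b := by linarith
    exact ⟨by linear_combination h, by linarith, by linarith, by linarith, rfl⟩
  · rintro ⟨a, b, c, d⟩ ⟨h, h1, h2, h3, rfl⟩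
    obtain rfl : d = a - μ * b := by linarith
    exact ⟨by linear_combination h, by linarith, by linarith, by linarith, rfl⟩
  · rintro ⟨a, b, c, d⟩ ⟨h, h1, h2, h3, rfl⟩
    simp; linarith
  · rintro ⟨a, b, c, d⟩ ⟨h, h1, h2, h3, rfl⟩
    simp; linarith

lemma RP_dec {l μ ν : ℤ} (ht : Ty l μ ν) (n : ℤ) : RP μ ν n =
    (Sx μ ν n (Lp ν 1)).ncard + ((Sx μ ν n (Zs ν)).ncard + ((Sx μ ν n (Rn ν)).ncard +
      ((Sx μ ν n (Is ν)).ncard + (Sx μ ν n (Js ν)).ncard))) := by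
  unfold RP
  rcases ht.pos with ⟨_, hν, _, _⟩
  have hν3 : ν = 1 ∨ ν = 3 := by unfold Ty at ht; omega
  rw [Sx_split ht n (Lp ν 1) (fun a b c d => d ≤ 0 ∧ Qp ν a b c d),
    Sx_split ht n (Zs ν) (fun a b c d => d < 0 ∧ Qp ν a b c d) (P := fun a b c d => d ≤ 0 ∧ Qp ν a b c d),
    Sx_split ht n (Rn ν) (Vs ν) (P := fun a b c d => d < 0 ∧ Qp ν a b c d),
    Sx_split ht n (Is ν) (Js ν) (P := Vs ν)]
  all_goals
    simp only [Lp, Qp, Zs, Rn, Vs, Is, Js]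
    intro a b c d
    rcases hν3 with rfl | rfl <;> omega

lemma RM_dec {l μ ν : ℤ} (ht : Ty l μ ν) (n : ℤ) : RM μ ν n +
    ((Sx μ ν n (Ks ν)).ncard + ((Sx μ ν n Es).ncard + (Sx μ ν n (Is ν)).ncard)) =
    (Sx μ ν n (Lp ν 0)).ncard + ((Sx μ ν n (Zs ν)).ncard + (Sx μ ν n (Ks ν)).ncard + (Sx μ ν n (Ln ν)).ncard) := by
  unfold RM
  rcases ht.pos with ⟨_, hν, _, _⟩
  have hν3 : ν = 1 ∨ ν = 3 := by unfold Ty at ht; omega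
  have hU : (Sx μ ν n (Us ν)).ncard = ((Sx μ ν n (Ks ν)).ncard + ((Sx μ ν n Es).ncard + (Sx μ ν n (Is ν)).ncard)) := by
    rw [Kst, Sx_split ht n (Kt ν) (fun a b c d => a < 0 ∧ Us ν a b c d),
      Sx_split ht n Es (Is ν) (P := fun a b c d => a < 0 ∧ Us ν a b c d)]
    all_goals
      simp only [Us, Es, Is, Kt]
      intro a b c d
      rcases hν3 with rfl | rfl <;> omega
  rw [← hU, Zst]
  rw [Sx_split ht n (Lp ν 0) (fun a b c d => d ≤ 0 ∧ Qm ν a b c d),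
    Sx_split ht n (fun a b c d => d = 0 ∧ Qm ν a b c d) (fun a b c d => d < 0 ∧ Qm ν a b c d) (P := fun a b c d => d ≤ 0 ∧ Qm ν a b c d),
    Sx_split ht n (Zt ν) (Ks ν) (P := fun a b c d => d = 0 ∧ Qm ν a b c d),
    Sx_split ht n (fun a b c d => d < 0 ∧ Qm ν a b c d) (Us ν) (P := Ln ν)]
  · ring
  all_goals
    simp only [Lp, Qm, Zt, Ln, Us, Ks]
    intro a b c d
    rcases hν3 with rfl | rfl <;> omega

lemma rightW (n : ℤ) : RP 3 1 n + RM 3 1 n + 2 * (Sx 1 3 n (Zs 3)).ncard =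
    RP 1 3 n + RM 1 3 n + 2 * (Sx 3 1 n (Zs 1)).ncard := by
  have t1 : Ty 3 3 1 := by unfold Ty; omega
  have t2 : Ty 3 1 3 := by unfold Ty; omega
  have a1 := RP_dec t1 n
  have a2 := RP_dec t2 n
  have a3 := RM_dec t1 n
  have a4 := RM_dec t2 n
  have b1 := Lp_symm t1 n 1
  have b2 := Lp_symm t1 n 0
  have b3 := LRn t1 n
  have b4 := LRn t2 n
  have b5 := Es_symm 3 1 n
  have b6 := Js_symm 3 1 n
  omega

/-- evaluation of the `Z` sets -/
lemma Zs_card (μ ν : ℤ) (hν : 0 < ν) (m : ℕ) (hm : 0 < m) : (Sx μ ν (ν * m) (Zs ν)).ncard = ν.toNat * small m := by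
  have hmem : ∀ x ∈ Sx μ ν (ν * m) (Zs ν), x.2.2.1.toNat ∈ m.divisors := by
    rintro ⟨a, b, c, d⟩ ⟨h, rfl, h1, h2, h3, h4⟩
    rw [Nat.mem_divisors]
    refine ⟨?_, hm.ne'⟩
    rw [← Int.natCast_dvd_natCast]
    dsimp only
    rw [Int.toNat_of_nonneg h3.le]
    refine ⟨b, mul_left_cancel₀ hν.ne' (by linear_combination -h)⟩
  have key : ∀ g ∈ m.divisors, {x ∈ Sx μ ν (ν * m) (Zs ν) | x.2.2.1.toNat = g} =
      if g < m / g then (fun a : ℤ => ((a, ((m / g : ℕ) : ℤ), (g : ℤ), 0) : V4)) '' (Set.Ioc 0 (ν * g)) else ∅ := by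
    intro g hg
    have hgd := (Nat.mem_divisors.1 hg).1
    have hg0 : 0 < g := Nat.pos_of_mem_divisors hg
    obtain ⟨D, rfl⟩ := hgd
    rw [Nat.mul_div_cancel_left _ hg0]
    ext ⟨a, b, c, d⟩
    constructor
    · rintro ⟨⟨h, rfl, h1, h2, h3, h4⟩, hgg⟩
      dsimp only at hgg
      have hcg : c = g := by omega
      subst hcg
      have hb : b = D := by
        have h' : (ν * g) * b = (ν * g) * D := by push_cast at h; linear_combination h
        exact mul_left_cancel₀ (by positivity) h'
      subst hb
      rw [if_pos (by omega)]
      exact ⟨a, ⟨h1, h2⟩, rfl⟩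
    · split_ifs with hlt
      · rintro ⟨a', ⟨h1, h2⟩, heq⟩
        simp only [Prod.mk.injEq] at heq
        obtain ⟨rfl, rfl, rfl, rfl⟩ := heq
        refine ⟨⟨by push_cast; ring, rfl, h1, h2, by omega, by omega⟩, by simp⟩
      · simp
  have hfin : (Sx μ ν (ν * m) (Zs ν)).Finite := by
    have : Sx μ ν (ν * m) (Zs ν) = ⋃ g ∈ m.divisors, {x ∈ Sx μ ν (ν * m) (Zs ν) | x.2.2.1.toNat = g} := by
      ext x
      simp only [Set.mem_iUnion]
      constructor
      · intro hx; exact ⟨_, hmem x hx, hx, rfl⟩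
      · rintro ⟨_, _, hx, _⟩; exact hx
    rw [this]
    refine Set.Finite.biUnion (Finset.finite_toSet _) ?_
    intro g hg
    rw [key g hg]
    split_ifs
    · exact (Set.finite_Ioc _ _).image _
    · exact Set.finite_empty
  rw [ncard_fiber hfin (fun x => x.2.2.1.toNat) m.divisors hmem]
  unfold small
  rw [Finset.mul_sum]
  apply Finset.sum_congr rfl
  intro g hg
  rw [key g hg]
  split_ifs
  · rw [Set.ncard_image_of_injective _ (fun a b h => by simpa using h),
      ← Finset.coe_Ioc, Set.ncard_coe_finset, Int.card_Ioc, sub_zero, Int.toNat_mul hν.le (by positivity)]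
    simp
  · simp

lemma Z1 (n : ℕ) (hn : 0 < n) : (Sx 3 1 n (Zs 1)).ncard = small n := by
  have := Zs_card 3 1 one_pos n hn
  simpa using this

lemma Z3 (n : ℕ) (hn : 0 < n) : (Sx 1 3 n (Zs 3)).ncard = if 3 ∣ n then 3 * small (n / 3) else 0 := by
  split_ifs with h
  · obtain ⟨m, rfl⟩ := h
    have := Zs_card 1 3 (by norm_num) m (by omega)
    simpa using this
  · convert Set.ncard_empty V4
    rw [Set.eq_empty_iff_forall_notMem]
    rintro ⟨a, b, c, d⟩ ⟨h1, rfl, _⟩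
    apply h
    rw [← Int.natCast_dvd_natCast]
    exact ⟨b * c, by push_cast; linear_combination -h1⟩

/-- final count for λ = 1 -/
lemma count_one (n : ℕ) (hn : 0 < n) : RP 1 1 n + RM 1 1 n = 2 * big n := by
  rw [← GP_one, ← GM_one, wall, S_one n hn]; ring

lemma count_three (n : ℕ) (hn : 0 < n) : RP 3 1 n + RM 3 1 n + (if 3 ∣ n then 3 * small (n / 3) else 0) =
    big n + (if 3 ∣ n then 3 * big (n / 3) else 0) + small n := by
  have h1 := rightW n
  rw [Z1 n hn, Z3 n hn] at h1
  have h2 := S_three n hn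
  have h3 := wall 3 n 1 0 1
  rw [GP_three] at h2
  rw [GP_three, GM_three] at h3
  omega



/-- six times the boundary weight -/
def w6 (k c e b : ℤ) : ℤ :=
  if 0 < b ∧ 0 < c ∧ -b ≤ e ∧ e ≤ b ∧ -c ≤ e ∧ e ≤ c then
    (if -b < e ∧ e < b ∧ -c < e ∧ e < c then 6 else if b = c then k else 3) else 0

def u6 (k c e b : ℤ) : ℤ :=
  if 0 < c ∧ c ≤ b ∧ 0 ≤ e ∧ e ≤ c then
    (if e = 0 then (if c < b then 12 else 6) else if e < c then (if c < b then 24 else 12)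
      else (if c < b then 12 else 2 * k)) else 0

lemma u6_w6 (k c e b : ℤ) : u6 k c e b + u6 k c (-e) b + u6 k b e c + u6 k b (-e) c = 4 * w6 k c e b := by
  by_cases hw : 0 < b ∧ 0 < c ∧ -b ≤ e ∧ e ≤ b ∧ -c ≤ e ∧ e ≤ c
  · obtain ⟨h1, h2, h3, h4, h5, h6⟩ := hw
    unfold u6 w6
    rcases lt_trichotomy b c with h | h | h
    · rcases lt_trichotomy e 0 with h' | h' | h'
      · rcases eq_or_lt_of_le h3 with g | g
        · simp (disch := omega) only [if_pos, if_neg]; try omega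
        · simp (disch := omega) only [if_pos, if_neg]; try omega
      · simp (disch := omega) only [if_pos, if_neg]; try omega
      · rcases eq_or_lt_of_le h4 with g | g
        · simp (disch := omega) only [if_pos, if_neg]; try omega
        · simp (disch := omega) only [if_pos, if_neg]; try omega
    · rcases lt_trichotomy e 0 with h' | h' | h'
      · rcases eq_or_lt_of_le h3 with g | g
        · simp (disch := omega) only [if_pos, if_neg]; try omega
        · simp (disch := omega) only [if_pos, if_neg]; try omega
      · simp (disch := omega) only [if_pos, if_neg]; try omega
      · rcases eq_or_lt_of_le h4 with g | g
        · simp (disch := omega) only [if_pos, if_neg]; try omega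
        · simp (disch := omega) only [if_pos, if_neg]; try omega
    · rcases lt_trichotomy e 0 with h' | h' | h'
      · rcases eq_or_lt_of_le h5 with g | g
        · simp (disch := omega) only [if_pos, if_neg]; try omega
        · simp (disch := omega) only [if_pos, if_neg]; try omega
      · simp (disch := omega) only [if_pos, if_neg]; try omega
      · rcases eq_or_lt_of_le h6 with g | g
        · simp (disch := omega) only [if_pos, if_neg]; try omega
        · simp (disch := omega) only [if_pos, if_neg]; try omega
  · unfold u6 w6
    simp (disch := omega) only [if_neg]; try omega

def Bx (a b c d : ℤ) : Prop := 0 < b ∧ 0 < c ∧ -b ≤ a - d ∧ a - d ≤ b ∧ -c ≤ a - d ∧ a - d ≤ c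

lemma Bx_bd {l a b c d n : ℤ} (hl : l = 1 ∨ l = 3) (h : l * a * d + 1 * b * c = n) (hb : Bx a b c d) :
    0 < n ∧ b ≤ 4 * n ∧ c ≤ 4 * n ∧ (a + d) ^ 2 ≤ 4 * n := by
  obtain ⟨h1, h2, h3, h4, h5, h6⟩ := hb
  have he : (a - d) ^ 2 ≤ b * c := by
    rcases le_total 0 (a - d) with g | g
    · nlinarith
    · nlinarith
  have hbc : 0 < b * c := mul_pos h1 h2
  have hb : b ≤ b * c := by nlinarith
  have hc : c ≤ b * c := by nlinarith
  have e1 : (a - d) ^ 2 = (a + d) ^ 2 - 4 * (a * d) := by ring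
  have e2 : l * a * d = l * (a * d) := by ring
  have := sq_nonneg (a + d)
  rcases hl with rfl | rfl <;> refine ⟨by nlinarith, by nlinarith, by nlinarith, by nlinarith⟩

lemma Bx_fin {l : ℤ} (hl : l = 1 ∨ l = 3) (n : ℤ) : (Sx l 1 n Bx).Finite := by
  apply Set.Finite.subset (Finset.finite_toSet (Finset.Icc (-4 * n) (4 * n) ×ˢ Finset.Icc (-4 * n) (4 * n)
    ×ˢ Finset.Icc (-4 * n) (4 * n) ×ˢ Finset.Icc (-4 * n) (4 * n)))
  rintro ⟨a, b, c, d⟩ ⟨h, hb⟩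
  obtain ⟨h0, h1, h2, h3⟩ := Bx_bd hl h hb
  obtain ⟨g1, g2, g3, g4, g5, g6⟩ := hb
  have h4 := abs_le_of_sq (m := 1) (n := 4 * n) one_pos (by rw [one_mul]; exact h3)
  simp only [Finset.coe_product, Set.mem_prod, Finset.coe_Icc, Set.mem_Icc]
  omega

noncomputable def FF (l n : ℤ) : Finset V4 := by
  classical
  exact if h : (Sx l 1 n Bx).Finite then h.toFinset else ∅

lemma mem_FF {l : ℤ} (hl : l = 1 ∨ l = 3) (n : ℤ) (a b c d : ℤ) :
    (a, b, c, d) ∈ FF l n ↔ l * a * d + b * c = n ∧ Bx a b c d := by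
  have := Bx_fin hl n
  simp only [FF, this, dif_pos, Set.Finite.mem_toFinset]
  simp only [Sx, Set.mem_ofPred_eq, one_mul]

lemma FF_card {l : ℤ} (hl : l = 1 ∨ l = 3) (n : ℤ) (P : ℤ → ℤ → ℤ → ℤ → Prop)
    [∀ a b c d, Decidable (P a b c d)] (h : ∀ a b c d, P a b c d → Bx a b c d) :
    ∑ x ∈ FF l n, (if P x.1 x.2.1 x.2.2.1 x.2.2.2 then (1 : ℤ) else 0) = (Sx l 1 n P).ncard := by
  rw [← Finset.sum_filter, Finset.sum_const, ← Set.ncard_coe_finset]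
  simp only [nsmul_eq_mul, mul_one, Nat.cast_inj]
  congr 1
  ext ⟨a, b, c, d⟩
  simp only [Finset.coe_filter, mem_FF hl, Set.mem_ofPred_eq, Sx, one_mul]
  have := h a b c d
  tauto

lemma FF_sigma1 {l : ℤ} (hl : l = 1 ∨ l = 3) (n : ℤ) (f : ℤ → ℤ → ℤ → ℤ) :
    ∑ x ∈ FF l n, f x.2.2.1 (-(x.1 - x.2.2.2)) x.2.1 = ∑ x ∈ FF l n, f x.2.2.1 (x.1 - x.2.2.2) x.2.1 := by
  apply Finset.sum_nbij' (fun x => (x.2.2.2, x.2.1, x.2.2.1, x.1)) (fun x => (x.2.2.2, x.2.1, x.2.2.1, x.1))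
  · rintro ⟨a, b, c, d⟩ h
    rw [mem_FF hl] at h ⊢
    unfold Bx at *
    exact ⟨by rw [← h.1]; ring, by dsimp only; omega⟩
  · rintro ⟨a, b, c, d⟩ h
    rw [mem_FF hl] at h ⊢
    unfold Bx at *
    exact ⟨by rw [← h.1]; ring, by dsimp only; omega⟩
  · intros; rfl
  · intros; rfl
  · rintro ⟨a, b, c, d⟩ h
    simp

lemma FF_sigma2 {l : ℤ} (hl : l = 1 ∨ l = 3) (n : ℤ) (f : ℤ → ℤ → ℤ → ℤ) :
    ∑ x ∈ FF l n, f x.2.1 (x.1 - x.2.2.2) x.2.2.1 = ∑ x ∈ FF l n, f x.2.2.1 (x.1 - x.2.2.2) x.2.1 := by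
  apply Finset.sum_nbij' (fun x => (x.1, x.2.2.1, x.2.1, x.2.2.2)) (fun x => (x.1, x.2.2.1, x.2.1, x.2.2.2))
  · rintro ⟨a, b, c, d⟩ h
    rw [mem_FF hl] at h ⊢
    unfold Bx at *
    exact ⟨by rw [← h.1]; ring, by dsimp only; omega⟩
  · rintro ⟨a, b, c, d⟩ h
    rw [mem_FF hl] at h ⊢
    unfold Bx at *
    exact ⟨by rw [← h.1]; ring, by dsimp only; omega⟩
  · intros; rfl
  · intros; rfl
  · rintro ⟨a, b, c, d⟩ h
    simp

lemma sum_w6_u6 {l : ℤ} (hl : l = 1 ∨ l = 3) (n k : ℤ) :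
    ∑ x ∈ FF l n, w6 k x.2.2.1 (x.1 - x.2.2.2) x.2.1 = ∑ x ∈ FF l n, u6 k x.2.2.1 (x.1 - x.2.2.2) x.2.1 := by
  have h1 := FF_sigma1 hl n (u6 k)
  have h2 := FF_sigma2 hl n (u6 k)
  have h3 := FF_sigma2 hl n (fun c e b => u6 k c (-e) b)
  have h : ∑ x ∈ FF l n, 4 * w6 k x.2.2.1 (x.1 - x.2.2.2) x.2.1 = 4 * ∑ x ∈ FF l n, u6 k x.2.2.1 (x.1 - x.2.2.2) x.2.1 := by
    simp only [← u6_w6, Finset.sum_add_distrib]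
    rw [h1, h2, h3, h1]; ring
  rw [← Finset.mul_sum] at h
  omega

def X0 (a b c d : ℤ) : Prop := 0 < a - d ∧ a - d < c ∧ b = c ∧ a = 0
def X1 (a b c d : ℤ) : Prop := a - d = c ∧ b = c ∧ 0 < c
def X1m (a b c d : ℤ) : Prop := a - d = c ∧ b = c ∧ 0 < c ∧ a < 0
def X2 (a b c d : ℤ) : Prop := a - d = 0 ∧ b = c ∧ 0 < c
def X2p (a b c d : ℤ) : Prop := a - d = 0 ∧ b = c ∧ 0 < c ∧ 0 < a

open Classical in
lemma u6_dec (k a b c d : ℤ) : u6 k c (a - d) b = 12 * (if Qp 1 a b c d then 1 else 0) +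
    12 * (if Qm 1 a b c d then 1 else 0) + 12 * (if X0 a b c d then 1 else 0) + 2 * k * (if X1 a b c d then 1 else 0)
    - 12 * (if X1m a b c d then 1 else 0) + 6 * (if X2 a b c d then 1 else 0) - 12 * (if X2p a b c d then 1 else 0) := by
  unfold u6 Qp Qm X0 X1 X1m X2 X2p
  by_cases hw : 0 < c ∧ c ≤ b ∧ 0 ≤ a - d ∧ a - d ≤ c
  · obtain ⟨h1, h2, h3, h4⟩ := hw
    rcases eq_or_lt_of_le h2 with g2 | g2 <;> rcases eq_or_lt_of_le h3 with g3 | g3 <;>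
    rcases eq_or_lt_of_le h4 with g4 | g4 <;> try omega
    all_goals rcases lt_trichotomy a 0 with g | g | g <;> 
      (simp (disch := omega) only [if_pos, if_neg]; try omega)
  · simp (disch := omega) only [if_neg]; try omega

lemma sum_dec {l : ℤ} (hl : l = 1 ∨ l = 3) (n k : ℤ) :
    ∑ x ∈ FF l n, w6 k x.2.2.1 (x.1 - x.2.2.2) x.2.1 = 12 * (RP l 1 n + RM l 1 n) + 12 * (Sx l 1 n X0).ncard
     + 2 * k * (Sx l 1 n X1).ncard - 12 * (Sx l 1 n X1m).ncard + 6 * (Sx l 1 n X2).ncard - 12 * (Sx l 1 n X2p).ncard := by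
  classical
  rw [sum_w6_u6 hl]
  simp only [u6_dec, Finset.sum_add_distrib, Finset.sum_sub_distrib, ← Finset.mul_sum]
  rw [FF_card hl n (Qp 1), FF_card hl n (Qm 1), FF_card hl n X0, FF_card hl n X1, FF_card hl n X1m,
    FF_card hl n X2, FF_card hl n X2p, RP, RM]
  · ring
  all_goals
    intro a b c d h
    simp only [X0, X1, X1m, X2, X2p, Qp, Qm] at h
    unfold Bx; omega



def E2 (l n : ℤ) (P : ℤ → ℤ → Prop) : Set (ℤ × ℤ) := {x | match x with
  | (x, c) => l * x ^ 2 + l * x * c + c ^ 2 = n ∧ P x c}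

lemma E2_finite {l : ℤ} (hl : l = 1 ∨ l = 3) (n : ℤ) (P : ℤ → ℤ → Prop) : (E2 l n P).Finite := by
  apply Set.Finite.subset (Finset.finite_toSet (Finset.Icc (-(4 * n)) (4 * n) ×ˢ Finset.Icc (-(4 * n)) (4 * n)))
  rintro ⟨x, c⟩ ⟨h, _⟩
  have h1 : 3 * x ^ 2 ≤ 4 * n := by
    rcases hl with rfl | rfl
    · nlinarith [sq_nonneg (2 * c + x)]
    · nlinarith [sq_nonneg (2 * c + 3 * x)]
  have h2 : 1 * c ^ 2 ≤ 4 * n := by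
    rcases hl with rfl | rfl
    · nlinarith [sq_nonneg (2 * x + c)]
    · nlinarith [sq_nonneg (2 * x + c)]
  have := abs_le_of_sq (by norm_num) h1
  have := abs_le_of_sq (by norm_num) h2
  simp only [Finset.coe_product, Set.mem_prod, Finset.coe_Icc, Set.mem_Icc]
  omega

lemma E2_split {l : ℤ} (hl : l = 1 ∨ l = 3) (n : ℤ) {P : ℤ → ℤ → Prop} (P1 P2 : ℤ → ℤ → Prop)
    (hs : ∀ x c, P x c ↔ P1 x c ∨ P2 x c) (hd : ∀ x c, P1 x c → P2 x c → False) :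
    (E2 l n P).ncard = (E2 l n P1).ncard + (E2 l n P2).ncard := by
  rw [← Set.ncard_union_eq ?_ (E2_finite hl n _) (E2_finite hl n _)]
  · congr 1
    ext ⟨x, c⟩
    simp only [E2, Set.mem_ofPred_eq, Set.mem_union, hs]
    tauto
  · rw [Set.disjoint_left]
    rintro ⟨x, c⟩ ⟨_, h1⟩ ⟨_, h2⟩
    exact hd _ _ h1 h2

def iS (n : ℕ) : ℕ := if IsSquare n then 1 else 0
def sS (n : ℕ) : ℕ := if IsSquare n then Nat.sqrt n else 0
noncomputable def iT (n : ℕ) : ℕ := by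
  classical
  exact if ∃ m : ℕ, n = 3 * m ^ 2 then 1 else 0

/-- counting positive square roots -/
lemma card_sq (n : ℕ) (hn : 0 < n) : {c : ℤ | 0 < c ∧ c ^ 2 = n}.ncard = iS n := by
  unfold iS
  split_ifs with h
  · obtain ⟨k, rfl⟩ := h
    rw [Set.ncard_eq_one]
    refine ⟨k, ?_⟩
    ext c
    simp only [Set.mem_ofPred_eq, Set.mem_singleton_iff]
    push_cast
    constructor
    · rintro ⟨h1, h2⟩
      have : 0 ≤ (k : ℤ) := by positivity
      nlinarith
    · rintro rfl
      have : 0 < k := Nat.pos_of_mul_pos_right hn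
      exact ⟨by exact_mod_cast this, by ring⟩
  · rw [Set.ncard_eq_zero (by
      apply (Set.finite_Icc (0:ℤ) n).subset
      rintro c ⟨h1, h2⟩
      exact ⟨h1.le, by nlinarith⟩)]
    rw [Set.eq_empty_iff_forall_notMem]
    rintro c ⟨h1, h2⟩
    apply h
    lift c to ℕ using h1.le
    exact ⟨c, by have : c ^ 2 = n := by exact_mod_cast h2
                 rw [← this]; ring⟩

lemma card_sq3 (n : ℕ) (hn : 0 < n) : {c : ℤ | 0 < c ∧ 3 * c ^ 2 = n}.ncard = iT n := by
  unfold iT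
  split_ifs with h
  · obtain ⟨k, rfl⟩ := h
    rw [Set.ncard_eq_one]
    refine ⟨k, ?_⟩
    ext c
    simp only [Set.mem_ofPred_eq, Set.mem_singleton_iff]
    push_cast
    constructor
    · rintro ⟨h1, h2⟩
      have : 0 ≤ (k : ℤ) := by positivity
      nlinarith
    · rintro rfl
      have : 0 < k := by
        rcases Nat.eq_zero_or_pos k with rfl | h
        · simp at hn
        · exact h
      exact ⟨by exact_mod_cast this, by ring⟩
  · rw [Set.ncard_eq_zero (by
      apply (Set.finite_Icc (0:ℤ) n).subset
      rintro c ⟨h1, h2⟩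
      exact ⟨h1.le, by nlinarith⟩)]
    rw [Set.eq_empty_iff_forall_notMem]
    rintro c ⟨h1, h2⟩
    apply h
    lift c to ℕ using h1.le
    exact ⟨c, by exact_mod_cast h2.symm⟩

lemma card_X0 (l : ℤ) (n : ℕ) (hn : 0 < n) : (Sx l 1 n X0).ncard + iS n = sS n := by
  unfold iS sS
  split_ifs with h
  · obtain ⟨k, rfl⟩ := h
    have hk : 0 < k := Nat.pos_of_mul_pos_right hn
    rw [Nat.sqrt_eq]
    have : (Sx l 1 ((k * k : ℕ) : ℤ) X0).ncard = ((Finset.Ioo (0 : ℤ) k : Finset ℤ) : Set ℤ).ncard := by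
      apply ncard_eq_of_inv (fun x => - x.2.2.2) (fun x => (0, (k : ℤ), (k : ℤ), -x))
      · rintro ⟨a, b, c, d⟩ ⟨h1, h2, h3, rfl, rfl⟩
        have : b = k := by
          push_cast at h1
          nlinarith
        simp only [Finset.coe_Ioo, Set.mem_Ioo]
        omega
      · intro y hy
        simp only [Finset.coe_Ioo, Set.mem_Ioo] at hy
        exact ⟨by push_cast; ring, by omega, by omega, rfl, rfl⟩
      · rintro ⟨a, b, c, d⟩ ⟨h1, h2, h3, rfl, rfl⟩
        have : b = k := by
          push_cast at h1
          nlinarith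
        simp [this]
      · intro y _
        simp
    rw [this, Set.ncard_coe_finset, Int.card_Ioo]
    omega
  · rw [add_zero]
    convert Set.ncard_empty V4
    rw [Set.eq_empty_iff_forall_notMem]
    rintro ⟨a, b, c, d⟩ ⟨h1, h2, h3, rfl, rfl⟩
    apply h
    have hb : 0 ≤ b := by omega
    lift b to ℕ using hb
    refine ⟨b, ?_⟩
    zify
    linear_combination -h1

lemma card_X2 {l : ℤ} (ht : Ty l l 1) (n : ℕ) (hn : 0 < n) : (Sx l 1 n X2).ncard = 2 * (Sx l 1 n X2p).ncard + iS n := by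
  have h1 : (Sx l 1 n X2).ncard = (Sx l 1 n X2p).ncard + (Sx l 1 n (fun a b c d => a - d = 0 ∧ b = c ∧ 0 < c ∧ a ≤ 0)).ncard := by
    apply Sx_split ht
    · intro a b c d; unfold X2; omega
    · intro a b c d; unfold X2 X2p; omega
    · intro a b c d; unfold X2p; omega
  have h2 : (Sx l 1 n (fun a b c d => a - d = 0 ∧ b = c ∧ 0 < c ∧ a ≤ 0)).ncard =
    (Sx l 1 n (fun a b c d => a - d = 0 ∧ b = c ∧ 0 < c ∧ a < 0)).ncard + (Sx l 1 n (fun a b c d => d = 0 ∧ b = c ∧ 0 < c ∧ a = 0)).ncard := by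
    apply Sx_split ht
    · intro a b c d; omega
    · intro a b c d; omega
    · intro a b c d; omega
  have h3 : (Sx l 1 n (fun a b c d => a - d = 0 ∧ b = c ∧ 0 < c ∧ a < 0)).ncard = (Sx l 1 n X2p).ncard := by
    apply ncard_eq_of_inv (fun x => (-x.1, x.2.1, x.2.2.1, -x.2.2.2)) (fun x => (-x.1, x.2.1, x.2.2.1, -x.2.2.2))
    · rintro ⟨a, b, c, d⟩ ⟨h1, h2⟩
      exact ⟨by rw [← h1]; ring, by unfold X2p; dsimp only; omega⟩
    · rintro ⟨a, b, c, d⟩ ⟨h1, h2⟩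
      exact ⟨by rw [← h1]; ring, by unfold X2p at h2; dsimp only; omega⟩
    · intros; simp
    · intros; simp
  have h4 : (Sx l 1 n (fun a b c d => d = 0 ∧ b = c ∧ 0 < c ∧ a = 0)).ncard = iS n := by
    rw [← card_sq n hn]
    apply ncard_eq_of_inv (fun x => x.2.1) (fun x => (0, x, x, 0))
    · rintro ⟨a, b, c, d⟩ ⟨h1, rfl, rfl, h2, rfl⟩
      exact ⟨h2, by rw [← h1]; ring⟩
    · rintro c ⟨h1, h2⟩
      exact ⟨by rw [← h2]; ring, rfl, rfl, h1, rfl⟩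
    · rintro ⟨a, b, c, d⟩ ⟨h1, rfl, rfl, h2, rfl⟩
      rfl
    · intros; rfl
  omega

lemma card_X1m (l n : ℤ) : (Sx l 1 n X1m).ncard = (E2 l n (fun x c => 0 < x ∧ 0 < c)).ncard := by
  apply ncard_eq_of_inv (fun x => (-x.1, x.2.2.1)) (fun x => (-x.1, x.2, x.2, -x.1 - x.2))
  · rintro ⟨a, b, c, d⟩ ⟨h1, h2, rfl, h3, h4⟩
    obtain rfl : a = d + b := by omega
    exact ⟨by rw [← h1]; ring, by dsimp only; omega⟩
  · rintro ⟨x, c⟩ ⟨h1, h2⟩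
    exact ⟨by rw [← h1]; ring, by dsimp only; omega, rfl, by dsimp only; omega, by dsimp only; omega⟩
  · rintro ⟨a, b, c, d⟩ ⟨h1, h2, rfl, h3, h4⟩
    obtain rfl : a = d + b := by omega
    simp
  · rintro ⟨x, c⟩ ⟨h1, h2⟩
    simp

lemma card_X1 (l n : ℤ) : (Sx l 1 n X1).ncard = (E2 l n (fun _ c => 0 < c)).ncard := by
  apply ncard_eq_of_inv (fun x => (-x.1, x.2.2.1)) (fun x => (-x.1, x.2, x.2, -x.1 - x.2))
  · rintro ⟨a, b, c, d⟩ ⟨h1, h2, rfl, h3⟩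
    obtain rfl : a = d + b := by omega
    exact ⟨by rw [← h1]; ring, by dsimp only; omega⟩
  · rintro ⟨x, c⟩ ⟨h1, h2⟩
    exact ⟨by rw [← h1]; ring, by dsimp only; omega, rfl, by dsimp only; omega⟩
  · rintro ⟨a, b, c, d⟩ ⟨h1, h2, rfl, h3⟩
    obtain rfl : a = d + b := by omega
    simp
  · rintro ⟨x, c⟩ ⟨h1, h2⟩
    simp

lemma E2_sq0 (l : ℤ) (n : ℕ) (hn : 0 < n) : (E2 l n (fun x c => 0 < c ∧ x = 0)).ncard = iS n := by
  rw [← card_sq n hn]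
  apply ncard_eq_of_inv (fun x => x.2) (fun x => (0, x))
  · rintro ⟨x, c⟩ ⟨h1, h2, rfl⟩
    exact ⟨h2, by rw [← h1]; ring⟩
  · rintro c ⟨h1, h2⟩
    exact ⟨by rw [← h2]; ring, h1, rfl⟩
  · rintro ⟨x, c⟩ ⟨h1, h2, rfl⟩; rfl
  · intros; rfl

/-- reflection x ↦ -c-x -/
lemma E2_refl (l n : ℤ) (P P' : ℤ → ℤ → Prop) (h : ∀ x c, P x c ↔ P' (-c - x) c) :
    (E2 l n P).ncard = (E2 l n P').ncard := by
  apply ncard_eq_of_inv (fun x => (-x.2 - x.1, x.2)) (fun x => (-x.2 - x.1, x.2))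
  · rintro ⟨x, c⟩ ⟨h1, h2⟩
    exact ⟨by rw [← h1]; ring, by rw [← h]; exact h2⟩
  · rintro ⟨x, c⟩ ⟨h1, h2⟩
    refine ⟨by rw [← h1]; ring, ?_⟩
    rw [h]
    simpa using h2
  · rintro ⟨x, c⟩ _; simp
  · rintro ⟨x, c⟩ _; simp

lemma card_rho {l : ℤ} (hl : l = 1 ∨ l = 3) (n : ℕ) (hn : 0 < n) : (E2 l n (fun _ c => 0 < c)).ncard =
    2 * (E2 l n (fun x c => 0 < x ∧ 0 < c)).ncard + 2 * iS n + (E2 l n (fun x c => x < 0 ∧ -c < x)).ncard := by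
  have h1 := E2_split hl n (P := fun _ c => 0 < c) (fun x c => 0 < x ∧ 0 < c) (fun x c => 0 < c ∧ x ≤ 0)
    (by intros; omega) (by intros; omega)
  have h2 := E2_split hl n (P := fun x c => 0 < c ∧ x ≤ 0) (fun x c => 0 < c ∧ x = 0) (fun x c => 0 < c ∧ x < 0)
    (by intros; omega) (by intros; omega)
  have h3 := E2_split hl n (P := fun x c => 0 < c ∧ x < 0) (fun x c => x < 0 ∧ -c < x) (fun x c => 0 < c ∧ x ≤ -c)
    (by intros; omega) (by intros; omega)
  have h4 := E2_split hl n (P := fun x c => 0 < c ∧ x ≤ -c) (fun x c => 0 < c ∧ x < -c) (fun x c => 0 < c ∧ x = -c)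
    (by intros; omega) (by intros; omega)
  have h5 := E2_refl l n (fun x c => 0 < c ∧ x < -c) (fun x c => 0 < x ∧ 0 < c) (by intros; omega)
  have h6 := E2_refl l n (fun x c => 0 < c ∧ x = -c) (fun x c => 0 < c ∧ x = 0) (by intros; omega)
  have h7 := E2_sq0 l n hn
  omega

lemma N3_one (n : ℤ) : (E2 1 n (fun x c => x < 0 ∧ -c < x)).ncard = (E2 1 n (fun x c => 0 < x ∧ 0 < c)).ncard := by
  apply ncard_eq_of_inv (fun x => (-x.1, x.2 + x.1)) (fun x => (-x.1, x.2 + x.1))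
  · rintro ⟨x, c⟩ ⟨h1, h2⟩
    exact ⟨by rw [← h1]; ring, by dsimp only; omega⟩
  · rintro ⟨x, c⟩ ⟨h1, h2⟩
    exact ⟨by rw [← h1]; ring, by dsimp only; omega⟩
  · rintro ⟨x, c⟩ _; simp
  · rintro ⟨x, c⟩ _; simp

lemma N3_three (n : ℕ) (hn : 0 < n) : (E2 3 n (fun x c => x < 0 ∧ -c < x)).ncard =
    4 * (E2 3 n (fun x c => 0 < x ∧ 0 < c)).ncard + 2 * iT n + iS n := by
  have hl : (3 : ℤ) = 1 ∨ (3 : ℤ) = 3 := Or.inr rfl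
  have hl1 : (1 : ℤ) = 1 ∨ (1 : ℤ) = 3 := Or.inl rfl
  have h1 := E2_split hl n (P := fun x c => x < 0 ∧ -c < x) (fun x c => x < 0 ∧ -2 * x < c) (fun x c => x < 0 ∧ -c < x ∧ c ≤ -2 * x)
    (by intros; omega) (by intros; omega)
  have h2 := E2_split hl n (P := fun x c => x < 0 ∧ -c < x ∧ c ≤ -2 * x) (fun x c => -c < x ∧ c < -2 * x) (fun x c => x < 0 ∧ c = -2 * x)
    (by intros; omega) (by intros; omega)
  have h3 : (E2 3 n (fun x c => x < 0 ∧ -2 * x < c)).ncard = (E2 1 n (fun x c => 0 < x ∧ 0 < c)).ncard := by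
    apply ncard_eq_of_inv (fun x => (-x.1, x.2 + 2 * x.1)) (fun x => (-x.1, x.2 + 2 * x.1))
    · rintro ⟨x, c⟩ ⟨h1, h2⟩
      exact ⟨by rw [← h1]; ring, by dsimp only; omega⟩
    · rintro ⟨x, c⟩ ⟨h1, h2⟩
      exact ⟨by rw [← h1]; ring, by dsimp only; omega⟩
    · rintro ⟨x, c⟩ _; simp
    · rintro ⟨x, c⟩ _; simp
  have h4 := E2_refl 3 n (fun x c => -c < x ∧ c < -2 * x) (fun x c => x < 0 ∧ -2 * x < c) (by intros; omega)
  have h5 : (E2 3 n (fun x c => x < 0 ∧ c = -2 * x)).ncard = iS n := by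
    rw [← card_sq n hn]
    apply ncard_eq_of_inv (fun x => -x.1) (fun x => (-x, 2 * x))
    · rintro ⟨x, c⟩ ⟨h1, h2, rfl⟩
      exact ⟨by dsimp only; omega, by rw [← h1]; ring⟩
    · rintro c ⟨h1, h2⟩
      exact ⟨by rw [← h2]; ring, by omega, by ring⟩
    · rintro ⟨x, c⟩ ⟨h1, h2, rfl⟩; simp
    · intros; simp
  have h6 := E2_split hl1 n (P := fun x c => 0 < x ∧ 0 < c) (fun x c => 0 < x ∧ x < c) (fun x c => 0 < c ∧ c ≤ x)
    (by intros; omega) (by intros; omega)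
  have h7 := E2_split hl1 n (P := fun x c => 0 < c ∧ c ≤ x) (fun x c => 0 < c ∧ c < x) (fun x c => 0 < c ∧ c = x)
    (by intros; omega) (by intros; omega)
  have h8 : (E2 1 n (fun x c => 0 < c ∧ c = x)).ncard = iT n := by
    rw [← card_sq3 n hn]
    apply ncard_eq_of_inv (fun x => x.1) (fun x => (x, x))
    · rintro ⟨x, c⟩ ⟨h1, h2, rfl⟩
      exact ⟨by dsimp only; omega, by rw [← h1]; ring⟩
    · rintro c ⟨h1, h2⟩
      exact ⟨by rw [← h2]; ring, by omega, by ring⟩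
    · rintro ⟨x, c⟩ ⟨h1, h2, rfl⟩; simp
    · intros; simp
  have h9 : (E2 1 n (fun x c => 0 < x ∧ x < c)).ncard = (E2 3 n (fun x c => 0 < x ∧ 0 < c)).ncard := by
    apply ncard_eq_of_inv (fun x => (x.1, x.2 - x.1)) (fun x => (x.1, x.2 + x.1))
    · rintro ⟨x, c⟩ ⟨h1, h2⟩
      exact ⟨by rw [← h1]; ring, by dsimp only; omega⟩
    · rintro ⟨x, c⟩ ⟨h1, h2⟩
      exact ⟨by rw [← h1]; ring, by dsimp only; omega⟩
    · rintro ⟨x, c⟩ _; simp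
    · rintro ⟨x, c⟩ _; simp
  have h10 : (E2 1 n (fun x c => 0 < c ∧ c < x)).ncard = (E2 1 n (fun x c => 0 < x ∧ x < c)).ncard := by
    apply ncard_eq_of_inv (fun x => (x.2, x.1)) (fun x => (x.2, x.1))
    · rintro ⟨x, c⟩ ⟨h1, h2⟩
      exact ⟨by rw [← h1]; ring, by dsimp only; omega⟩
    · rintro ⟨x, c⟩ ⟨h1, h2⟩
      exact ⟨by rw [← h1]; ring, by dsimp only; omega⟩
    · rintro ⟨x, c⟩ _; simp
    · rintro ⟨x, c⟩ _; simp
  omega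

lemma bd_one (n : ℕ) (hn : 0 < n) : ∑ x ∈ FF 1 n, w6 2 x.2.2.1 (x.1 - x.2.2.2) x.2.1 =
    24 * big n + 12 * sS n + 2 * iS n := by
  have h1 := sum_dec (l := 1) (Or.inl rfl) n 2
  have h2 := card_X0 1 n hn
  have h3 := card_X2 (l := 1) (Or.inl ⟨rfl, rfl, rfl⟩) n hn
  have h4 := card_X1 1 n
  have h5 := card_X1m 1 n
  have h6 := card_rho (l := 1) (Or.inl rfl) n hn
  have h7 := N3_one n
  have h8 := count_one n hn
  omega

lemma bd_three (n : ℕ) (hn : 0 < n) : ∑ x ∈ FF 3 n, w6 1 x.2.2.1 (x.1 - x.2.2.2) x.2.1 +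
     12 * (if 3 ∣ n then 3 * small (n / 3) else 0 : ℕ) =
    12 * (big n + (if 3 ∣ n then 3 * big (n / 3) else 0) + small n : ℕ) + 12 * sS n + 4 * iT n := by
  have h1 := sum_dec (l := 3) (Or.inr rfl) n 1
  have h2 := card_X0 3 n hn
  have h3 := card_X2 (l := 3) (Or.inr ⟨rfl, Or.inl ⟨rfl, rfl⟩⟩) n hn
  have h4 := card_X1 3 n
  have h5 := card_X1m 3 n
  have h6 := card_rho (l := 3) (Or.inr rfl) n hn
  have h7 := N3_three n hn
  have h8 := count_three n hn
  rw [h1, h4, h5]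
  rw [← h8]
  push_cast
  omega



/-- six times the weight of a reduced form -/
def wF (A B C : ℤ) : ℤ :=
  if 0 < A ∧ -A ≤ B ∧ B ≤ A ∧ A ≤ C then
    (if -A < B ∧ B < A then (if A < C then 6 else 3) else (if A < C then 3 else 1)) else 0

lemma wF_nonneg (A B C : ℤ) : 0 ≤ wF A B C := by
  unfold wF; split_ifs <;> norm_num

lemma wF_ne {A B C : ℤ} : wF A B C ≠ 0 ↔ 0 < A ∧ -A ≤ B ∧ B ≤ A ∧ A ≤ C := by
  unfold wF; split_ifs <;> simp_all

lemma wF_neg (A B C : ℤ) : wF A (-B) C = wF A B C := by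
  unfold wF
  have h1 : (0 < A ∧ -A ≤ -B ∧ -B ≤ A ∧ A ≤ C) ↔ (0 < A ∧ -A ≤ B ∧ B ≤ A ∧ A ≤ C) := by omega
  have h2 : (-A < -B ∧ -B < A) ↔ (-A < B ∧ B < A) := by omega
  simp only [h1, h2]

lemma wF_three (A B C : ℤ) : wF (3 * A) (3 * B) (3 * C) = wF A B C := by
  unfold wF
  have h1 : (0 < 3 * A ∧ -(3 * A) ≤ 3 * B ∧ 3 * B ≤ 3 * A ∧ 3 * A ≤ 3 * C) ↔ (0 < A ∧ -A ≤ B ∧ B ≤ A ∧ A ≤ C) := by omega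
  have h2 : (-(3 * A) < 3 * B ∧ 3 * B < 3 * A) ↔ (-A < B ∧ B < A) := by omega
  have h3 : 3 * A < 3 * C ↔ A < C := by omega
  simp only [h1, h2, h3]

lemma w6_ne {k c e b : ℤ} (h : w6 k c e b ≠ 0) : 0 < b ∧ 0 < c ∧ -b ≤ e ∧ e ≤ b ∧ -c ≤ e ∧ e ≤ c := by
  unfold w6 at h; split_ifs at h <;> first | assumption | simp_all

lemma w6_neg (k c e b : ℤ) : w6 k c (-e) b = w6 k c e b := by
  unfold w6
  have h1 : (0 < b ∧ 0 < c ∧ -b ≤ -e ∧ -e ≤ b ∧ -c ≤ -e ∧ -e ≤ c) ↔ (0 < b ∧ 0 < c ∧ -b ≤ e ∧ e ≤ b ∧ -c ≤ e ∧ e ≤ c) := by omega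
  have h2 : (-b < -e ∧ -e < b ∧ -c < -e ∧ -e < c) ↔ (-b < e ∧ e < b ∧ -c < e ∧ e < c) := by omega
  simp only [h1, h2]

lemma w6_one (c e b : ℤ) : w6 2 c e b = wF c e b + wF b e c := by
  by_cases hw : 0 < b ∧ 0 < c ∧ -b ≤ e ∧ e ≤ b ∧ -c ≤ e ∧ e ≤ c
  · unfold w6 wF
    rcases lt_trichotomy b c with h | h | h
    · by_cases h' : -b < e ∧ e < b <;> (simp (disch := omega) only [if_pos, if_neg]; try omega)
    · by_cases h' : -b < e ∧ e < b <;> (simp (disch := omega) only [if_pos, if_neg]; try omega)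
    · by_cases h' : -c < e ∧ e < c <;> (simp (disch := omega) only [if_pos, if_neg]; try omega)
  · unfold w6 wF
    simp (disch := omega) only [if_neg]; try omega

lemma w6_three_aux (c e b : ℤ) (he : 0 ≤ e) : w6 1 c e b = wF (3 * c) (3 * e) b + wF b (-3 * e) (3 * c) +
    wF b (-3 * e - 2 * b) (3 * c + 3 * e + b) + wF b (2 * b - 3 * e) (3 * c - 3 * e + b) := by
  by_cases hw : 0 < b ∧ 0 < c ∧ -b ≤ e ∧ e ≤ b ∧ -c ≤ e ∧ e ≤ c
  · obtain ⟨h1, h2, h3, h4, h5, h6⟩ := hw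
    rcases lt_trichotomy (3 * e) b with h | h | h <;> rcases lt_trichotomy b (3 * c) with g | g | g <;>
    rcases eq_or_lt_of_le h4 with f | f <;> rcases eq_or_lt_of_le h6 with i | i <;>
    first
      | (exfalso; omega)
      | (unfold w6 wF; simp (disch := omega) only [if_pos, if_neg]; done)
      | (unfold w6 wF; simp (disch := omega) only [if_pos, if_neg]; omega)
  · unfold w6 wF
    simp (disch := omega) only [if_neg]; try omega

lemma w6_three (c e b : ℤ) : w6 1 c e b = wF (3 * c) (3 * e) b + wF b (-3 * e) (3 * c) +
    wF b (-3 * e - 2 * b) (3 * c + 3 * e + b) + wF b (2 * b - 3 * e) (3 * c - 3 * e + b) := by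
  rcases le_total 0 e with h | h
  · exact w6_three_aux c e b h
  · have := w6_three_aux c (-e) b (by omega)
    rw [w6_neg] at this
    rw [this, ← wF_neg _ (3 * e), ← wF_neg _ (-3 * e), ← wF_neg _ (-3 * e - 2 * b), ← wF_neg _ (2 * b - 3 * e)]
    ring_nf

noncomputable def TT (N : ℤ) : Finset (ℤ × ℤ × ℤ) :=
  (Finset.Icc 1 N ×ˢ Finset.Icc (-N) N ×ˢ Finset.Icc 1 N).filter
    (fun Q => 4 * Q.1 * Q.2.2 - Q.2.1 ^ 2 = N ∧ -Q.1 ≤ Q.2.1 ∧ Q.2.1 ≤ Q.1 ∧ Q.1 ≤ Q.2.2)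

lemma mem_TT {N A B C : ℤ} : (A, B, C) ∈ TT N ↔ 4 * A * C - B ^ 2 = N ∧ 0 < A ∧ -A ≤ B ∧ B ≤ A ∧ A ≤ C := by
  unfold TT
  simp only [Finset.mem_filter, Finset.mem_product, Finset.mem_Icc]
  constructor
  · rintro ⟨⟨h1, h2, h3⟩, h4, h5, h6, h7⟩
    exact ⟨h4, by omega, h5, h6, h7⟩
  · rintro ⟨h1, h2, h3, h4, h5⟩
    have h6 : B ^ 2 ≤ A * A := by nlinarith
    have h7 : A * A ≤ A * C := by nlinarith
    have h8 : C ≤ A * C := by nlinarith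
    have h9 : 3 * (A * C) ≤ N := by nlinarith
    exact ⟨⟨by omega, by omega, by omega⟩, h1, h3, h4, h5⟩

def wQ (Q : ℤ × ℤ × ℤ) : ℤ := wF Q.1 Q.2.1 Q.2.2
noncomputable def Hw (N : ℤ) : ℤ := ∑ Q ∈ TT N, wQ Q

lemma Hw_nonpos {N : ℤ} (h : N ≤ 0) : Hw N = 0 := by
  unfold Hw TT
  rw [Finset.Icc_eq_empty (by omega)]
  simp

lemma sum_bij_supp {α β : Type*} (s : Finset α) (t : Finset β) (f : α → ℤ) (g : β → ℤ) (i : α → β) (j : β → α)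
    (hi : ∀ a ∈ s, f a ≠ 0 → i a ∈ t ∧ g (i a) = f a ∧ j (i a) = a)
    (hj : ∀ b ∈ t, g b ≠ 0 → j b ∈ s ∧ f (j b) = g b ∧ i (j b) = b) : ∑ a ∈ s, f a = ∑ b ∈ t, g b := by
  apply Finset.sum_bij_ne_zero (fun a _ _ => i a)
  · intro a h1 h2; exact (hi a h1 h2).1
  · intro a h1 h2 b h3 h4 h
    rw [← (hi a h1 h2).2.2, ← (hi b h3 h4).2.2, h]
  · intro b h1 h2
    obtain ⟨h3, h4, h5⟩ := hj b h1 h2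
    exact ⟨j b, h3, by rw [h4]; exact h2, h5⟩
  · intro a h1 h2
    exact (hi a h1 h2).2.1.symm

lemma parity_of {B t : ℤ} (h : (4 : ℤ) ∣ t ^ 2 - B ^ 2) : (t + B) / 2 * 2 = t + B ∧ (t - B) / 2 * 2 = t - B := by
  have h2 : (2 : ℤ) ∣ t + B := by
    rcases Int.even_or_odd (t + B) with h1 | h1
    · exact h1.two_dvd
    · exfalso
      have : Odd (t - B) := by
        have e : t - B = (t + B) - 2 * B := by ring
        rw [e]; exact h1.sub_even (even_two_mul B)
      have h3 := h1.mul this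
      rw [show (t + B) * (t - B) = t ^ 2 - B ^ 2 by ring, ← Int.not_even_iff_odd] at h3
      exact h3 (even_iff_two_dvd.2 (dvd_trans (by norm_num) h))
  omega

lemma FF_fib {l : ℤ} (hl : l = 1 ∨ l = 3) (n : ℤ) (f : V4 → ℤ) : ∑ x ∈ FF l n, f x =
    ∑ t ∈ Finset.Icc (-(4 * n)) (4 * n), ∑ x ∈ (FF l n).filter (fun x => x.1 + x.2.2.2 = t), f x := by
  rw [Finset.sum_fiberwise_of_maps_to]
  rintro ⟨a, b, c, d⟩ h
  rw [mem_FF hl] at h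
  obtain ⟨h0, h1, h2, h3⟩ := Bx_bd (n := n) hl (by rw [one_mul]; exact h.1) h.2
  have h4 := abs_le_of_sq (x := a + d) (m := 1) (n := 4 * n) one_pos (by rw [one_mul]; exact h3)
  exact Finset.mem_Icc.2 h4

lemma lvl1 (n : ℤ) : ∑ x ∈ FF 1 n, w6 2 x.2.2.1 (x.1 - x.2.2.2) x.2.1 =
    2 * ∑ t ∈ Finset.Icc (-(4 * n)) (4 * n), Hw (4 * n - t ^ 2) := by
  have hl : (1 : ℤ) = 1 ∨ (1 : ℤ) = 3 := Or.inl rfl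
  simp only [w6_one, Finset.sum_add_distrib]
  rw [FF_sigma2 hl n wF, ← two_mul, FF_fib hl]
  congr 1
  apply Finset.sum_congr rfl
  intro t _
  unfold Hw
  apply sum_bij_supp _ _ _ _ (fun x => (x.2.2.1, x.1 - x.2.2.2, x.2.1)) (fun Q => ((t + Q.2.1) / 2, Q.2.2, Q.1, (t - Q.2.1) / 2))
  · rintro ⟨a, b, c, d⟩ hx h
    rw [Finset.mem_filter, mem_FF hl] at hx
    obtain ⟨⟨h1, h2⟩, h3⟩ := hx
    dsimp only at *
    subst h3
    refine ⟨?_, rfl, ?_⟩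
    · rw [mem_TT]
      exact ⟨by rw [← h1]; ring, wF_ne.1 h⟩
    · ext <;> dsimp only <;> omega
  · rintro ⟨A, B, C⟩ hx h
    rw [mem_TT] at hx
    dsimp only at *
    obtain ⟨h1, h2, h3, h4, h5⟩ := hx
    obtain ⟨p1, p2⟩ := parity_of (B := B) (t := t) ⟨n - A * C, by linear_combination h1⟩
    set a := (t + B) / 2
    set d := (t - B) / 2
    have e1 : t = a + d := by omega
    have e2 : B = a - d := by omega
    refine ⟨?_, ?_, ?_⟩
    · rw [Finset.mem_filter, mem_FF hl]
      refine ⟨⟨?_, ?_⟩, e1.symm⟩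
      · have : 4 * (1 * a * d + C * A) = 4 * n := by
          rw [e1, e2] at h1
          linear_combination h1
        omega
      · unfold Bx; omega
    · rw [← e2]; rfl
    · rw [← e2]

lemma line3 (n s : ℤ) (φ : ℤ → ℤ → ℤ → ℤ × ℤ × ℤ) (ψ : ℤ × ℤ × ℤ → ℤ × ℤ × ℤ) (p : ℤ × ℤ × ℤ → Prop) [DecidablePred p]
    (h1 : ∀ c e b, p (φ c e b) ∧ ψ (φ c e b) = (c, e, b) ∧
      4 * (φ c e b).1 * (φ c e b).2.2 - (φ c e b).2.1 ^ 2 = 12 * b * c - 9 * e ^ 2)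
    (h2 : ∀ Q, p Q → φ (ψ Q).1 (ψ Q).2.1 (ψ Q).2.2 = Q)
    (h3 : ∀ c e b, wQ (φ c e b) ≤ w6 1 c e b) :
    ∑ x ∈ (FF 3 n).filter (fun x => x.1 + x.2.2.2 = s), wQ (φ x.2.2.1 (x.1 - x.2.2.2) x.2.1) =
    ∑ Q ∈ TT (12 * n - 9 * s ^ 2), if p Q then wQ Q else 0 := by
  have hl : (3 : ℤ) = 1 ∨ (3 : ℤ) = 3 := Or.inr rfl
  apply sum_bij_supp _ _ _ _ (fun x => φ x.2.2.1 (x.1 - x.2.2.2) x.2.1)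
    (fun Q => ((s + (ψ Q).2.1) / 2, (ψ Q).2.2, (ψ Q).1, (s - (ψ Q).2.1) / 2))
  · rintro ⟨a, b, c, d⟩ hx h
    rw [Finset.mem_filter, mem_FF hl] at hx
    obtain ⟨⟨g1, g2⟩, g3⟩ := hx
    dsimp only at *
    subst g3
    obtain ⟨k1, k2, k3⟩ := h1 c (a - d) b
    refine ⟨?_, if_pos k1, ?_⟩
    · rw [show φ c (a - d) b = ((φ c (a - d) b).1, (φ c (a - d) b).2.1, (φ c (a - d) b).2.2) from rfl, mem_TT, k3]
      exact ⟨by rw [← g1]; ring, wF_ne.1 h⟩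
    · rw [k2]; ext <;> dsimp only <;> omega
  · intro Q hx h
    have hp : p Q := by by_contra hp; simp [hp] at h
    rw [if_pos hp] at h ⊢
    have hQ := h2 Q hp
    set c := (ψ Q).1
    set e := (ψ Q).2.1
    set b := (ψ Q).2.2
    obtain ⟨k1, k2, k3⟩ := h1 c e b
    have k4 := h3 c e b
    rw [hQ] at k3 k4
    have k5 : w6 1 c e b ≠ 0 := by
      have : 0 ≤ wQ Q := wF_nonneg _ _ _
      omega
    have k6 := w6_ne k5
    obtain ⟨A, B, C⟩ := Q
    rw [mem_TT] at hx
    dsimp only at *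
    have k7 : 12 * b * c - 9 * e ^ 2 = 12 * n - 9 * s ^ 2 := by rw [← k3, hx.1]
    have k8 : (4 : ℤ) ∣ s ^ 2 - e ^ 2 := by
      have : 9 * (s ^ 2 - e ^ 2) = 4 * (3 * (n - b * c)) := by linear_combination k7
      omega
    obtain ⟨p1, p2⟩ := parity_of k8
    set a := (s + e) / 2
    set d := (s - e) / 2
    have e1 : s = a + d := by omega
    have e2 : e = a - d := by omega
    refine ⟨?_, ?_, ?_⟩
    · rw [Finset.mem_filter, mem_FF hl]
      refine ⟨⟨?_, ?_⟩, e1.symm⟩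
      · have : 12 * (3 * a * d + b * c) = 12 * n := by
          rw [e1, e2] at k7
          linear_combination k7
        omega
      · unfold Bx; omega
    · rw [← e2, hQ]
    · rw [← e2, hQ]

lemma iso_count (A B C : ℤ) (h : (3 : ℤ) ∣ 4 * A * C - B ^ 2) :
    (if 3 ∣ A ∧ 3 ∣ B then (1 : ℤ) else 0) + (if 3 ∣ B ∧ 3 ∣ C then 1 else 0) + (if 3 ∣ A + B + C ∧ 3 ∣ 2 * A + B then 1 else 0)
    + (if 3 ∣ A - B + C ∧ 3 ∣ 2 * A - B then 1 else 0) = 1 + 3 * (if 3 ∣ A ∧ 3 ∣ B ∧ 3 ∣ C then 1 else 0) := by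
  obtain ⟨a, r, hr, rfl⟩ : ∃ a r, (r = 0 ∨ r = 1 ∨ r = 2) ∧ A = 3 * a + r := ⟨A / 3, A % 3, by omega, by omega⟩
  obtain ⟨b, s, hs, rfl⟩ : ∃ a r, (r = 0 ∨ r = 1 ∨ r = 2) ∧ B = 3 * a + r := ⟨B / 3, B % 3, by omega, by omega⟩
  obtain ⟨c, t, ht, rfl⟩ : ∃ a r, (r = 0 ∨ r = 1 ∨ r = 2) ∧ C = 3 * a + r := ⟨C / 3, C % 3, by omega, by omega⟩
  have h' : (3 : ℤ) ∣ 4 * r * t - s ^ 2 := by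
    have e : 4 * (3 * a + r) * (3 * c + t) - (3 * b + s) ^ 2 = 4 * r * t - s ^ 2 + 3 * (12 * a * c + 4 * a * t + 4 * r * c - 3 * b ^ 2 - 2 * b * s) := by ring
    rw [e] at h
    exact (Int.dvd_add_left (dvd_mul_right _ _)).1 h
  rcases hr with rfl | rfl | rfl <;> rcases hs with rfl | rfl | rfl <;> rcases ht with rfl | rfl | rfl <;>
  first
    | (exfalso; revert h'; norm_num; done)
    | (simp (disch := omega) only [if_pos, if_neg]; done)
    | (simp (disch := omega) only [if_pos, if_neg]; norm_num)

lemma sub3 (n : ℕ) (s : ℤ) : (∑ Q ∈ TT (12 * n - 9 * s ^ 2), if 3 ∣ Q.1 ∧ 3 ∣ Q.2.1 ∧ 3 ∣ Q.2.2 then wQ Q else 0) =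
    if 3 ∣ n then Hw (4 * (n / 3 : ℕ) - s ^ 2) else 0 := by
  split_ifs with h
  · obtain ⟨m, rfl⟩ := h
    rw [Nat.mul_div_cancel_left m (by norm_num)]
    unfold Hw
    apply sum_bij_supp _ _ _ _ (fun Q => (Q.1 / 3, Q.2.1 / 3, Q.2.2 / 3)) (fun Q => (3 * Q.1, 3 * Q.2.1, 3 * Q.2.2))
    · rintro ⟨A, B, C⟩ hQ h
      rw [mem_TT] at hQ
      dsimp only at *
      have h3 : 3 ∣ A ∧ 3 ∣ B ∧ 3 ∣ C := by by_contra h3; simp [h3] at h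
      rw [if_pos h3]
      obtain ⟨⟨a, rfl⟩, ⟨b, rfl⟩, ⟨c, rfl⟩⟩ := h3
      simp only [ne_eq, OfNat.ofNat_ne_zero, not_false_eq_true, Int.mul_ediv_cancel_left]
      refine ⟨?_, ?_, trivial⟩
      · rw [mem_TT]
        refine ⟨?_, by omega⟩
        have := hQ.1
        push_cast at this
        linarith
      · exact (wF_three _ _ _).symm
    · rintro ⟨A, B, C⟩ hQ h
      rw [mem_TT] at hQ
      dsimp only at *
      have e : wQ (3 * A, 3 * B, 3 * C) = wQ (A, B, C) := wF_three _ _ _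
      rw [if_pos (by simp)]
      simp only [ne_eq, OfNat.ofNat_ne_zero, not_false_eq_true, Int.mul_ediv_cancel_left]
      refine ⟨?_, e, trivial⟩
      rw [mem_TT]
      refine ⟨?_, by omega⟩
      push_cast
      have := hQ.1
      linarith
  · apply Finset.sum_eq_zero
    rintro ⟨A, B, C⟩ hQ
    rw [mem_TT] at hQ
    rw [if_neg]
    rintro ⟨⟨a, rfl⟩, ⟨b, rfl⟩, ⟨c, rfl⟩⟩
    apply h
    have : 3 * (4 * (a * c) - b ^ 2 + s ^ 2) = 4 * (n : ℤ) := by linarith [hQ.1]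
    omega

lemma lvl3 (n : ℕ) : ∑ x ∈ FF 3 n, w6 1 x.2.2.1 (x.1 - x.2.2.2) x.2.1 =
    ∑ s ∈ Finset.Icc (-(4 * (n : ℤ))) (4 * n), (Hw (12 * n - 9 * s ^ 2) + 3 * (if 3 ∣ n then Hw (4 * (n / 3 : ℕ) - s ^ 2) else 0)) := by
  have hl : (3 : ℤ) = 1 ∨ (3 : ℤ) = 3 := Or.inr rfl
  rw [FF_fib hl]
  apply Finset.sum_congr rfl
  intro s _
  have hle : ∀ c e b, wF (3 * c) (3 * e) b ≤ w6 1 c e b ∧ wF b (-3 * e) (3 * c) ≤ w6 1 c e b ∧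
    wF b (-3 * e - 2 * b) (3 * c + 3 * e + b) ≤ w6 1 c e b ∧ wF b (2 * b - 3 * e) (3 * c - 3 * e + b) ≤ w6 1 c e b := by
    intro c e b
    rw [w6_three]
    have h1 := wF_nonneg (3 * c) (3 * e) b
    have h2 := wF_nonneg b (-3 * e) (3 * c)
    have h3 := wF_nonneg b (-3 * e - 2 * b) (3 * c + 3 * e + b)
    have h4 := wF_nonneg b (2 * b - 3 * e) (3 * c - 3 * e + b)
    omega
  have l1 := line3 n s (fun c e b => (3 * c, 3 * e, b)) (fun Q => (Q.1 / 3, Q.2.1 / 3, Q.2.2))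
    (fun Q => 3 ∣ Q.1 ∧ 3 ∣ Q.2.1)
    (by intro c e b; refine ⟨by simp, by simp, by ring⟩)
    (by rintro ⟨A, B, C⟩ ⟨h1, h2⟩; ext <;> dsimp only at * <;> omega)
    (fun c e b => (hle c e b).1)
  have l2 := line3 n s (fun c e b => (b, -3 * e, 3 * c)) (fun Q => (Q.2.2 / 3, -Q.2.1 / 3, Q.1))
    (fun Q => 3 ∣ Q.2.1 ∧ 3 ∣ Q.2.2)
    (by intro c e b; refine ⟨by constructor <;> (dsimp only; omega), by ext <;> dsimp only <;> omega, by ring⟩)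
    (by rintro ⟨A, B, C⟩ ⟨h1, h2⟩; ext <;> dsimp only at * <;> omega)
    (fun c e b => (hle c e b).2.1)
  have l3 := line3 n s (fun c e b => (b, -3 * e - 2 * b, 3 * c + 3 * e + b)) (fun Q => ((Q.1 + Q.2.1 + Q.2.2) / 3, -(2 * Q.1 + Q.2.1) / 3, Q.1))
    (fun Q => 3 ∣ Q.1 + Q.2.1 + Q.2.2 ∧ 3 ∣ 2 * Q.1 + Q.2.1)
    (by intro c e b; refine ⟨by constructor <;> (dsimp only; omega), by ext <;> dsimp only <;> omega, by ring⟩)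
    (by rintro ⟨A, B, C⟩ ⟨h1, h2⟩; ext <;> dsimp only at * <;> omega)
    (fun c e b => (hle c e b).2.2.1)
  have l4 := line3 n s (fun c e b => (b, 2 * b - 3 * e, 3 * c - 3 * e + b)) (fun Q => ((Q.1 - Q.2.1 + Q.2.2) / 3, (2 * Q.1 - Q.2.1) / 3, Q.1))
    (fun Q => 3 ∣ Q.1 - Q.2.1 + Q.2.2 ∧ 3 ∣ 2 * Q.1 - Q.2.1)
    (by intro c e b; refine ⟨by constructor <;> (dsimp only; omega), by ext <;> dsimp only <;> omega, by ring⟩)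
    (by rintro ⟨A, B, C⟩ ⟨h1, h2⟩; ext <;> dsimp only at * <;> omega)
    (fun c e b => (hle c e b).2.2.2)
  dsimp only [wQ] at l1 l2 l3 l4
  simp only [w6_three, Finset.sum_add_distrib]
  rw [l1, l2, l3, l4, ← sub3, ← Finset.sum_add_distrib, ← Finset.sum_add_distrib, ← Finset.sum_add_distrib, Hw,
    Finset.mul_sum, ← Finset.sum_add_distrib]
  apply Finset.sum_congr rfl
  rintro ⟨A, B, C⟩ hQ
  rw [mem_TT] at hQ
  have := iso_count A B C (by rw [hQ.1]; exact ⟨4 * n - 3 * s ^ 2, by ring⟩)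
  have h2 := congrArg (fun z => z * wF A B C) this
  simp only [add_mul, ite_mul, one_mul, zero_mul, mul_assoc] at h2
  dsimp only [wQ]
  exact h2



abbrev SL2 := Matrix.SpecialLinearGroup (Fin 2) ℤ

lemma formAct_eq (γ : SL2) (A B C : ℤ) : formAct γ (A, B, C) =
    (A * (γ.1 0 0) ^ 2 + B * (γ.1 0 0) * (γ.1 1 0) + C * (γ.1 1 0) ^ 2,
     2 * A * (γ.1 0 0) * (γ.1 0 1) + B * ((γ.1 0 0) * (γ.1 1 1) + (γ.1 0 1) * (γ.1 1 0)) + 2 * C * (γ.1 1 0) * (γ.1 1 1),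
     A * (γ.1 0 1) ^ 2 + B * (γ.1 0 1) * (γ.1 1 1) + C * (γ.1 1 1) ^ 2) := by
  unfold formAct formEval
  ext <;> dsimp only <;> ring

lemma formAct_mul (γ δ : SL2) (Q : ℤ × ℤ × ℤ) : formAct (γ * δ) Q = formAct δ (formAct γ Q) := by
  obtain ⟨A, B, C⟩ := Q
  rw [formAct_eq γ, formAct_eq δ, formAct_eq]
  simp only [Matrix.SpecialLinearGroup.coe_mul, Matrix.mul_apply, Fin.sum_univ_two]
  ext <;> dsimp only <;> ring

lemma formAct_one (Q : ℤ × ℤ × ℤ) : formAct 1 Q = Q := by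
  obtain ⟨A, B, C⟩ := Q
  rw [formAct_eq]
  simp

lemma formAct_inv {γ : SL2} {Q Q' : ℤ × ℤ × ℤ} (h : formAct γ Q = Q') : formAct γ⁻¹ Q' = Q := by
  rw [← h, ← formAct_mul, mul_inv_cancel, formAct_one]

lemma SL2_det (γ : SL2) : γ.1 0 0 * γ.1 1 1 - γ.1 0 1 * γ.1 1 0 = 1 := by
  have := γ.2
  rw [Matrix.det_fin_two] at this
  exact this

def mk2 (p q r s : ℤ) (h : p * s - q * r = 1) : SL2 := ⟨!![p, q; r, s], by rw [Matrix.det_fin_two_of]; exact h⟩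

lemma mk2_act (p q r s : ℤ) (h : p * s - q * r = 1) (A B C : ℤ) : formAct (mk2 p q r s h) (A, B, C) =
    (A * p ^ 2 + B * p * r + C * r ^ 2, 2 * A * p * q + B * (p * s + q * r) + 2 * C * r * s, A * q ^ 2 + B * q * s + C * s ^ 2) := by
  rw [formAct_eq]; simp [mk2]

lemma SL2_ext {γ δ : SL2} (h1 : γ.1 0 0 = δ.1 0 0) (h2 : γ.1 0 1 = δ.1 0 1) (h3 : γ.1 1 0 = δ.1 1 0)
    (h4 : γ.1 1 1 = δ.1 1 1) : γ = δ := by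
  apply Subtype.ext
  ext i j
  fin_cases i <;> fin_cases j <;> assumption

lemma formDisc_act (γ : SL2) (Q : ℤ × ℤ × ℤ) : formDisc (formAct γ Q) = formDisc Q := by
  obtain ⟨A, B, C⟩ := Q
  rw [formAct_eq]
  have h := SL2_det γ
  unfold formDisc
  dsimp only
  generalize γ.1 0 0 = p at *
  generalize γ.1 0 1 = q at *
  generalize γ.1 1 0 = r at *
  generalize γ.1 1 1 = s at *
  have : ∀ X : ℤ, X = X * (p * s - q * r) ^ 2 := by intro X; rw [h]; ring
  rw [this (B ^ 2 - 4 * A * C)]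
  ring

lemma IsPosDef_act (γ : SL2) {Q : ℤ × ℤ × ℤ} (hQ : IsPosDef Q) : IsPosDef (formAct γ Q) := by
  refine ⟨?_, by rw [formDisc_act]; exact hQ.2⟩
  obtain ⟨A, B, C⟩ := Q
  obtain ⟨h1, h2⟩ := hQ
  rw [formAct_eq]
  have h := SL2_det γ
  unfold formDisc at h2
  dsimp only at *
  generalize γ.1 0 0 = p at *
  generalize γ.1 0 1 = q at *
  generalize γ.1 1 0 = r at *
  generalize γ.1 1 1 = s at *
  have e : 4 * A * (A * p ^ 2 + B * p * r + C * r ^ 2) = (2 * A * p + B * r) ^ 2 + (4 * A * C - B ^ 2) * r ^ 2 := by ring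
  by_cases hr : r = 0
  · subst hr
    have hp : p ≠ 0 := by rintro rfl; simp at h
    have : 0 < p ^ 2 := by positivity
    nlinarith
  · have h3 : 0 < r ^ 2 := by positivity
    have h4 : 0 < (4 * A * C - B ^ 2) * r ^ 2 := mul_pos (by linarith) h3
    have h5 := sq_nonneg (2 * A * p + B * r)
    by_contra h6
    have : A * (A * p ^ 2 + B * p * r + C * r ^ 2) ≤ 0 := mul_nonpos_of_nonneg_of_nonpos h1.le (by linarith)
    linarith

/-- strictly reduced forms -/
def SR (Q : ℤ × ℤ × ℤ) : Prop := 0 < Q.1 ∧ -Q.1 < Q.2.1 ∧ Q.2.1 ≤ Q.1 ∧ Q.1 ≤ Q.2.2 ∧ (Q.1 = Q.2.2 → 0 ≤ Q.2.1)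

lemma exists_SR (m : ℕ) : ∀ Q : ℤ × ℤ × ℤ, IsPosDef Q → Q.1.toNat ≤ m → ∃ γ : SL2, SR (formAct γ Q) := by
  induction m with
  | zero =>
    intro Q hQ h
    have := hQ.1
    omega
  | succ m ih =>
    rintro ⟨A, B, C⟩ hQ hm
    have hA : 0 < A := hQ.1
    set k := (B + A - 1) / (2 * A) with hk
    have hk1 := Int.emod_add_mul_ediv (B + A - 1) (2 * A)
    have hk2 := Int.emod_nonneg (B + A - 1) (show 2 * A ≠ 0 by omega)
    have hk3 := Int.emod_lt_of_pos (B + A - 1) (show 0 < 2 * A by omega)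
    rw [← hk] at hk1
    let γ := mk2 1 (-k) 0 1 (by ring)
    have hγ : formAct γ (A, B, C) = (A, B - 2 * A * k, A * k ^ 2 - B * k + C) := by
      rw [mk2_act]; ext <;> dsimp only <;> ring
    have hP := IsPosDef_act γ hQ
    rw [hγ] at hP
    set B1 := B - 2 * A * k with hB1
    set C1 := A * k ^ 2 - B * k + C
    have b1 : -A < B1 := by omega
    have b2 : B1 ≤ A := by omega
    let σ := mk2 0 (-1) 1 0 (by ring)
    have hσ : formAct σ (A, B1, C1) = (C1, -B1, A) := by
      rw [mk2_act]; ext <;> dsimp only <;> ring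
    rcases lt_trichotomy A C1 with h | h | h
    · exact ⟨γ, by rw [hγ]; exact ⟨hA, b1, b2, h.le, fun h' => absurd h' h.ne⟩⟩
    · by_cases hB : 0 ≤ B1
      · exact ⟨γ, by rw [hγ]; exact ⟨hA, b1, b2, h.le, fun _ => hB⟩⟩
      · refine ⟨γ * σ, ?_⟩
        rw [formAct_mul, hγ, hσ]
        unfold SR; dsimp only; omega
    · have hP2 := IsPosDef_act σ hP
      rw [hσ] at hP2
      have : 0 < C1 := hP2.1
      dsimp only at hm
      obtain ⟨δ, hδ⟩ := ih _ hP2 (by dsimp only; omega)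
      refine ⟨γ * σ * δ, ?_⟩
      rw [formAct_mul, formAct_mul, hγ, hσ]
      exact hδ

set_option maxHeartbeats 1000000 in
lemma core {A B C A' B' C' p q r s : ℤ} (h : SR (A, B, C)) (h' : SR (A', B', C')) (hd : p * s - q * r = 1)
    (e1 : A' = A * p ^ 2 + B * p * r + C * r ^ 2)
    (e2 : B' = 2 * A * p * q + B * (p * s + q * r) + 2 * C * r * s)
    (e3 : C' = A * q ^ 2 + B * q * s + C * s ^ 2) (hle : A' ≤ A) :
    (A' = A ∧ B' = B ∧ C' = C) ∧ ((r = 0 ∧ q = 0 ∧ (p = 1 ∨ p = -1) ∧ s = p) ∨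
      (B = 0 ∧ A = C ∧ p = 0 ∧ (r = 1 ∨ r = -1) ∧ s = 0 ∧ q = -r) ∨
      (B = A ∧ A = C ∧ q = -r ∧ s = p + r ∧ ((p = 0 ∧ (r = 1 ∨ r = -1)) ∨ (p = 1 ∧ r = -1) ∨ (p = -1 ∧ r = 1)))) := by
  obtain ⟨h1, h2, h3, h4, h5⟩ := h
  obtain ⟨g1, g2, g3, g4, g5⟩ := h'
  dsimp only at *
  have hB : B ^ 2 ≤ A * A := by nlinarith
  have hAC : A * A ≤ A * C := by nlinarith
  have hr : r ^ 2 < 2 := by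
    by_contra hr
    have k1 : 4 * A * A' = (2 * A * p + B * r) ^ 2 + (4 * A * C - B ^ 2) * r ^ 2 := by rw [e1]; ring
    have k2 : 3 * (A * A) * 2 ≤ (4 * A * C - B ^ 2) * r ^ 2 :=
      mul_le_mul (by linarith) (by linarith) (by norm_num) (by nlinarith)
    nlinarith [sq_nonneg (2 * A * p + B * r), mul_le_mul_of_nonneg_left hle h1.le]
  have hp : p ^ 2 < 2 := by
    by_contra hp
    have k1 : 4 * C * A' = (2 * C * r + B * p) ^ 2 + (4 * A * C - B ^ 2) * p ^ 2 := by rw [e1]; ring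
    have k2 : 3 * (A * C) * 2 ≤ (4 * A * C - B ^ 2) * p ^ 2 :=
      mul_le_mul (by linarith) (by linarith) (by norm_num) (by nlinarith)
    nlinarith [sq_nonneg (2 * C * r + B * p), mul_le_mul_of_nonneg_left hle (show 0 ≤ C by linarith)]
  have hr' : r = 0 ∨ r = 1 ∨ r = -1 := by
    have : -2 < r := by nlinarith
    have : r < 2 := by nlinarith
    omega
  have hp' : p = 0 ∨ p = 1 ∨ p = -1 := by
    have : -2 < p := by nlinarith
    have : p < 2 := by nlinarith
    omega
  have key : ∀ x y : ℤ, -A < x → x ≤ A → -A < y → y ≤ A → ∀ k, y = x + 2 * A * k → k = 0 := by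
    intro x y a1 a2 a3 a4 k a5
    have : k < 1 := by nlinarith
    have : -1 < k := by nlinarith
    omega
  rcases hr' with rfl | rfl | rfl
  · rcases hp' with rfl | rfl | rfl
    · simp at hd
    · obtain rfl : s = 1 := by linarith
      have : q = 0 := key B B' h2 h3 (by linarith) (by linarith) q (by rw [e2]; ring)
      subst this
      refine ⟨⟨by rw [e1]; ring, by rw [e2]; ring, by rw [e3]; ring⟩, by omega⟩
    · obtain rfl : s = -1 := by linarith
      have : -q = 0 := key B B' h2 h3 (by linarith) (by linarith) (-q) (by rw [e2]; ring)
      obtain rfl : q = 0 := by omega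
      refine ⟨⟨by rw [e1]; ring, by rw [e2]; ring, by rw [e3]; ring⟩, by omega⟩
  · rcases hp' with rfl | rfl | rfl
    · obtain rfl : q = -1 := by linarith
      have hC : C = A := by linarith
      subst hC
      have : s < 2 := by nlinarith
      have : -1 < s := by nlinarith
      have hs : s = 0 ∨ s = 1 := by omega
      rcases hs with rfl | rfl
      · ring_nf at e1 e2 e3
        omega
      · ring_nf at e1 e2 e3
        omega
    · exfalso; linarith
    · have hC : C ≤ B := by linarith
      obtain rfl : B = A := by omega
      obtain rfl : C = B := by omega
      obtain rfl : q = -1 - s := by linarith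
      have e2' : B' = C + 2 * C * s := by rw [e2]; ring
      have : s < 1 := by nlinarith
      have : -1 < s := by nlinarith
      obtain rfl : s = 0 := by omega
      ring_nf at e1 e2 e3
      omega
  · rcases hp' with rfl | rfl | rfl
    · obtain rfl : q = 1 := by linarith
      have hC : C = A := by linarith
      subst hC
      have : s < 1 := by nlinarith
      have : -2 < s := by nlinarith
      have hs : s = 0 ∨ s = -1 := by omega
      rcases hs with rfl | rfl
      · ring_nf at e1 e2 e3
        omega
      · ring_nf at e1 e2 e3
        omega
    · have hC : C ≤ B := by linarith
      obtain rfl : B = A := by omega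
      obtain rfl : C = B := by omega
      obtain rfl : q = 1 - s := by linarith
      have e2' : B' = C - 2 * C * s := by rw [e2]; ring
      have : s < 1 := by nlinarith
      have : -1 < s := by nlinarith
      obtain rfl : s = 0 := by omega
      ring_nf at e1 e2 e3
      omega
    · exfalso; linarith

lemma SR_unique {Q Q' : ℤ × ℤ × ℤ} (h : SR Q) (h' : SR Q') (γ : SL2) (e : formAct γ Q = Q') : Q = Q' := by
  have main : ∀ {Q Q' : ℤ × ℤ × ℤ}, SR Q → SR Q' → ∀ γ : SL2, formAct γ Q = Q' → Q'.1 ≤ Q.1 → Q = Q' := by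
    rintro ⟨A, B, C⟩ ⟨A', B', C'⟩ h h' γ e hle
    rw [formAct_eq] at e
    simp only [Prod.mk.injEq] at e
    obtain ⟨⟨rfl, rfl, rfl⟩, _⟩ := core h h' (SL2_det γ) e.1.symm e.2.1.symm e.2.2.symm hle
    rfl
  rcases le_total Q'.1 Q.1 with hle | hle
  · exact main h h' γ e hle
  · exact (main h' h γ⁻¹ (formAct_inv e) hle).symm



lemma stab_card (Q : ℤ × ℤ × ℤ) (k : ℤ) (L : Finset (ℤ × ℤ))
    (hS : ∀ γ : SL2, formAct γ Q = Q ↔ (γ.1 0 0, γ.1 1 0) ∈ L ∧ γ.1 0 1 = -γ.1 1 0 ∧ γ.1 1 1 = γ.1 0 0 + k * γ.1 1 0)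
    (hL : ∀ x ∈ L, x.1 * (x.1 + k * x.2) - (-x.2) * x.2 = 1) :
    Nat.card {γ : SL2 // formAct γ Q = Q} = L.card := by
  have : Nat.card {γ : SL2 // formAct γ Q = Q} = Set.ncard {γ : SL2 | formAct γ Q = Q} := rfl
  rw [this, ← Set.ncard_coe_finset]
  apply ncard_eq_of_inv (fun γ => (γ.1 0 0, γ.1 1 0))
    (fun x => if h : x.1 * (x.1 + k * x.2) - (-x.2) * x.2 = 1 then mk2 x.1 (-x.2) x.2 (x.1 + k * x.2) h else 1)
  · intro γ hγ
    exact ((hS γ).1 hγ).1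
  · intro x hx
    simp only [hL x hx, dif_pos]
    rw [Set.mem_ofPred_eq, hS]
    exact ⟨by simpa [mk2] using hx, by simp [mk2], by simp [mk2]⟩
  · intro γ hγ
    obtain ⟨h1, h2, h3⟩ := (hS γ).1 hγ
    have := hL _ h1
    dsimp only at this ⊢
    rw [dif_pos this]
    apply SL2_ext <;> simp [mk2, h2, h3]
  · intro x hx
    simp only [hL x (by simpa using hx), dif_pos]
    simp [mk2]

lemma stab_core {A B C : ℤ} (h : SR (A, B, C)) {γ : SL2} (e : formAct γ (A, B, C) = (A, B, C)) :
    (γ.1 1 0 = 0 ∧ γ.1 0 1 = 0 ∧ (γ.1 0 0 = 1 ∨ γ.1 0 0 = -1) ∧ γ.1 1 1 = γ.1 0 0) ∨ (B = 0 ∧ A = C ∧ γ.1 0 0 = 0 ∧ (γ.1 1 0 = 1 ∨ γ.1 1 0 = -1) ∧ γ.1 1 1 = 0 ∧ γ.1 0 1 = -γ.1 1 0) ∨ (B = A ∧ A = C ∧ γ.1 0 1 = -γ.1 1 0 ∧ γ.1 1 1 = γ.1 0 0 + γ.1 1 0 ∧ ((γ.1 0 0 = 0 ∧ (γ.1 1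 0 = 1 ∨ γ.1 1 0 = -1)) ∨ (γ.1 0 0 = 1 ∧ γ.1 1 0 = -1) ∨ (γ.1 0 0 = -1 ∧ γ.1 1 0 = 1))) :=
  (core h h (SL2_det γ) (congrArg Prod.fst ((formAct_eq γ A B C).symm.trans e)).symm
    (congrArg (fun x => x.2.1) ((formAct_eq γ A B C).symm.trans e)).symm
    (congrArg (fun x => x.2.2) ((formAct_eq γ A B C).symm.trans e)).symm le_rfl).2

lemma stab_SR {A B C : ℤ} (h : SR (A, B, C)) : Nat.card {γ : SL2 // formAct γ (A, B, C) = (A, B, C)} =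
    if A = C ∧ B = 0 then 4 else if A = C ∧ B = A then 6 else 2 := by
  have hA : 0 < A := h.1
  split_ifs with h1 h2
  · obtain ⟨rfl, rfl⟩ := h1
    rw [stab_card _ 0 {(1, 0), (-1, 0), (0, 1), (0, -1)}]
    · rfl
    · intro γ
      constructor
      · intro e
        have := stab_core h e
        simp only [Finset.mem_insert, Finset.mem_singleton, Prod.mk.injEq]
        omega
      · rintro ⟨h2, h3, h4⟩
        rw [formAct_eq, h3, h4]
        simp only [Finset.mem_insert, Finset.mem_singleton, Prod.mk.injEq] at h2
        rcases h2 with ⟨h5, h6⟩ | ⟨h5, h6⟩ | ⟨h5, h6⟩ | ⟨h5, h6⟩ <;> rw [h5, h6] <;> ext <;> dsimp only <;> ring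
    · decide
  · obtain ⟨rfl, rfl⟩ := h2
    rw [stab_card _ 1 {(1, 0), (-1, 0), (0, 1), (0, -1), (1, -1), (-1, 1)}]
    · rfl
    · intro γ
      constructor
      · intro e
        have := stab_core h e
        simp only [Finset.mem_insert, Finset.mem_singleton, Prod.mk.injEq]
        omega
      · rintro ⟨h2, h3, h4⟩
        rw [formAct_eq, h3, h4]
        simp only [Finset.mem_insert, Finset.mem_singleton, Prod.mk.injEq] at h2
        rcases h2 with ⟨h5, h6⟩ | ⟨h5, h6⟩ | ⟨h5, h6⟩ | ⟨h5, h6⟩ | ⟨h5, h6⟩ | ⟨h5, h6⟩ <;> rw [h5, h6] <;> ext <;> dsimp only <;> ring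
    · decide
  · rw [stab_card _ 0 {(1, 0), (-1, 0)}]
    · rfl
    · intro γ
      constructor
      · intro e
        have := stab_core h e
        simp only [Finset.mem_insert, Finset.mem_singleton, Prod.mk.injEq]
        omega
      · rintro ⟨h2, h3, h4⟩
        rw [formAct_eq, h3, h4]
        simp only [Finset.mem_insert, Finset.mem_singleton, Prod.mk.injEq] at h2
        rcases h2 with ⟨h5, h6⟩ | ⟨h5, h6⟩ <;> rw [h5, h6] <;> ext <;> dsimp only <;> ring
    · decide

lemma stab_conj {Q Q' : ℤ × ℤ × ℤ} (δ : SL2) (h : formAct δ Q = Q') :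
    Nat.card {γ : SL2 // formAct γ Q = Q} = Nat.card {γ : SL2 // formAct γ Q' = Q'} := by
  have h' := formAct_inv h
  apply Nat.card_congr
  refine ⟨fun γ => ⟨δ⁻¹ * γ.1 * δ, ?_⟩, fun γ => ⟨δ * γ.1 * δ⁻¹, ?_⟩, ?_, ?_⟩
  · rw [formAct_mul, formAct_mul, h', γ.2, h]
  · rw [formAct_mul, formAct_mul, h, γ.2, h']
  · intro γ; apply Subtype.ext; dsimp only; group
  · intro γ; apply Subtype.ext; dsimp only; group

lemma rel_equiv (N : ℤ) : Equivalence (fun (Q Q' : {Q : ℤ × ℤ × ℤ // formDisc Q = -N ∧ IsPosDef Q}) =>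
    ∃ γ : Matrix.SpecialLinearGroup (Fin 2) ℤ, formAct γ Q.1 = Q'.1) := by
  refine ⟨fun Q => ⟨1, formAct_one _⟩, ?_, ?_⟩
  · rintro Q Q' ⟨γ, h⟩
    exact ⟨γ⁻¹, formAct_inv h⟩
  · rintro Q Q' Q'' ⟨γ, h⟩ ⟨δ, h'⟩
    exact ⟨γ * δ, by rw [formAct_mul, h, h']⟩

lemma class_eq {N : ℤ} {Q Q' : {Q : ℤ × ℤ × ℤ // formDisc Q = -N ∧ IsPosDef Q}}
    (h : (Quot.mk _ Q : FormClasses N) = Quot.mk _ Q') : ∃ γ : SL2, formAct γ Q.1 = Q'.1 := by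
  have := Quot.eqvGen_exact h
  rwa [(rel_equiv N).eqvGen_iff] at this

open Classical in
noncomputable def TS (N : ℤ) : Finset (ℤ × ℤ × ℤ) := (TT N).filter SR

lemma mem_TS {N : ℤ} {Q : ℤ × ℤ × ℤ} : Q ∈ TS N ↔ formDisc Q = -N ∧ SR Q := by
  obtain ⟨A, B, C⟩ := Q
  classical
  unfold TS
  rw [Finset.mem_filter, mem_TT]
  unfold SR formDisc
  dsimp only
  constructor
  · rintro ⟨h1, h2⟩
    exact ⟨by linarith [h1.1], h2⟩
  · rintro ⟨h1, h2⟩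
    exact ⟨⟨by linarith, by omega⟩, h2⟩

lemma TS_prop {N : ℤ} (hN : 0 < N) {Q : ℤ × ℤ × ℤ} (h : Q ∈ TS N) : formDisc Q = -N ∧ IsPosDef Q := by
  rw [mem_TS] at h
  exact ⟨h.1, h.2.1, by rw [h.1]; linarith⟩

def vS (A B C : ℤ) : ℤ := if A = C ∧ B = 0 then 3 else if A = C ∧ B = A then 2 else 6

lemma hurwitz_TS {N : ℤ} (hN : 0 < N) : hurwitzClassNumber N = ((∑ Q ∈ TS N, vS Q.1 Q.2.1 Q.2.2 : ℤ) : ℝ) / 6 := by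
  unfold hurwitzClassNumber
  rw [if_neg hN.ne']
  have hb : Function.Bijective (fun Q : {Q // Q ∈ TS N} => (Quot.mk _ ⟨Q.1, TS_prop hN Q.2⟩ : FormClasses N)) := by
    constructor
    · intro Q Q' h
      obtain ⟨γ, hγ⟩ := class_eq h
      exact Subtype.ext (SR_unique (mem_TS.1 Q.2).2 (mem_TS.1 Q'.2).2 γ hγ)
    · intro c
      induction c using Quot.ind with
      | mk Q =>
        obtain ⟨γ, hγ⟩ := exists_SR _ Q.1 Q.2.2 le_rfl
        have hm : formAct γ Q.1 ∈ TS N := mem_TS.2 ⟨by rw [formDisc_act]; exact Q.2.1, hγ⟩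
        exact ⟨⟨_, hm⟩, (Quot.sound ⟨γ, rfl⟩).symm⟩
  rw [← finsum_eq_of_bijective _ hb (f := fun Q => (vS Q.1.1 Q.1.2.1 Q.1.2.2 : ℝ) / 6)]
  · rw [finsum_eq_sum_of_fintype]
    push_cast
    rw [Finset.sum_div]
    exact Finset.sum_coe_sort (TS N) (fun Q => (vS Q.1 Q.2.1 Q.2.2 : ℝ) / 6)
  · rintro ⟨⟨A, B, C⟩, hQ⟩
    dsimp only
    obtain ⟨γ, hγ⟩ := class_eq (Quot.out_eq (Quot.mk _ ⟨(A, B, C), TS_prop hN hQ⟩ : FormClasses N))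
    rw [stab_conj γ hγ]
    dsimp only
    rw [stab_SR (mem_TS.1 hQ).2]
    unfold vS
    split_ifs <;> norm_num

lemma TS_TT (N : ℤ) : ∑ Q ∈ TS N, vS Q.1 Q.2.1 Q.2.2 = Hw N := by
  classical
  unfold TS Hw
  rw [Finset.sum_filter]
  have h1 : ∑ Q ∈ TT N, (if SR (Q.1, -Q.2.1, Q.2.2) then vS Q.1 (-Q.2.1) Q.2.2 else 0) =
      ∑ Q ∈ TT N, (if SR Q then vS Q.1 Q.2.1 Q.2.2 else 0) := by
    apply Finset.sum_nbij' (fun Q => (Q.1, -Q.2.1, Q.2.2)) (fun Q => (Q.1, -Q.2.1, Q.2.2))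
    · rintro ⟨A, B, C⟩ h
      rw [mem_TT] at *
      exact ⟨by rw [neg_sq]; exact h.1, by dsimp only; omega⟩
    · rintro ⟨A, B, C⟩ h
      rw [mem_TT] at *
      exact ⟨by rw [neg_sq]; exact h.1, by dsimp only; omega⟩
    · intros; simp
    · intros; simp
    · intros; rfl
  have h2 : ∑ Q ∈ TT N, ((if SR Q then vS Q.1 Q.2.1 Q.2.2 else 0) + (if SR (Q.1, -Q.2.1, Q.2.2) then vS Q.1 (-Q.2.1) Q.2.2 else 0))
      = ∑ Q ∈ TT N, 2 * wQ Q := by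
    apply Finset.sum_congr rfl
    rintro ⟨A, B, C⟩ h
    rw [mem_TT] at h
    obtain ⟨_, h2, h3, h4, h5⟩ := h
    unfold SR vS wQ wF
    dsimp only
    rcases eq_or_lt_of_le h3 with f | f <;> rcases eq_or_lt_of_le h4 with g | g <;>
    rcases eq_or_lt_of_le h5 with i | i <;> rcases lt_trichotomy B 0 with j | j | j <;>
    first
      | (exfalso; omega)
      | (simp (disch := omega) only [if_pos, if_neg]; done)
      | (simp (disch := omega) only [if_pos, if_neg]; norm_num)
  rw [Finset.sum_add_distrib, h1, ← Finset.mul_sum] at h2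
  omega

lemma hurwitz_eq (N : ℤ) : hurwitzClassNumber N = (Hw N : ℝ) / 6 - (if N = 0 then 1 / 12 else 0) := by
  rcases lt_trichotomy N 0 with h | h | h
  · rw [Hw_nonpos h.le, if_neg h.ne]
    unfold hurwitzClassNumber
    rw [if_neg h.ne]
    have : IsEmpty (FormClasses N) := by
      constructor
      intro c
      induction c using Quot.ind with
      | mk Q =>
        have h1 := Q.2.1
        have h2 := Q.2.2.2
        omega
    rw [finsum_of_isEmpty]; simp
  · subst h
    rw [Hw_nonpos le_rfl]
    simp [hurwitzClassNumber]
  · rw [hurwitz_TS h, TS_TT, if_neg h.ne']; simp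



lemma sum_shrink {M : Type*} [AddCommMonoid M] {f : ℤ → M} {A B : ℤ} (h : A ≤ B)
    (hf : ∀ t, (t < -A ∨ A < t) → f t = 0) :
    ∑ t ∈ Finset.Icc (-B) B, f t = ∑ t ∈ Finset.Icc (-A) A, f t := by
  symm
  apply Finset.sum_subset
  · apply Finset.Icc_subset_Icc <;> omega
  · intro t _ ht
    apply hf
    rw [Finset.mem_Icc] at ht
    omega

lemma H_neg {N : ℤ} (h : N < 0) : hurwitzClassNumber N = 0 := by
  rw [hurwitz_eq, Hw_nonpos h.le, if_neg h.ne]; simp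

lemma out_neg {m : ℕ} (hm : 0 < m) {t : ℤ} (ht : t < -(4 * (m : ℤ)) ∨ 4 * (m : ℤ) < t) : 4 * (m : ℤ) - t ^ 2 < 0 := by
  rcases ht with h | h <;> nlinarith

lemma sumHw {m : ℕ} (hm : 0 < m) {B : ℤ} (hB : 4 * (m : ℤ) ≤ B) :
    ∑ t ∈ Finset.Icc (-B) B, Hw (4 * m - t ^ 2) = 12 * big m + 6 * sS m + iS m := by
  rw [sum_shrink hB (fun t ht => Hw_nonpos (out_neg hm ht).le)]
  have h1 := lvl1 m
  rw [bd_one m hm] at h1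
  linarith

lemma cnt {m : ℕ} (hm : 0 < m) {B : ℤ} (hB : 4 * (m : ℤ) ≤ B) :
    ∑ t ∈ Finset.Icc (-B) B, (if 4 * (m : ℤ) - t ^ 2 = 0 then (1 / 12 : ℝ) else 0) = iS m / 6 := by
  unfold iS
  split_ifs with h
  · obtain ⟨k, rfl⟩ := h
    have hk : 0 < k := Nat.pos_of_mul_pos_left hm
    have e : ∀ t : ℤ, (if 4 * ((k * k : ℕ) : ℤ) - t ^ 2 = 0 then (1 / 12 : ℝ) else 0) =
        (if t = 2 * k then (1 / 12 : ℝ) else 0) + (if t = -(2 * k) then (1 / 12 : ℝ) else 0) := by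
      intro t
      have h1 : 4 * ((k * k : ℕ) : ℤ) - t ^ 2 = 0 ↔ t = 2 * k ∨ t = -(2 * k) := by
        rw [← sq_eq_sq_iff_eq_or_eq_neg]
        push_cast
        constructor <;> intro h <;> linarith
      rw [if_congr h1 rfl rfl]
      have hk' : (0 : ℤ) < k := by exact_mod_cast hk
      split_ifs <;> first | omega | simp
    simp only [e, Finset.sum_add_distrib, Finset.sum_ite_eq']
    push_cast at hB
    have hk' : (1 : ℤ) ≤ k := by exact_mod_cast hk
    rw [if_pos, if_pos]
    · norm_num
    · rw [Finset.mem_Icc]; constructor <;> nlinarith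
    · rw [Finset.mem_Icc]; constructor <;> nlinarith
  · rw [Finset.sum_eq_zero]
    · simp
    · intro t _
      rw [if_neg]
      intro h0
      apply h
      have h2 : Even (t ^ 2) := ⟨2 * m, by linarith⟩
      rw [Int.even_pow' (by norm_num)] at h2
      obtain ⟨u, rfl⟩ := h2
      refine ⟨u.natAbs, ?_⟩
      zify
      rw [abs_mul_abs_self]
      nlinarith

lemma tot {m : ℕ} (hm : 0 < m) {B : ℤ} (hB : 4 * (m : ℤ) ≤ B) :
    ∑ t ∈ Finset.Icc (-B) B, hurwitzClassNumber (4 * m - t ^ 2) = 2 * big m + sS m := by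
  simp only [hurwitz_eq, Finset.sum_sub_distrib]
  rw [cnt hm hB, ← Finset.sum_div, ← Int.cast_sum, sumHw hm hB]
  push_cast
  ring

lemma iT_three (k : ℕ) : iT (3 * k) = iS k := by
  classical
  unfold iT iS
  apply if_congr _ rfl rfl
  constructor
  · rintro ⟨m, h⟩; exact ⟨m, by nlinarith⟩
  · rintro ⟨m, h⟩; exact ⟨m, by rw [h]; ring⟩

lemma iT_not {n : ℕ} (h : ¬ 3 ∣ n) : iT n = 0 := by
  unfold iT
  rw [if_neg]
  rintro ⟨m, rfl⟩
  exact h (dvd_mul_right _ _)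

lemma tot3 {n : ℕ} (hn : 0 < n) :
    ∑ s ∈ Finset.Icc (-(4 * (n : ℤ))) (4 * n), hurwitzClassNumber (12 * n - 9 * s ^ 2) =
    2 * (big n + small n + sS n) - (if 3 ∣ n then 6 * (small (n / 3) : ℝ) + 3 * sS (n / 3) else 0) := by
  have h1 := bd_three n hn
  rw [lvl3, Finset.sum_add_distrib, ← Finset.mul_sum] at h1
  simp only [hurwitz_eq, Finset.sum_sub_distrib]
  rw [← Finset.sum_div, ← Int.cast_sum]
  by_cases h3 : 3 ∣ n
  · obtain ⟨k, rfl⟩ := h3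
    have hk : 0 < k := by omega
    have hd : 3 ∣ 3 * k := dvd_mul_right _ _
    have hq : 3 * k / 3 = k := by omega
    simp only [if_pos hd, hq] at h1 ⊢
    rw [sumHw hk (by push_cast; omega), iT_three] at h1
    have h2 : ∑ s ∈ Finset.Icc (-(4 * ((3 * k : ℕ) : ℤ))) (4 * (3 * k : ℕ)),
        (if 12 * ((3 * k : ℕ) : ℤ) - 9 * s ^ 2 = 0 then (1 / 12 : ℝ) else 0) = iS k / 6 := by
      rw [← cnt hk (B := 4 * (3 * k : ℕ)) (by push_cast; omega)]
      apply Finset.sum_congr rfl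
      intro t _
      apply if_congr _ rfl rfl
      push_cast
      constructor <;> intro h <;> linarith
    rw [h2]
    have h4 := congrArg (Int.cast : ℤ → ℝ) h1
    push_cast at h4 ⊢
    linarith
  · simp only [if_neg h3] at h1 ⊢
    rw [iT_not h3] at h1
    have h2 : ∑ s ∈ Finset.Icc (-(4 * (n : ℤ))) (4 * n),
        (if 12 * (n : ℤ) - 9 * s ^ 2 = 0 then (1 / 12 : ℝ) else 0) = 0 := by
      apply Finset.sum_eq_zero
      intro t _
      rw [if_neg]
      intro h
      apply h3
      generalize t ^ 2 = u at h
      omega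
    rw [h2]
    have h4 := congrArg (Int.cast : ℤ → ℝ) h1
    push_cast at h4 ⊢
    simp only [Finset.sum_const_zero] at h4
    push_cast at h4
    linarith

lemma HH_sum (m : ℤ) {n : ℕ} (hn : 0 < n) : HH 0 m 3 (3 * n) =
    ∑ t ∈ Finset.Icc (-(12 * (n : ℤ))) (12 * n), if t % 3 = m % 3 then hurwitzClassNumber (12 * n - t ^ 2) else 0 := by
  unfold HH
  rw [finsum_eq_sum_of_support_subset (s := Finset.Icc (-(12 * (n : ℤ))) (12 * n))]
  · apply Finset.sum_congr rfl
    intro t _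
    have : 4 * ((3 * n : ℕ) : ℤ) = 12 * n := by push_cast; ring
    rw [this]
    simp
  · intro t ht
    rw [Finset.coe_Icc, Set.mem_Icc]
    by_contra hc
    apply ht
    have := out_neg (m := 3 * n) (by omega) (t := t) (by push_cast; omega)
    dsimp only
    rw [H_neg this]
    simp

lemma HH_symm {n : ℕ} (hn : 0 < n) : HH 0 1 3 (3 * n) = HH 0 2 3 (3 * n) := by
  rw [HH_sum 1 hn, HH_sum 2 hn]
  apply Finset.sum_nbij' (fun t => -t) (fun t => -t)
  · intro t h; rw [Finset.mem_Icc] at *; omega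
  · intro t h; rw [Finset.mem_Icc] at *; omega
  · intros; simp
  · intros; simp
  · intro t _
    rw [neg_sq]
    apply if_congr _ rfl rfl
    omega

lemma HH_zero {n : ℕ} (hn : 0 < n) :
    ∑ t ∈ Finset.Icc (-(12 * (n : ℤ))) (12 * n), (if t % 3 = 0 then hurwitzClassNumber (12 * n - t ^ 2) else 0) =
    ∑ s ∈ Finset.Icc (-(4 * (n : ℤ))) (4 * n), hurwitzClassNumber (12 * n - 9 * s ^ 2) := by
  rw [← Finset.sum_filter]
  apply Finset.sum_nbij' (fun t => t / 3) (fun t => 3 * t)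
  · intro t h; rw [Finset.mem_filter, Finset.mem_Icc] at h; rw [Finset.mem_Icc]; omega
  · intro t h; rw [Finset.mem_Icc] at h; rw [Finset.mem_filter, Finset.mem_Icc]; omega
  · intro t h; rw [Finset.mem_filter] at h; omega
  · intro t _; omega
  · intro t h
    rw [Finset.mem_filter] at h
    obtain ⟨u, rfl⟩ : (3 : ℤ) ∣ t := by omega
    rw [show 3 * u / 3 = u by omega]
    congr 1; ring

lemma HH_val {n : ℕ} (hn : 0 < n) : 2 * HH 0 1 3 (3 * n) = 2 * big (3 * n) + sS (3 * n) -
    (2 * (big n + small n + sS n) - (if 3 ∣ n then 6 * (small (n / 3) : ℝ) + 3 * sS (n / 3) else 0)) := by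
  rw [← tot3 hn, ← HH_zero hn, ← tot (m := 3 * n) (B := 12 * n) (by omega) (by push_cast; omega), two_mul]
  conv_lhs => arg 2; rw [HH_symm hn]
  rw [HH_sum 1 hn, HH_sum 2 hn, ← Finset.sum_add_distrib, ← Finset.sum_sub_distrib]
  apply Finset.sum_congr rfl
  intro t _
  have : 4 * ((3 * n : ℕ) : ℤ) = 12 * n := by push_cast; ring
  rw [this]
  split_ifs <;> first | omega | simp

lemma sS_sum {m : ℕ} (hm : 0 < m) : sS m = ∑ g ∈ m.divisors, if g = m / g then g else 0 := by
  unfold sS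
  split_ifs with h
  · obtain ⟨k, rfl⟩ := h
    have hk : 0 < k := Nat.pos_of_mul_pos_left hm
    rw [Nat.sqrt_eq, Finset.sum_eq_single k]
    · rw [if_pos (Nat.mul_div_cancel _ hk).symm]
    · intro g hg hne
      rw [if_neg]
      intro he
      have := Nat.div_mul_cancel (Nat.dvd_of_mem_divisors hg)
      rw [← he] at this
      exact hne (Nat.mul_self_inj.1 this)
    · intro h
      exact absurd (Nat.mem_divisors.2 ⟨dvd_mul_right _ _, hm.ne'⟩) h
  · symm
    apply Finset.sum_eq_zero
    intro g hg
    rw [if_neg]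
    intro he
    have := Nat.div_mul_cancel (Nat.dvd_of_mem_divisors hg)
    rw [← he] at this
    exact h ⟨g, this.symm⟩

lemma flip_sum {m : ℕ} (f : ℕ → ℕ → ℕ) :
    ∑ g ∈ m.divisors, f g (m / g) = ∑ g ∈ m.divisors, f (m / g) g := by
  rw [← Nat.sum_div_divisors]
  apply Finset.sum_congr rfl
  intro g hg
  rw [Nat.div_div_self (Nat.dvd_of_mem_divisors hg) (Nat.mem_divisors.1 hg).2]

lemma sigma_eq {m : ℕ} (hm : 0 < m) : ∑ d ∈ m.divisors, d = big m + small m + sS m := by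
  have h := flip_sum (m := m) (fun a b => if a < b then b else 0)
  unfold big small
  rw [sS_sum hm, h, ← Finset.sum_add_distrib, ← Finset.sum_add_distrib]
  apply Finset.sum_congr rfl
  intro g _
  split_ifs <;> omega

lemma min_eq {m : ℕ} (hm : 0 < m) : ∑ d ∈ m.divisors, min d (m / d) = 2 * small m + sS m := by
  have h := flip_sum (m := m) (fun a b => if a < b then a else 0)
  rw [two_mul]
  conv_rhs => arg 1; arg 2; unfold small; rw [h]
  unfold small
  rw [sS_sum hm, ← Finset.sum_add_distrib, ← Finset.sum_add_distrib]
  apply Finset.sum_congr rfl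
  intro g _
  split_ifs <;> omega

lemma small_eq (k : ℕ) : small k = ∑ d ∈ k.divisors.filter (fun d => d ^ 2 < k), d := by
  unfold small
  rw [Finset.sum_filter]
  apply Finset.sum_congr rfl
  intro g hg
  apply if_congr _ rfl rfl
  have h1 := Nat.div_mul_cancel (Nat.dvd_of_mem_divisors hg)
  have h2 := Nat.pos_of_mem_divisors hg
  generalize k / g = u at *
  subst h1
  rw [sq]
  exact (Nat.mul_lt_mul_right h2).symm

lemma sq_part (n : ℕ) : (1 / 4 : ℝ) * (if IsSquare (12 * n) then (1 : ℝ) else 0) * Real.sqrt (12 * n) =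
    if 3 ∣ n then 3 / 2 * (sS (n / 3) : ℝ) else 0 := by
  by_cases h : IsSquare (12 * n)
  · obtain ⟨r, hr⟩ := h
    have h3 : 3 ∣ r := by
      have : 3 ∣ r * r := by omega
      rcases (Nat.Prime.dvd_mul Nat.prime_three).1 this with h | h <;> exact h
    have h2 : 2 ∣ r := by
      have : 2 ∣ r * r := by omega
      rcases (Nat.Prime.dvd_mul Nat.prime_two).1 this with h | h <;> exact h
    obtain ⟨m, rfl⟩ : 6 ∣ r := by omega
    have hn : n = 3 * (m * m) := by nlinarith
    subst hn
    rw [if_pos ⟨6 * m, hr⟩, if_pos (dvd_mul_right _ _), Nat.mul_div_cancel_left _ (by norm_num)]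
    unfold sS
    rw [if_pos ⟨m, rfl⟩, Nat.sqrt_eq]
    have : (12 * ((3 * (m * m) : ℕ) : ℝ)) = (6 * m) ^ 2 := by push_cast; ring
    rw [this, Real.sqrt_sq (by positivity)]
    ring
  · rw [if_neg h]
    split_ifs with h3
    · obtain ⟨k, rfl⟩ := h3
      rw [Nat.mul_div_cancel_left _ (by norm_num)]
      unfold sS
      rw [if_neg]
      · simp
      · rintro ⟨m, rfl⟩
        exact h ⟨6 * m, by ring⟩
    · simp

/-- Lemma 4.1 (4): for every `n ≥ 1`, `H_{1,3}(3n) = H_{2,3}(3n)`, and this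
common value equals
`σ(3n) - (1/2)∑_{d∣3n} min(d, 3n/d) - σ(n) + 3 δ_{3∣n} ∑_{d∣(n/3), d²<n/3} d + (1/4) δ_{12n=□} √(12n)`. -/
theorem class_number_sum_m_nonzero_three_dvd (n : ℕ) (hn : 0 < n) :
    HH 0 1 3 (3 * n) = HH 0 2 3 (3 * n)
    ∧ HH 0 1 3 (3 * n) =
        (∑ d ∈ (3 * n).divisors, (d : ℝ))
        - 1 / 2 * (∑ d ∈ (3 * n).divisors, (min d (3 * n / d) : ℝ))
        - (∑ d ∈ n.divisors, (d : ℝ))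
        + 3 * (if 3 ∣ n then (1 : ℝ) else 0) *
            (∑ d ∈ (n / 3).divisors.filter (fun d => d ^ 2 < n / 3), (d : ℝ))
        + 1 / 4 * (if IsSquare (12 * n) then (1 : ℝ) else 0) * Real.sqrt (12 * n) := by
  refine ⟨HH_symm hn, ?_⟩
  have h1 := HH_val hn
  have h3 : 0 < 3 * n := by omega
  have e1 : ∑ d ∈ (3 * n).divisors, (min d (3 * n / d) : ℝ) = ((∑ d ∈ (3 * n).divisors, min d (3 * n / d) : ℕ) : ℝ) := by
    rw [Nat.cast_sum]
    apply Finset.sum_congr rfl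
    intro d hd
    rw [Nat.cast_min, Nat.cast_div (Nat.dvd_of_mem_divisors hd)]
    · push_cast; rfl
    · exact_mod_cast (Nat.pos_of_mem_divisors hd).ne'
  rw [sq_part, e1, min_eq h3, ← Nat.cast_sum, ← Nat.cast_sum, ← Nat.cast_sum, ← small_eq, sigma_eq h3, sigma_eq hn]
  push_cast
  split_ifs at * <;> linarith

end HurwitzPaper
end

section
/- Let h, m ∈ ℤ and k, M ∈ ℕ with gcd(h,k)=1, and set g₁ := gcd(M,k) and g₂ := gcd(M, k/g₁). If g₂ does not divide 2m, then the generalized quadratic Gauss sum G(hM², 2hmM; k) equals 0. -/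
open scoped BigOperators Real

namespace HurwitzPaper

/-- The generalized quadratic Gauss sum `G(a,b;c) = ∑_{ℓ mod c} e^{2πi(aℓ² + bℓ)/c}`. -/
noncomputable def gaussSum' (a b : ℤ) (c : ℕ) : ℂ :=
  ∑ ℓ ∈ Finset.range c,
    Complex.exp (2 * Real.pi * Complex.I * ((a : ℂ) * (ℓ : ℂ) ^ 2 + (b : ℂ) * ℓ) / c)

theorem sum_shift (f : ℕ → ℂ) (k : ℕ) (hf : ∀ n, f (n + k) = f n) (s : ℕ) :
    ∑ l ∈ Finset.range k, f (l + s) = ∑ l ∈ Finset.range k, f l := by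
  induction s with
  | zero => simp
  | succ s ih =>
    rw [← ih]
    have h1 := Finset.sum_range_succ (fun l => f (l + s)) k
    have h2 := Finset.sum_range_succ' (fun l => f (l + s)) k
    rw [h1] at h2
    have h3 : f (k + s) = f (0 + s) := by rw [zero_add, add_comm, hf]
    simp only [h3] at h2
    have h4 := add_right_cancel h2
    rw [h4]
    refine Finset.sum_congr rfl fun l _ => ?_
    congr 1
    ring

/-- Lemma 3.2, vanishing case: for `h, m ∈ ℤ`, `k, M ≥ 1` with
`gcd(h,k) = 1`, setting `g₁ = gcd(M,k)` and `g₂ = gcd(M, k/g₁)`, if `g₂ ∤ 2m` then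
`G(hM², 2hmM; k) = 0`. -/
theorem gauss_sum_vanishes (h m : ℤ) (k M : ℕ) (hk : 0 < k) (hM : 0 < M)
    (hco : Int.gcd h k = 1)
    (hndvd : ¬ ((Nat.gcd M (k / Nat.gcd M k) : ℤ) ∣ 2 * m)) :
    gaussSum' (h * (M : ℤ) ^ 2) (2 * h * m * M) k = 0 := by
  obtain ⟨g₁, hg₁⟩ : ∃ g, g = Nat.gcd M k := ⟨_, rfl⟩
  rw [← hg₁] at hndvd
  obtain ⟨g₂, hg₂⟩ : ∃ g, g = Nat.gcd M (k / g₁) := ⟨_, rfl⟩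
  rw [← hg₂] at hndvd
  have hg₁pos : 0 < g₁ := hg₁ ▸ Nat.gcd_pos_of_pos_left _ hM
  have hg₂pos : 0 < g₂ := hg₂ ▸ Nat.gcd_pos_of_pos_left _ hM
  have hcop : Nat.Coprime (M / g₁) (k / g₁) := by
    rw [hg₁]; exact Nat.coprime_div_gcd_div_gcd (hg₁ ▸ hg₁pos)
  obtain ⟨A, hA⟩ : g₁ ∣ M := hg₁ ▸ Nat.gcd_dvd_left _ _
  obtain ⟨K, hK⟩ : g₁ ∣ k := hg₁ ▸ Nat.gcd_dvd_right _ _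
  have e1 : M / g₁ = A := by rw [hA]; exact Nat.mul_div_cancel_left _ hg₁pos
  have e2 : k / g₁ = K := by rw [hK]; exact Nat.mul_div_cancel_left _ hg₁pos
  rw [e1, e2] at hcop
  rw [e2] at hg₂
  obtain ⟨B, hB⟩ : g₂ ∣ M := hg₂ ▸ Nat.gcd_dvd_left _ _
  obtain ⟨s, hs⟩ : g₂ ∣ K := hg₂ ▸ Nat.gcd_dvd_right _ _
  have hks : k = g₁ * g₂ * s := by rw [hK, hs]; ring
  have hspos : 0 < s := by
    rcases Nat.eq_zero_or_pos s with h0 | h0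
    · simp [h0] at hks; omega
    · exact h0
  have hcA : IsCoprime (g₂ : ℤ) (A : ℤ) := by
    rw [Nat.isCoprime_iff_coprime]
    exact (hcop.coprime_dvd_right ⟨s, hs⟩).symm
  have hch : IsCoprime (g₂ : ℤ) h := by
    have h1 : IsCoprime h (k : ℤ) := Int.isCoprime_iff_gcd_eq_one.mpr hco
    refine (h1.of_isCoprime_of_dvd_right ?_).symm
    exact ⟨(g₁ * s : ℕ), by rw [hks]; push_cast; ring⟩
  have hnd : ¬ ((g₂ : ℤ) ∣ h * (A * (2 * m))) := fun hd =>
    hndvd (hcA.dvd_of_dvd_mul_left (hch.dvd_of_dvd_mul_left hd))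
  have c1 : (g₁ : ℂ) ≠ 0 := by exact_mod_cast hg₁pos.ne'
  have c2 : (g₂ : ℂ) ≠ 0 := by exact_mod_cast hg₂pos.ne'
  have c3 : (s : ℂ) ≠ 0 := by exact_mod_cast hspos.ne'
  have ck : (k : ℂ) ≠ 0 := by exact_mod_cast hk.ne'
  have hkC : (k : ℂ) = g₁ * g₂ * s := by exact_mod_cast hks
  have hMA : (M : ℂ) = g₁ * A := by exact_mod_cast hA
  have hMB : (M : ℂ) = g₂ * B := by exact_mod_cast hB
  let f : ℕ → ℂ := fun l => Complex.exp (2 * Real.pi * Complex.I *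
    (((h * (M : ℤ) ^ 2 : ℤ) : ℂ) * (l : ℂ) ^ 2 + ((2 * h * m * M : ℤ) : ℂ) * l) / k)
  have hper : ∀ n, f (n + k) = f n := by
    intro n
    simp only [f]
    rw [Complex.exp_eq_exp_iff_exists_int]
    refine ⟨h * M ^ 2 * (2 * n + k) + 2 * h * m * M, ?_⟩
    push_cast
    field_simp
    ring
  let z : ℂ := Complex.exp (2 * Real.pi * Complex.I * (h * (A * (2 * m))) / g₂)
  have hshift : ∀ n, f (n + s) = z * f n := by
    intro n
    simp only [f, z]
    rw [← Complex.exp_add, Complex.exp_eq_exp_iff_exists_int]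
    refine ⟨h * A * B * (2 * n + s), ?_⟩
    have q1 : (M : ℂ) ^ 2 * s / k = A * B := by
      rw [div_eq_iff ck, hkC, pow_two]
      nth_rewrite 1 [hMA]
      rw [hMB]; ring
    have q2 : (M : ℂ) * s / k = A / g₂ := by
      rw [hkC, hMA]; field_simp
    push_cast
    linear_combination (2 * Real.pi * Complex.I * h * (2 * n + s)) * q1 +
      (2 * Real.pi * Complex.I * 2 * h * m) * q2
  have hz : z ≠ 1 := by
    intro hz
    obtain ⟨n, hn⟩ := Complex.exp_eq_one_iff.mp hz
    apply hnd
    refine ⟨n, ?_⟩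
    have hpi : (2 * Real.pi * Complex.I : ℂ) ≠ 0 := Complex.two_pi_I_ne_zero
    rw [div_eq_iff c2] at hn
    have h5 : (h * (A * (2 * m)) : ℂ) = g₂ * n := by
      apply mul_left_cancel₀ hpi
      linear_combination hn
    exact_mod_cast h5
  have hsum := sum_shift f k hper s
  simp only [hshift, ← Finset.mul_sum] at hsum
  have h6 : (z - 1) * ∑ l ∈ Finset.range k, f l = 0 := by
    linear_combination hsum
  exact (mul_eq_zero.mp h6).resolve_left (sub_ne_zero.mpr hz)

end HurwitzPaper
end

section
/- Let d ∈ ℕ and let f : ℍ → ℂ satisfy f(τ+1) = f(τ) for all τ ∈ ℍ. Define f|U_d(τ) := (1/d)·∑_{j=0}^{d−1} f((τ+j)/d), and for coprime a ∈ ℤ, c ∈ ℕ define C_f(a/c) := −lim_{z→0⁺} z²·f(a/c + iz/c) (z real), assuming all these limits exist. Then for every h ∈ ℤ and k ∈ ℕ with gcd(h,k)=1, setting g_j := gcd(h+kj, d), one has C_{f|U_d}(h/k) = (1/d)·∑_{j=0}^{d−1} g_j²·C_f( ((h+kj)/g_j) / (kd/g_j) ). -/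
open scoped BigOperators Topology

namespace HurwitzPaper

/-- Lemma 2.2: let `f : ℍ → ℂ` be `1`-periodic, extended to `ℂ` as `F`
(with `F = 0` off the upper half-plane, which is irrelevant for all the limits below).
For coprime `a ∈ ℤ`, `c ∈ ℕ` suppose `C a c = -lim_{z→0⁺} z² F(a/c + iz/c)` exists.
Then, with `f|U_d(τ) = (1/d) ∑_{j=0}^{d-1} f((τ+j)/d)` and `g_j = gcd(h+kj, d)`,
`C_{f|U_d}(h/k) = (1/d) ∑_{j=0}^{d-1} g_j² C(((h+kj)/g_j) / (kd/g_j))`, i.e.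
`lim_{z→0⁺} z² (f|U_d)(h/k + iz/k) = -(1/d) ∑_j g_j² C((h+kj)/g_j) (kd/g_j)`. -/
theorem U_operator_cusp_growth (d : ℕ) (hd : 0 < d) (f : UpperHalfPlane → ℂ)
    (F : ℂ → ℂ) (hFf : ∀ (w : ℂ) (hw : 0 < w.im), F w = f ⟨w, hw⟩)
    (hper : ∀ w : ℂ, 0 < w.im → F (w + 1) = F w)
    (C : ℤ → ℕ → ℂ)
    (hC : ∀ (a : ℤ) (c : ℕ), 0 < c → Int.gcd a c = 1 →
      Filter.Tendsto (fun z : ℝ => (z : ℂ) ^ 2 * F ((a : ℂ) / c + Complex.I * z / c))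
        (𝓝[>] (0 : ℝ)) (𝓝 (-(C a c))))
    (h : ℤ) (k : ℕ) (hk : 0 < k) (hco : Int.gcd h k = 1) :
    Filter.Tendsto
      (fun z : ℝ => (z : ℂ) ^ 2 *
        ((1 / (d : ℂ)) * ∑ j ∈ Finset.range d,
          F ((((h : ℂ) / k + Complex.I * z / k) + j) / d)))
      (𝓝[>] (0 : ℝ))
      (𝓝 (-((1 / (d : ℂ)) * ∑ j ∈ Finset.range d,
        ((Int.gcd (h + k * j) d : ℕ) : ℂ) ^ 2 *
          C ((h + k * j) / (Int.gcd (h + k * j) d : ℤ))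
            (k * d / Int.gcd (h + k * j) d)))) := by
  have key : ∀ j ∈ Finset.range d, Filter.Tendsto
      (fun z : ℝ => (z : ℂ) ^ 2 * F ((((h : ℂ) / k + Complex.I * z / k) + j) / d))
      (𝓝[>] (0 : ℝ))
      (𝓝 (((Int.gcd (h + k * j) d : ℕ) : ℂ) ^ 2 *
          -(C ((h + k * j) / (Int.gcd (h + k * j) d : ℤ))
            (k * d / Int.gcd (h + k * j) d)))) := by
    intro j _
    have hg : 0 < Int.gcd (h + k * j) d :=
      Int.gcd_pos_of_ne_zero_right _ (by exact_mod_cast hd.ne')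
    have hcop : IsCoprime ((h + k * j) / (Int.gcd (h + k * j) d : ℤ))
        ((d : ℤ) / (Int.gcd (h + k * j) d : ℤ)) :=
      Int.isCoprime_iff_gcd_eq_one.mpr (Int.gcd_ediv_gcd_ediv_gcd hg)
    have hk1 : IsCoprime (h + k * j) (k : ℤ) := by
      have h0 : IsCoprime h (k : ℤ) := Int.isCoprime_iff_gcd_eq_one.mpr hco
      exact h0.add_mul_left_left _
    obtain ⟨a, ha⟩ : (Int.gcd (h + k * j) d : ℤ) ∣ (h + k * j) := Int.gcd_dvd_left ..
    obtain ⟨e, he⟩ : Int.gcd (h + k * j) d ∣ d := by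
      have := Int.gcd_dvd_right (h + k * j) (d : ℤ)
      exact_mod_cast this
    generalize Int.gcd (h + k * j) d = g at *
    have hgz : (g : ℤ) ≠ 0 := by exact_mod_cast hg.ne'
    have e1 : (h + k * j) / (g : ℤ) = a := by
      rw [ha]; exact Int.mul_ediv_cancel_left _ hgz
    have e2 : (d : ℤ) / (g : ℤ) = e := by
      rw [he]; push_cast; exact Int.mul_ediv_cancel_left _ hgz
    have e3 : k * d / g = k * e := by
      rw [he, show k * (g * e) = g * (k * e) by ring]
      exact Nat.mul_div_cancel_left _ hg
    rw [e1, e2] at hcop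
    rw [e1, e3]
    have hepos : 0 < e := by
      rcases Nat.eq_zero_or_pos e with h0 | h0
      · subst h0; omega
      · exact h0
    have hak : IsCoprime a (k : ℤ) := by
      rw [ha] at hk1; exact hk1.of_mul_left_right
    have hfin : Int.gcd a ((k * e : ℕ) : ℤ) = 1 := by
      rw [← Int.isCoprime_iff_gcd_eq_one]
      push_cast
      exact hak.mul_right hcop
    have hl := hC a (k * e) (Nat.mul_pos hk hepos) hfin
    have hgR : (0 : ℝ) < g := by exact_mod_cast hg
    have hs : Filter.Tendsto (fun z : ℝ => z / g) (𝓝[>] (0 : ℝ)) (𝓝[>] (0 : ℝ)) := by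
      apply tendsto_nhdsWithin_of_tendsto_nhds_of_eventually_within
      · have : Filter.Tendsto (fun z : ℝ => z / g) (𝓝 0) (𝓝 (0 / g)) :=
          (continuous_id.div_const _).tendsto 0
        rw [zero_div] at this
        exact this.mono_left nhdsWithin_le_nhds
      · filter_upwards [self_mem_nhdsWithin] with z hz
        exact div_pos hz hgR
    refine ((hl.comp hs).const_mul ((g : ℂ) ^ 2)).congr ?_
    intro z
    have hgC : (g : ℂ) ≠ 0 := by exact_mod_cast hg.ne'
    have hkC : (k : ℂ) ≠ 0 := by exact_mod_cast hk.ne'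
    have heC : (e : ℂ) ≠ 0 := by exact_mod_cast hepos.ne'
    have haC : (h : ℂ) + k * j = g * a := by exact_mod_cast ha
    have hdC : (d : ℂ) = g * e := by exact_mod_cast he
    have harg : (a : ℂ) / ((k * e : ℕ) : ℂ) + Complex.I * ((z / g : ℝ) : ℂ) / ((k * e : ℕ) : ℂ)
        = (((h : ℂ) / k + Complex.I * z / k) + j) / d := by
      rw [hdC, eq_sub_of_add_eq haC]
      push_cast
      field_simp
      ring
    simp only [Function.comp]
    rw [harg]
    push_cast
    field_simp
  have hsum := ((tendsto_finsetSum _ key).const_mul (1 / (d : ℂ)))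
  convert hsum using 2
  · rw [Finset.mul_sum, Finset.mul_sum, Finset.mul_sum]
    exact Finset.sum_congr rfl fun _ _ => by ring
  · simp only [mul_neg, Finset.sum_neg_distrib]

end HurwitzPaper
end
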